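/- arXiv:1707.05105 — 5 statements merged into one kernel-verified Lean document; each statement's English description precedes it below -/
import Mathlib

section
/- Let G be a group, and suppose B < G where B is an elementary abelian 2-group of rank k ≥ 6, and x ∈ G centralises B. Let T be the Imrich generating set for B with respect to some generating tuple, and let S be a generating set for G such that S = [(Bx ∖ Tx) ∖ {x}] ∪ X, where X ⊆ G ∖ ⟨B, x⟩ with |X| ≤ 17. Then Aut(Cay(G,S))_1 fixes B pointwise and fixes x. -/
section Defs

variable {G : Type*} [Group G]

/-- A permutation of `G` is an automorphism of the Cayley digraph `Cay(G,S)`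
(whose arcs are pairs `(x,y)` with `y * x⁻¹ ∈ S`). -/
def IsCayleyAut (S : Set G) (φ : Equiv.Perm G) : Prop :=
  ∀ x y : G, y * x⁻¹ ∈ S ↔ φ y * (φ x)⁻¹ ∈ S

/-- `Cay(G,S)` is a digraphical regular representation of `G`: every automorphism of the
Cayley digraph is a right translation. -/
def IsCayleyDRR (S : Set G) : Prop :=
  ∀ φ : Equiv.Perm G, IsCayleyAut S φ → ∃ g : G, ∀ v : G, φ v = v * g

/-- `G` admits an oriented regular representation. -/
def HasORR (H : Type*) [Group H] : Prop :=
  ∃ S : Set H, S ∩ S⁻¹ = ∅ ∧ IsCayleyDRR S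

/-- `G` is a generalised dihedral group: it is generated by an abelian subgroup `A`
together with an involution `τ` inverting every element of `A`. -/
def IsGeneralizedDihedral (H : Type*) [Group H] : Prop :=
  ∃ A : Subgroup H, (∀ a ∈ A, ∀ b ∈ A, a * b = b * a) ∧
    ∃ τ : H, τ ∉ A ∧ τ * τ = 1 ∧ (∀ a ∈ A, τ * a * τ = a⁻¹) ∧
      ∀ g : H, g ∈ A ∨ ∃ a ∈ A, g = a * τ

/-- The Imrich connection set with respect to the generating tuple `z 0, …, z (k-1)`. -/
def imrichSet (k : ℕ) (z : ℕ → G) : Set G :=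
  z '' Set.Iio k ∪ {g | ∃ i, i + 1 < k ∧ g = z i * z (i + 1)} ∪
    {z 0 * z 1 * z (k - 3) * z (k - 2), z 0 * z 1 * z (k - 2) * z (k - 1)}

end Defs

section CosetDefs

variable {G : Type*} [Group G]

/-- The right coset `B * x` as a subset of `G`. -/
def rightCosetSet (B : Subgroup G) (x : G) : Set G := (· * x) '' (B : Set G)

/-- In `Cay(G,S)`, `w` is a mutual inneighbour of `u` and `v` via elements of
`X` (a subset of the connection set): both `u * w⁻¹ ∈ X` and `v * w⁻¹ ∈ X`. -/
def IsMutualInNbrVia (X : Set G) (u v w : G) : Prop := u * w⁻¹ ∈ X ∧ v * w⁻¹ ∈ X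

/-- `u` and `v` have at least three mutual inneighbours via elements of `X`. -/
def HasThreeMutualInNbrsVia (X : Set G) (u v : G) : Prop :=
  ∃ w₁ w₂ w₃ : G, w₁ ≠ w₂ ∧ w₁ ≠ w₃ ∧ w₂ ≠ w₃ ∧
    IsMutualInNbrVia X u v w₁ ∧ IsMutualInNbrVia X u v w₂ ∧ IsMutualInNbrVia X u v w₃

end CosetDefs

namespace ImrichAux


/-- The index `j` lies in the support of the element of `T ∪ {1}` with code `p`. -/
def Mem (k p j : ℕ) : Prop :=
  (p < 2 * k ∧ p ≠ 0 ∧ (p = 2 * j ∨ p = 2 * j + 1 ∨ p = 2 * j + 2)) ∨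
  (p = 2 * k ∧ (j = 0 ∨ j = 1 ∨ j + 3 = k ∨ j + 2 = k)) ∨
  (p = 2 * k + 1 ∧ (j = 0 ∨ j = 1 ∨ j + 2 = k ∨ j + 1 = k))

/-- Sorted quadruples of codes whose sum is zero. -/
def Quad (k p q r s : ℕ) : Prop :=
  (p = 0 ∧ q % 2 = 1 ∧ r = q + 1 ∧ s = q + 2 ∧ s < 2 * k) ∨
  (p % 2 = 1 ∧ q = p + 1 ∧ r = p + 3 ∧ s = p + 4 ∧ s < 2 * k) ∨
  (p = 0 ∧ q = 2 ∧ r + 4 = 2 * k ∧ s = 2 * k) ∨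
  (p = 0 ∧ q = 2 ∧ r + 2 = 2 * k ∧ s = 2 * k + 1) ∨
  (p = 1 ∧ q = 3 ∧ r + 4 = 2 * k ∧ s = 2 * k) ∨
  (p = 1 ∧ q = 3 ∧ r + 2 = 2 * k ∧ s = 2 * k + 1) ∨
  (p = 2 ∧ q + 5 = 2 * k ∧ r + 3 = 2 * k ∧ s = 2 * k) ∨
  (p = 2 ∧ q + 3 = 2 * k ∧ r + 1 = 2 * k ∧ s = 2 * k + 1) ∨
  (p + 5 = 2 * k ∧ q + 1 = 2 * k ∧ r = 2 * k ∧ s = 2 * k + 1) ∨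
  (p + 4 = 2 * k ∧ q + 2 = 2 * k ∧ r = 2 * k ∧ s = 2 * k + 1)

/-- The four codes have sum zero. -/
def Zero4 (k p q r s : ℕ) : Prop :=
  ∀ j < k, ((Mem k p j ↔ Mem k q j) ↔ (Mem k r j ↔ Mem k s j))

theorem mem_small {k p j : ℕ} (hp : p < 2 * k) :
    Mem k p j ↔ p ≠ 0 ∧ (p = 2 * j ∨ p = 2 * j + 1 ∨ p = 2 * j + 2) := by
  unfold Mem; omega
theorem mem_a {k j : ℕ} :
    Mem k (2 * k) j ↔ (j = 0 ∨ j = 1 ∨ j + 3 = k ∨ j + 2 = k) := by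
  unfold Mem; omega
theorem mem_c {k j : ℕ} :
    Mem k (2 * k + 1) j ↔ (j = 0 ∨ j = 1 ∨ j + 2 = k ∨ j + 1 = k) := by
  unfold Mem; omega

theorem quad_case1 {k p q r s : ℕ} (hk : 6 ≤ k) (hpq : p < q) (hqr : q < r)
    (hrs : r < s) (hs : s < 2 * k) (h : Zero4 k p q r s) : Quad k p q r s := by
  have H : ∀ j < k, _ := fun j hj => h j hj
  simp only [mem_small hs, mem_small (hrs.trans hs), mem_small (hqr.trans (hrs.trans hs)),
    mem_small (hpq.trans (hqr.trans (hrs.trans hs)))] at H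
  have h5 := H (s / 2) (by omega)
  by_cases hp : p = 0
  · have h0 := H ((q - 1) / 2) (by omega)
    have hq : q % 2 = 1 ∧ r = q + 1 := by
      clear h5; omega
    have h1 := H ((q - 1) / 2 + 1) (by omega)
    left
    clear h0
    have : s = q + 2 ∨ s = q + 3 := by clear h5; omega
    omega
  · have h0 := H ((p - 1) / 2) (by omega)
    have hq : p % 2 = 1 ∧ q = p + 1 := by
      clear h5; omega
    clear h0
    have h1 := H ((p - 1) / 2 + 1) (by omega)
    have hr : r = p + 3 := by omega
    clear h1
    have h2 := H ((p - 1) / 2 + 2) (by omega)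
    right; left
    have : s = p + 4 ∨ s = p + 5 := by clear h5; omega
    omega

theorem quad_case2 {k p q r : ℕ} (hk : 6 ≤ k) (hpq : p < q) (hqr : q < r)
    (hrs : r < 2 * k) (h : Zero4 k p q r (2 * k)) : Quad k p q r (2 * k) := by
  have H : ∀ j < k, _ := fun j hj => h j hj
  simp only [mem_a, mem_small hrs, mem_small (hqr.trans hrs),
    mem_small (hpq.trans (hqr.trans hrs))] at H
  have h0 := H 0 (by omega)
  have h1 := H 1 (by omega)
  have h2 := H 2 (by omega)
  have c1 : (p = 0 ∧ q = 2 ∧ 5 ≤ r) ∨ (p = 0 ∧ q = 1 ∧ (r = 3 ∨ r = 4)) ∨ 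
      (p = 1 ∧ (q = 3 ∨ q = 4) ∧ 5 ≤ r) ∨ (p = 2 ∧ q = 3 ∧ r = 4) ∨ (p = 2 ∧ 5 ≤ q) := by
    clear h2; omega
  clear h0 h1
  obtain ⟨n, rfl⟩ : ∃ n, k = n + 6 := ⟨k - 6, by omega⟩
  have h3 := H (n + 2) (by omega)
  have h4 := H (n + 3) (by omega)
  have h5 := H (n + 4) (by omega)
  have h6 := H (n + 5) (by omega)
  unfold Quad
  rcases c1 with ⟨rfl, rfl, c⟩ | ⟨rfl, rfl, rfl | rfl⟩ | ⟨rfl, rfl | rfl, c⟩ |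
      ⟨rfl, rfl, rfl⟩ | ⟨rfl, c⟩
  case inr.inr.inr.inr =>
    have h7 := H (q / 2) (by omega)
    have e : (r = 2 * n + 9 ∨ r = 2 * n + 8) := by
      clear H h h2 h7 h3
      omega
    rcases e with rfl | rfl
    · simp at h3 h4 h5 h6
      clear H h h2
      grind (splits := 30)
    · simp at h3 h4 h5 h6
      clear H h h2
      grind (splits := 30)
  all_goals simp at h2 h3 h4 h5 h6 <;> clear H h <;> grind (splits := 30)

theorem quad_case3 {k p q r : ℕ} (hk : 6 ≤ k) (hpq : p < q) (hqr : q < r)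
    (hrs : r < 2 * k) (h : Zero4 k p q r (2 * k + 1)) : Quad k p q r (2 * k + 1) := by
  have H : ∀ j < k, _ := fun j hj => h j hj
  simp only [mem_c, mem_small hrs, mem_small (hqr.trans hrs),
    mem_small (hpq.trans (hqr.trans hrs))] at H
  have h0 := H 0 (by omega)
  have h1 := H 1 (by omega)
  have h2 := H 2 (by omega)
  have c1 : (p = 0 ∧ q = 2 ∧ 5 ≤ r) ∨ (p = 0 ∧ q = 1 ∧ (r = 3 ∨ r = 4)) ∨ 
      (p = 1 ∧ (q = 3 ∨ q = 4) ∧ 5 ≤ r) ∨ (p = 2 ∧ q = 3 ∧ r = 4) ∨ (p = 2 ∧ 5 ≤ q) := by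
    clear h2; omega
  clear h0 h1
  obtain ⟨n, rfl⟩ : ∃ n, k = n + 6 := ⟨k - 6, by omega⟩
  have h4 := H (n + 3) (by omega)
  have h5 := H (n + 4) (by omega)
  have h6 := H (n + 5) (by omega)
  unfold Quad
  rcases c1 with ⟨rfl, rfl, c⟩ | ⟨rfl, rfl, rfl | rfl⟩ | ⟨rfl, rfl | rfl, c⟩ |
      ⟨rfl, rfl, rfl⟩ | ⟨rfl, c⟩
  case inr.inr.inr.inr =>
    have h7 := H (q / 2) (by omega)
    have e : (r = 2 * n + 11 ∨ r = 2 * n + 10) := by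
      clear H h h2 h7 
      omega
    rcases e with rfl | rfl
    · simp at h4 h5 h6
      clear H h h2
      grind (splits := 30)
    · simp at h4 h5 h6
      clear H h h2
      grind (splits := 30)
  all_goals simp at h2 h4 h5 h6 <;> clear H h <;> grind (splits := 30)

theorem quad_case4 {k p q : ℕ} (hk : 6 ≤ k) (hpq : p < q)
    (hrs : q < 2 * k) (h : Zero4 k p q (2 * k) (2 * k + 1)) :
    Quad k p q (2 * k) (2 * k + 1) := by
  have H : ∀ j < k, _ := fun j hj => h j hj
  simp only [mem_a, mem_c, mem_small hrs, mem_small (hpq.trans hrs)] at H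
  obtain ⟨n, rfl⟩ : ∃ n, k = n + 6 := ⟨k - 6, by omega⟩
  have h3 := H (n + 2) (by omega)
  have h4 := H (n + 3) (by omega)
  have h5 := H (n + 4) (by omega)
  have h6 := H (n + 5) (by omega)
  simp at h3 h4 h5 h6
  unfold Quad
  clear H h
  grind (splits := 30)

theorem quad_of_zero4 {k p q r s : ℕ} (hk : 6 ≤ k) (hpq : p < q) (hqr : q < r)
    (hrs : r < s) (hs : s < 2 * k + 2) (h : Zero4 k p q r s) : Quad k p q r s := by
  by_cases h1 : s < 2 * k
  · exact quad_case1 hk hpq hqr hrs h1 h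
  by_cases h2 : s = 2 * k
  · subst h2; exact quad_case2 hk hpq hqr hrs h
  obtain rfl : s = 2 * k + 1 := by omega
  by_cases h3 : r < 2 * k
  · exact quad_case3 hk hpq hqr h3 h
  obtain rfl : r = 2 * k := by omega
  exact quad_case4 hk hpq hqr h

theorem code_inj {k p q : ℕ} (hk : 6 ≤ k) (hp : p < 2 * k + 2) (hq : q < 2 * k + 2)
    (h : ∀ j < k, (Mem k p j ↔ Mem k q j)) : p = q := by
  wlog hpq : p < q generalizing p q
  · rcases Nat.lt_or_ge q p with h1 | h1
    · exact (this hq hp (fun j hj => (h j hj).symm) h1).symm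
    · omega
  exfalso
  have h0 := h 0 (by omega)
  have h1 := h 1 (by omega)
  have h2 := h (k - 2) (by omega)
  have h3 := h (k - 1) (by omega)
  have h4 := h (k - 3) (by omega)
  by_cases c : q < 2 * k
  · clear h0 h1 h2 h3 h4
    have h5 := h (q / 2) (by omega)
    have h6 := h ((p - 1) / 2) (by omega)
    rw [mem_small c, mem_small (hpq.trans c)] at h5 h6
    omega
  · obtain rfl | rfl : q = 2 * k ∨ q = 2 * k + 1 := by omega
    · simp only [mem_a, mem_small hpq] at h0 h1 h2 h3 h4
      clear h; grind (splits := 30)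
    · by_cases c : p < 2 * k
      · simp only [mem_c, mem_small c] at h0 h1 h2 h3 h4
        clear h; grind (splits := 30)
      · obtain rfl : p = 2 * k := by omega
        simp only [mem_a, mem_c] at h4
        omega

theorem zero4_of_quad {k p q r s : ℕ} (hk : 6 ≤ k) (h : Quad k p q r s) : Zero4 k p q r s := by
  intro j hj
  unfold Quad at h
  rcases h with h | h | h | h | h | h | h | h | h | h
  · obtain ⟨rfl, h1, rfl, rfl, h2⟩ := h
    rw [mem_small h2, mem_small (by omega), mem_small (by omega), mem_small (by omega)]
    omega
  · obtain ⟨h1, rfl, rfl, rfl, h2⟩ := h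
    rw [mem_small h2, mem_small (by omega), mem_small (by omega), mem_small (by omega)]
    omega
  · obtain ⟨rfl, rfl, h1, rfl⟩ := h
    rw [mem_a, mem_small (by omega), mem_small (by omega), mem_small (by omega)]
    omega
  · obtain ⟨rfl, rfl, h1, rfl⟩ := h
    rw [mem_c, mem_small (by omega), mem_small (by omega), mem_small (by omega)]
    omega
  · obtain ⟨rfl, rfl, h1, rfl⟩ := h
    rw [mem_a, mem_small (by omega), mem_small (by omega), mem_small (by omega)]
    omega
  · obtain ⟨rfl, rfl, h1, rfl⟩ := h
    rw [mem_c, mem_small (by omega), mem_small (by omega), mem_small (by omega)]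
    omega
  · obtain ⟨rfl, h2, h1, rfl⟩ := h
    rw [mem_a, mem_small (by omega), mem_small (by omega), mem_small (by omega)]
    omega
  · obtain ⟨rfl, h2, h1, rfl⟩ := h
    rw [mem_c, mem_small (by omega), mem_small (by omega), mem_small (by omega)]
    omega
  · obtain ⟨h1, h2, rfl, rfl⟩ := h
    rw [mem_a, mem_c, mem_small (by omega), mem_small (by omega)]
    omega
  · obtain ⟨h1, h2, rfl, rfl⟩ := h
    rw [mem_a, mem_c, mem_small (by omega), mem_small (by omega)]
    omega

/-- The unordered quadruple consisting of `p < q` and `r < s` has sum zero. -/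
def Opt (k p q r s : ℕ) : Prop :=
  Quad k p q r s ∨ Quad k p r q s ∨ Quad k p r s q ∨ Quad k r p q s ∨ Quad k r p s q ∨
    Quad k r s p q

theorem Zero4.swap23 {k p q r s : ℕ} (h : Zero4 k p q r s) : Zero4 k p r q s := by
  intro j hj; have := h j hj; grind
theorem Zero4.swap34 {k p q r s : ℕ} (h : Zero4 k p q r s) : Zero4 k p q s r := by
  intro j hj; have := h j hj; grind
theorem Zero4.swap12 {k p q r s : ℕ} (h : Zero4 k p q r s) : Zero4 k q p r s := by
  intro j hj; have := h j hj; grind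
theorem Zero4.swap {k p q r s : ℕ} (h : Zero4 k p q r s) : Zero4 k r s p q := by
  intro j hj; have := h j hj; grind

theorem Opt.zero4 {k p q r s : ℕ} (hk : 6 ≤ k) (h : Opt k p q r s) : Zero4 k p q r s := by
  rcases h with h | h | h | h | h | h
  · exact zero4_of_quad hk h
  · exact (zero4_of_quad hk h).swap23
  · exact (zero4_of_quad hk h).swap34.swap23
  · exact (zero4_of_quad hk h).swap12.swap23
  · exact (zero4_of_quad hk h).swap12.swap34.swap23
  · exact (zero4_of_quad hk h).swap

theorem opt_of_zero4 {k p q r s : ℕ} (hk : 6 ≤ k) (hpq : p < q) (hrs : r < s)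
    (hq : q < 2 * k + 2) (hs : s < 2 * k + 2) (h1 : p ≠ r) (h2 : p ≠ s) (h3 : q ≠ r) (h4 : q ≠ s)
    (h : Zero4 k p q r s) : Opt k p q r s := by
  unfold Opt
  rcases Nat.lt_or_gt_of_ne h1 with c1 | c1
  · rcases Nat.lt_or_gt_of_ne h3 with c2 | c2
    · exact Or.inl (quad_of_zero4 hk hpq c2 hrs hs h)
    · rcases Nat.lt_or_gt_of_ne h4 with c3 | c3
      · exact Or.inr (Or.inl (quad_of_zero4 hk c1 c2 c3 hs h.swap23))
      · exact Or.inr (Or.inr (Or.inl (quad_of_zero4 hk c1 hrs c3 hq h.swap23.swap34)))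
  · rcases Nat.lt_or_gt_of_ne h2 with c2 | c2
    · rcases Nat.lt_or_gt_of_ne h4 with c3 | c3
      · exact Or.inr (Or.inr (Or.inr (Or.inl (quad_of_zero4 hk c1 hpq c3 hs h.swap23.swap12))))
      · exact Or.inr (Or.inr (Or.inr (Or.inr (Or.inl
          (quad_of_zero4 hk c1 c2 c3 hq h.swap23.swap34.swap12)))))
    · exact Or.inr (Or.inr (Or.inr (Or.inr (Or.inr (quad_of_zero4 hk hrs c2 hpq hq h.swap)))))

/-- Pairs of codes lying in exactly three zero-sum quadruples. -/
def F8 (k p q : ℕ) : Prop :=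
  (p = 0 ∧ q = 2) ∨ (p = 1 ∧ q = 3) ∨ (p + 4 = 2 * k ∧ q = 2 * k) ∨
    (p + 2 = 2 * k ∧ q = 2 * k + 1)

/-- Pairs of codes lying in exactly two zero-sum quadruples. -/
def F6 (k p q : ℕ) : Prop :=
  (p = 0 ∧ q % 2 = 1 ∧ 3 ≤ q ∧ q + 3 ≤ 2 * k) ∨
  (p % 2 = 1 ∧ q = p + 1 ∧ p + 5 ≤ 2 * k) ∨
  (p % 2 = 0 ∧ 4 ≤ p ∧ q = p + 1 ∧ p + 2 ≤ 2 * k) ∨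
  (p + 5 = 2 * k ∧ q + 1 = 2 * k) ∨
  (p + 4 = 2 * k ∧ q + 2 = 2 * k) ∨
  (p = 2 * k ∧ q = 2 * k + 1) ∨
  (p = 0 ∧ q + 4 = 2 * k) ∨
  (p + 5 = 2 * k ∧ q + 3 = 2 * k) ∨
  (p = 2 ∧ q = 2 * k) ∨
  (p = 0 ∧ q + 2 = 2 * k) ∨
  (p + 3 = 2 * k ∧ q + 1 = 2 * k) ∨
  (p = 2 ∧ q = 2 * k + 1) ∨
  (p + 5 = 2 * k ∧ q = 2 * k) ∨
  (p + 1 = 2 * k ∧ q = 2 * k + 1) ∨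
  (p = 2 ∧ q + 3 = 2 * k)

/-- Two given pairs are the only ones completing `p, q` to a zero-sum quadruple. -/
def Two (k p q r1 s1 r2 s2 : ℕ) : Prop :=
  Opt k p q r1 s1 ∧ Opt k p q r2 s2 ∧ (r1 ≠ r2) ∧ r1 ≠ s2 ∧ s1 ≠ r2 ∧ s1 ≠ s2 ∧
  ∀ r s, Opt k p q r s → (r = r1 ∧ s = s1) ∨ (r = r2 ∧ s = s2)

theorem opt1 {k p q r s : ℕ} (h : Quad k p q r s) : Opt k p q r s :=
  Or.inl h

theorem opt2 {k p q r s : ℕ} (h : Quad k p r q s) : Opt k p q r s :=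
  Or.inr (Or.inl h)

theorem opt3 {k p q r s : ℕ} (h : Quad k p r s q) : Opt k p q r s :=
  Or.inr (Or.inr (Or.inl h))

theorem opt4 {k p q r s : ℕ} (h : Quad k r p q s) : Opt k p q r s :=
  Or.inr (Or.inr (Or.inr (Or.inl h)))

theorem opt5 {k p q r s : ℕ} (h : Quad k r p s q) : Opt k p q r s :=
  Or.inr (Or.inr (Or.inr (Or.inr (Or.inl h))))

theorem opt6 {k p q r s : ℕ} (h : Quad k r s p q) : Opt k p q r s :=
  Or.inr (Or.inr (Or.inr (Or.inr (Or.inr (h)))))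

theorem quad1 {k p q r s : ℕ} (h : p = 0 ∧ q % 2 = 1 ∧ r = q + 1 ∧ s = q + 2 ∧ s < 2 * k) :
    Quad k p q r s :=
  Or.inl h

theorem quad2 {k p q r s : ℕ} (h : p % 2 = 1 ∧ q = p + 1 ∧ r = p + 3 ∧ s = p + 4 ∧ s < 2 * k) :
    Quad k p q r s :=
  Or.inr (Or.inl h)

theorem quad3 {k p q r s : ℕ} (h : p = 0 ∧ q = 2 ∧ r + 4 = 2 * k ∧ s = 2 * k) :
    Quad k p q r s :=
  Or.inr (Or.inr (Or.inl h))

theorem quad4 {k p q r s : ℕ} (h : p = 0 ∧ q = 2 ∧ r + 2 = 2 * k ∧ s = 2 * k + 1) :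
    Quad k p q r s :=
  Or.inr (Or.inr (Or.inr (Or.inl h)))

theorem quad5 {k p q r s : ℕ} (h : p = 1 ∧ q = 3 ∧ r + 4 = 2 * k ∧ s = 2 * k) :
    Quad k p q r s :=
  Or.inr (Or.inr (Or.inr (Or.inr (Or.inl h))))

theorem quad6 {k p q r s : ℕ} (h : p = 1 ∧ q = 3 ∧ r + 2 = 2 * k ∧ s = 2 * k + 1) :
    Quad k p q r s :=
  Or.inr (Or.inr (Or.inr (Or.inr (Or.inr (Or.inl h)))))

theorem quad7 {k p q r s : ℕ} (h : p = 2 ∧ q + 5 = 2 * k ∧ r + 3 = 2 * k ∧ s = 2 * k) :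
    Quad k p q r s :=
  Or.inr (Or.inr (Or.inr (Or.inr (Or.inr (Or.inr (Or.inl h))))))

theorem quad8 {k p q r s : ℕ} (h : p = 2 ∧ q + 3 = 2 * k ∧ r + 1 = 2 * k ∧ s = 2 * k + 1) :
    Quad k p q r s :=
  Or.inr (Or.inr (Or.inr (Or.inr (Or.inr (Or.inr (Or.inr (Or.inl h)))))))

theorem quad9 {k p q r s : ℕ} (h : p + 5 = 2 * k ∧ q + 1 = 2 * k ∧ r = 2 * k ∧ s = 2 * k + 1) :
    Quad k p q r s :=
  Or.inr (Or.inr (Or.inr (Or.inr (Or.inr (Or.inr (Or.inr (Or.inr (Or.inl h))))))))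

theorem quad10 {k p q r s : ℕ} (h : p + 4 = 2 * k ∧ q + 2 = 2 * k ∧ r = 2 * k ∧ s = 2 * k + 1) :
    Quad k p q r s :=
  Or.inr (Or.inr (Or.inr (Or.inr (Or.inr (Or.inr (Or.inr (Or.inr (Or.inr (h)))))))))

set_option maxHeartbeats 1000000 in
theorem two1 {k p q : ℕ} (hk : 6 ≤ k) (h : p = 0 ∧ q % 2 = 1 ∧ 3 ≤ q ∧ q + 3 ≤ 2 * k) :
    Two k p q (q + 1) (q + 2) (q - 2) (q - 1) := by
  refine ⟨opt1 (quad1 (by omega)), opt3 (quad1 (by omega)),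
    by omega, by omega, by omega, by omega, ?_⟩
  intro r s h'
  unfold Opt at h'
  rcases h' with h' | h' | h' | h' | h' | h' <;> unfold Quad at h' <;>
    rcases h' with h' | h' | h' | h' | h' | h' | h' | h' | h' | h' <;>
    first | (exfalso; omega) | (left; omega) | (right; omega)

set_option maxHeartbeats 1000000 in
theorem two2 {k p q : ℕ} (hk : 6 ≤ k) (h : p % 2 = 1 ∧ q = p + 1 ∧ p + 5 ≤ 2 * k) :
    Two k p q (0) (p + 2) (p + 3) (p + 4) := by
  refine ⟨opt4 (quad1 (by omega)), opt1 (quad2 (by omega)),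
    by omega, by omega, by omega, by omega, ?_⟩
  intro r s h'
  unfold Opt at h'
  rcases h' with h' | h' | h' | h' | h' | h' <;> unfold Quad at h' <;>
    rcases h' with h' | h' | h' | h' | h' | h' | h' | h' | h' | h' <;>
    first | (exfalso; omega) | (left; omega) | (right; omega)

set_option maxHeartbeats 1000000 in
theorem two3 {k p q : ℕ} (hk : 6 ≤ k) (h : p % 2 = 0 ∧ 4 ≤ p ∧ q = p + 1 ∧ p + 2 ≤ 2 * k) :
    Two k p q (0) (p - 1) (p - 3) (p - 2) := by
  refine ⟨opt6 (quad1 (by omega)), opt6 (quad2 (by omega)),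
    by omega, by omega, by omega, by omega, ?_⟩
  intro r s h'
  unfold Opt at h'
  rcases h' with h' | h' | h' | h' | h' | h' <;> unfold Quad at h' <;>
    rcases h' with h' | h' | h' | h' | h' | h' | h' | h' | h' | h' <;>
    first | (exfalso; omega) | (left; omega) | (right; omega)

set_option maxHeartbeats 1000000 in
theorem two4 {k p q : ℕ} (hk : 6 ≤ k) (h : p + 5 = 2 * k ∧ q + 1 = 2 * k) :
    Two k p q (p + 1) (p + 3) (2 * k) (2 * k + 1) := by
  refine ⟨opt3 (quad2 (by omega)), opt1 (quad9 (by omega)),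
    by omega, by omega, by omega, by omega, ?_⟩
  intro r s h'
  unfold Opt at h'
  rcases h' with h' | h' | h' | h' | h' | h' <;> unfold Quad at h' <;>
    rcases h' with h' | h' | h' | h' | h' | h' | h' | h' | h' | h' <;>
    first | (exfalso; omega) | (left; omega) | (right; omega)

set_option maxHeartbeats 1000000 in
theorem two5 {k p q : ℕ} (hk : 6 ≤ k) (h : p + 4 = 2 * k ∧ q + 2 = 2 * k) :
    Two k p q (p - 1) (p + 3) (2 * k) (2 * k + 1) := by
  refine ⟨opt4 (quad2 (by omega)), opt1 (quad10 (by omega)),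
    by omega, by omega, by omega, by omega, ?_⟩
  intro r s h'
  unfold Opt at h'
  rcases h' with h' | h' | h' | h' | h' | h' <;> unfold Quad at h' <;>
    rcases h' with h' | h' | h' | h' | h' | h' | h' | h' | h' | h' <;>
    first | (exfalso; omega) | (left; omega) | (right; omega)

set_option maxHeartbeats 1000000 in
theorem two6 {k p q : ℕ} (hk : 6 ≤ k) (h : p = 2 * k ∧ q = 2 * k + 1) :
    Two k p q (2 * k - 5) (2 * k - 1) (2 * k - 4) (2 * k - 2) := by
  refine ⟨opt6 (quad9 (by omega)), opt6 (quad10 (by omega)),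
    by omega, by omega, by omega, by omega, ?_⟩
  intro r s h'
  unfold Opt at h'
  rcases h' with h' | h' | h' | h' | h' | h' <;> unfold Quad at h' <;>
    rcases h' with h' | h' | h' | h' | h' | h' | h' | h' | h' | h' <;>
    first | (exfalso; omega) | (left; omega) | (right; omega)

set_option maxHeartbeats 1000000 in
theorem two7 {k p q : ℕ} (hk : 6 ≤ k) (h : p = 0 ∧ q + 4 = 2 * k) :
    Two k p q (2 * k - 5) (2 * k - 3) (2) (2 * k) := by
  refine ⟨opt2 (quad1 (by omega)), opt2 (quad3 (by omega)),
    by omega, by omega, by omega, by omega, ?_⟩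
  intro r s h'
  unfold Opt at h'
  rcases h' with h' | h' | h' | h' | h' | h' <;> unfold Quad at h' <;>
    rcases h' with h' | h' | h' | h' | h' | h' | h' | h' | h' | h' <;>
    first | (exfalso; omega) | (left; omega) | (right; omega)

set_option maxHeartbeats 1000000 in
theorem two8 {k p q : ℕ} (hk : 6 ≤ k) (h : p + 5 = 2 * k ∧ q + 3 = 2 * k) :
    Two k p q (0) (2 * k - 4) (2) (2 * k) := by
  refine ⟨opt5 (quad1 (by omega)), opt4 (quad7 (by omega)),
    by omega, by omega, by omega, by omega, ?_⟩
  intro r s h'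
  unfold Opt at h'
  rcases h' with h' | h' | h' | h' | h' | h' <;> unfold Quad at h' <;>
    rcases h' with h' | h' | h' | h' | h' | h' | h' | h' | h' | h' <;>
    first | (exfalso; omega) | (left; omega) | (right; omega)

set_option maxHeartbeats 1000000 in
theorem two9 {k p q : ℕ} (hk : 6 ≤ k) (h : p = 2 ∧ q = 2 * k) :
    Two k p q (0) (2 * k - 4) (2 * k - 5) (2 * k - 3) := by
  refine ⟨opt5 (quad3 (by omega)), opt3 (quad7 (by omega)),
    by omega, by omega, by omega, by omega, ?_⟩
  intro r s h'
  unfold Opt at h'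
  rcases h' with h' | h' | h' | h' | h' | h' <;> unfold Quad at h' <;>
    rcases h' with h' | h' | h' | h' | h' | h' | h' | h' | h' | h' <;>
    first | (exfalso; omega) | (left; omega) | (right; omega)

set_option maxHeartbeats 1000000 in
theorem two10 {k p q : ℕ} (hk : 6 ≤ k) (h : p = 0 ∧ q + 2 = 2 * k) :
    Two k p q (2 * k - 3) (2 * k - 1) (2) (2 * k + 1) := by
  refine ⟨opt2 (quad1 (by omega)), opt2 (quad4 (by omega)),
    by omega, by omega, by omega, by omega, ?_⟩
  intro r s h'
  unfold Opt at h'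
  rcases h' with h' | h' | h' | h' | h' | h' <;> unfold Quad at h' <;>
    rcases h' with h' | h' | h' | h' | h' | h' | h' | h' | h' | h' <;>
    first | (exfalso; omega) | (left; omega) | (right; omega)

set_option maxHeartbeats 1000000 in
theorem two11 {k p q : ℕ} (hk : 6 ≤ k) (h : p + 3 = 2 * k ∧ q + 1 = 2 * k) :
    Two k p q (0) (2 * k - 2) (2) (2 * k + 1) := by
  refine ⟨opt5 (quad1 (by omega)), opt4 (quad8 (by omega)),
    by omega, by omega, by omega, by omega, ?_⟩
  intro r s h'
  unfold Opt at h'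
  rcases h' with h' | h' | h' | h' | h' | h' <;> unfold Quad at h' <;>
    rcases h' with h' | h' | h' | h' | h' | h' | h' | h' | h' | h' <;>
    first | (exfalso; omega) | (left; omega) | (right; omega)

set_option maxHeartbeats 1000000 in
theorem two12 {k p q : ℕ} (hk : 6 ≤ k) (h : p = 2 ∧ q = 2 * k + 1) :
    Two k p q (0) (2 * k - 2) (2 * k - 3) (2 * k - 1) := by
  refine ⟨opt5 (quad4 (by omega)), opt3 (quad8 (by omega)),
    by omega, by omega, by omega, by omega, ?_⟩
  intro r s h'
  unfold Opt at h'
  rcases h' with h' | h' | h' | h' | h' | h' <;> unfold Quad at h' <;>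
    rcases h' with h' | h' | h' | h' | h' | h' | h' | h' | h' | h' <;>
    first | (exfalso; omega) | (left; omega) | (right; omega)

set_option maxHeartbeats 1000000 in
theorem two13 {k p q : ℕ} (hk : 6 ≤ k) (h : p + 5 = 2 * k ∧ q = 2 * k) :
    Two k p q (2) (2 * k - 3) (2 * k - 1) (2 * k + 1) := by
  refine ⟨opt5 (quad7 (by omega)), opt2 (quad9 (by omega)),
    by omega, by omega, by omega, by omega, ?_⟩
  intro r s h'
  unfold Opt at h'
  rcases h' with h' | h' | h' | h' | h' | h' <;> unfold Quad at h' <;>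
    rcases h' with h' | h' | h' | h' | h' | h' | h' | h' | h' | h' <;>
    first | (exfalso; omega) | (left; omega) | (right; omega)

set_option maxHeartbeats 1000000 in
theorem two14 {k p q : ℕ} (hk : 6 ≤ k) (h : p + 1 = 2 * k ∧ q = 2 * k + 1) :
    Two k p q (2) (2 * k - 3) (2 * k - 5) (2 * k) := by
  refine ⟨opt6 (quad8 (by omega)), opt5 (quad9 (by omega)),
    by omega, by omega, by omega, by omega, ?_⟩
  intro r s h'
  unfold Opt at h'
  rcases h' with h' | h' | h' | h' | h' | h' <;> unfold Quad at h' <;>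
    rcases h' with h' | h' | h' | h' | h' | h' | h' | h' | h' | h' <;>
    first | (exfalso; omega) | (left; omega) | (right; omega)

set_option maxHeartbeats 1000000 in
theorem two15 {k p q : ℕ} (hk : 6 ≤ k) (h : p = 2 ∧ q + 3 = 2 * k) :
    Two k p q (2 * k - 5) (2 * k) (2 * k - 1) (2 * k + 1) := by
  refine ⟨opt2 (quad7 (by omega)), opt1 (quad8 (by omega)),
    by omega, by omega, by omega, by omega, ?_⟩
  intro r s h'
  unfold Opt at h'
  rcases h' with h' | h' | h' | h' | h' | h' <;> unfold Quad at h' <;>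
    rcases h' with h' | h' | h' | h' | h' | h' | h' | h' | h' | h' <;>
    first | (exfalso; omega) | (left; omega) | (right; omega)

theorem two_of_F6 {k p q : ℕ} (hk : 6 ≤ k) (h : F6 k p q) :
    ∃ r1 s1 r2 s2, Two k p q r1 s1 r2 s2 := by
  unfold F6 at h
  rcases h with h | h | h | h | h | h | h | h | h | h | h | h | h | h | h
  · exact ⟨_, _, _, _, two1 hk h⟩
  · exact ⟨_, _, _, _, two2 hk h⟩
  · exact ⟨_, _, _, _, two3 hk h⟩
  · exact ⟨_, _, _, _, two4 hk h⟩
  · exact ⟨_, _, _, _, two5 hk h⟩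
  · exact ⟨_, _, _, _, two6 hk h⟩
  · exact ⟨_, _, _, _, two7 hk h⟩
  · exact ⟨_, _, _, _, two8 hk h⟩
  · exact ⟨_, _, _, _, two9 hk h⟩
  · exact ⟨_, _, _, _, two10 hk h⟩
  · exact ⟨_, _, _, _, two11 hk h⟩
  · exact ⟨_, _, _, _, two12 hk h⟩
  · exact ⟨_, _, _, _, two13 hk h⟩
  · exact ⟨_, _, _, _, two14 hk h⟩
  · exact ⟨_, _, _, _, two15 hk h⟩

theorem three_of_F8 {k p q : ℕ} (hk : 6 ≤ k) (h : F8 k p q) :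
    ∃ r1 s1 r2 s2 r3 s3, Opt k p q r1 s1 ∧ Opt k p q r2 s2 ∧ Opt k p q r3 s3 ∧
      r1 ≠ r2 ∧ r1 ≠ s2 ∧ s1 ≠ r2 ∧ s1 ≠ s2 ∧ r1 ≠ r3 ∧ r1 ≠ s3 ∧ s1 ≠ r3 ∧ s1 ≠ s3 ∧
      r2 ≠ r3 ∧ r2 ≠ s3 ∧ s2 ≠ r3 ∧ s2 ≠ s3 := by
  unfold F8 at h
  rcases h with h | h | h | h
  · exact ⟨1, 3, 2 * k - 4, 2 * k, 2 * k - 2, 2 * k + 1,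
      opt2 (quad1 (by omega)), opt1 (quad3 (by omega)), opt1 (quad4 (by omega)),
      by omega⟩
  · exact ⟨0, 2, 2 * k - 4, 2 * k, 2 * k - 2, 2 * k + 1,
      opt5 (quad1 (by omega)), opt1 (quad5 (by omega)), opt1 (quad6 (by omega)),
      by omega⟩
  · exact ⟨0, 2, 1, 3, 2 * k - 2, 2 * k + 1,
      opt6 (quad3 (by omega)), opt6 (quad5 (by omega)), opt2 (quad10 (by omega)),
      by omega⟩
  · exact ⟨0, 2, 1, 3, 2 * k - 4, 2 * k,
      opt6 (quad4 (by omega)), opt6 (quad6 (by omega)), opt5 (quad10 (by omega)),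
      by omega⟩

set_option maxHeartbeats 10000000 in
theorem uniq_of_not_F {k p q r s r' s' : ℕ} (hk : 6 ≤ k) (h6 : ¬ F6 k p q) (h8 : ¬ F8 k p q)
    (h : Opt k p q r s) (h' : Opt k p q r' s') : r' = r ∧ s' = s := by
  unfold Opt at h
  rcases h with h | h | h | h | h | h <;> unfold Quad at h <;>
    rcases h with h | h | h | h | h | h | h | h | h | h <;>
    first
    | (exfalso; apply h8; first
        | exact Or.inl (by omega)
        | exact Or.inr (Or.inl (by omega))
        | exact Or.inr (Or.inr (Or.inl (by omega)))
        | exact Or.inr (Or.inr (Or.inr (by omega))))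
    | (exfalso; apply h6; first
        | exact Or.inl (by omega)
        | exact Or.inr (Or.inl (by omega))
        | exact Or.inr (Or.inr (Or.inl (by omega)))
        | exact Or.inr (Or.inr (Or.inr (Or.inl (by omega))))
        | exact Or.inr (Or.inr (Or.inr (Or.inr (Or.inl (by omega)))))
        | exact Or.inr (Or.inr (Or.inr (Or.inr (Or.inr (Or.inl (by omega))))))
        | exact Or.inr (Or.inr (Or.inr (Or.inr (Or.inr (Or.inr (Or.inl (by omega)))))))
        | exact Or.inr (Or.inr (Or.inr (Or.inr (Or.inr (Or.inr (Or.inr (Or.inl (by omega))))))))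
        | exact Or.inr (Or.inr (Or.inr (Or.inr (Or.inr (Or.inr (Or.inr (Or.inr (Or.inl (by omega)))))))))
        | exact Or.inr (Or.inr (Or.inr (Or.inr (Or.inr (Or.inr (Or.inr (Or.inr (Or.inr (Or.inl (by omega))))))))))
        | exact Or.inr (Or.inr (Or.inr (Or.inr (Or.inr (Or.inr (Or.inr (Or.inr (Or.inr (Or.inr (Or.inl (by omega)))))))))))
        | exact Or.inr (Or.inr (Or.inr (Or.inr (Or.inr (Or.inr (Or.inr (Or.inr (Or.inr (Or.inr (Or.inr (Or.inl (by omega))))))))))))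
        | exact Or.inr (Or.inr (Or.inr (Or.inr (Or.inr (Or.inr (Or.inr (Or.inr (Or.inr (Or.inr (Or.inr (Or.inr (Or.inl (by omega)))))))))))))
        | exact Or.inr (Or.inr (Or.inr (Or.inr (Or.inr (Or.inr (Or.inr (Or.inr (Or.inr (Or.inr (Or.inr (Or.inr (Or.inr (Or.inl (by omega))))))))))))))
        | exact Or.inr (Or.inr (Or.inr (Or.inr (Or.inr (Or.inr (Or.inr (Or.inr (Or.inr (Or.inr (Or.inr (Or.inr (Or.inr (Or.inr (by omega)))))))))))))))
    | (unfold Opt at h'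
       rcases h' with h' | h' | h' | h' | h' | h' <;> unfold Quad at h' <;>
         rcases h' with h' | h' | h' | h' | h' | h' | h' | h' | h' | h' <;>
       first
       | (exfalso; omega)
       | omega
       | (exfalso; apply h8; first
           | exact Or.inl (by omega)
           | exact Or.inr (Or.inl (by omega))
           | exact Or.inr (Or.inr (Or.inl (by omega)))
           | exact Or.inr (Or.inr (Or.inr (by omega))))
       | (exfalso; apply h6; first
           | exact Or.inl (by omega)
           | exact Or.inr (Or.inl (by omega))
           | exact Or.inr (Or.inr (Or.inl (by omega)))
           | exact Or.inr (Or.inr (Or.inr (Or.inl (by omega))))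
           | exact Or.inr (Or.inr (Or.inr (Or.inr (Or.inl (by omega)))))
           | exact Or.inr (Or.inr (Or.inr (Or.inr (Or.inr (Or.inl (by omega))))))
           | exact Or.inr (Or.inr (Or.inr (Or.inr (Or.inr (Or.inr (Or.inl (by omega)))))))
           | exact Or.inr (Or.inr (Or.inr (Or.inr (Or.inr (Or.inr (Or.inr (Or.inl (by omega))))))))
           | exact Or.inr (Or.inr (Or.inr (Or.inr (Or.inr (Or.inr (Or.inr (Or.inr (Or.inl (by omega)))))))))
           | exact Or.inr (Or.inr (Or.inr (Or.inr (Or.inr (Or.inr (Or.inr (Or.inr (Or.inr (Or.inl (by omega))))))))))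
           | exact Or.inr (Or.inr (Or.inr (Or.inr (Or.inr (Or.inr (Or.inr (Or.inr (Or.inr (Or.inr (Or.inl (by omega)))))))))))
           | exact Or.inr (Or.inr (Or.inr (Or.inr (Or.inr (Or.inr (Or.inr (Or.inr (Or.inr (Or.inr (Or.inr (Or.inl (by omega))))))))))))
           | exact Or.inr (Or.inr (Or.inr (Or.inr (Or.inr (Or.inr (Or.inr (Or.inr (Or.inr (Or.inr (Or.inr (Or.inr (Or.inl (by omega)))))))))))))
           | exact Or.inr (Or.inr (Or.inr (Or.inr (Or.inr (Or.inr (Or.inr (Or.inr (Or.inr (Or.inr (Or.inr (Or.inr (Or.inr (Or.inl (by omega))))))))))))))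
           | exact Or.inr (Or.inr (Or.inr (Or.inr (Or.inr (Or.inr (Or.inr (Or.inr (Or.inr (Or.inr (Or.inr (Or.inr (Or.inr (Or.inr (by omega))))))))))))))))

theorem Opt.lt {k p q r s : ℕ} (hk : 6 ≤ k) (h : Opt k p q r s) : r < s ∧ p < q ∧ s < 2 * k + 2 ∧
    q < 2 * k + 2 ∧ p ≠ r ∧ p ≠ s ∧ q ≠ r ∧ q ≠ s := by
  unfold Opt Quad at h
  omega


open Classical in
/-- The codes `r` lying in a zero-sum quadruple `p, q, r, s`. -/
noncomputable def cset (k p q : ℕ) : Finset ℕ :=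
  (Finset.range (2 * k + 2)).filter (fun r => ∃ s < 2 * k + 2, Zero4 k p q r s)

theorem mem_cset {k p q r : ℕ} :
    r ∈ cset k p q ↔ r < 2 * k + 2 ∧ ∃ s < 2 * k + 2, Zero4 k p q r s := by
  unfold cset; simp

theorem cset_symm (k p q : ℕ) : cset k p q = cset k q p := by
  ext r
  rw [mem_cset, mem_cset]
  constructor
  · rintro ⟨h, s, hs, h'⟩
    exact ⟨h, s, hs, h'.swap12⟩
  · rintro ⟨h, s, hs, h'⟩
    exact ⟨h, s, hs, h'.swap12⟩

theorem mem_cset_iff {k p q r : ℕ} (hk : 6 ≤ k) (hpq : p < q) (hq : q < 2 * k + 2) :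
    r ∈ cset k p q ↔ r = p ∨ r = q ∨ ∃ s, Opt k p q r s ∨ Opt k p q s r := by
  rw [mem_cset]
  constructor
  · rintro ⟨hr, s, hs, h⟩
    by_cases h1 : r = p
    · exact Or.inl h1
    by_cases h2 : r = q
    · exact Or.inr (Or.inl h2)
    have h3 : s ≠ p := by
      rintro rfl
      exact h2 (code_inj hk hr hq (fun j hj => by have := h j hj; grind))
    have h4 : s ≠ q := by
      rintro rfl
      exact h1 (code_inj hk hr (by omega) (fun j hj => by have := h j hj; grind))
    have h5 : r ≠ s := by
      rintro rfl
      exact hpq.ne (code_inj hk (by omega) hq (fun j hj => by have := h j hj; grind))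
    rcases Nat.lt_or_gt_of_ne h5 with c | c
    · exact Or.inr (Or.inr ⟨s, Or.inl
        (opt_of_zero4 hk hpq c hq hs (Ne.symm h1) (Ne.symm h3) (Ne.symm h2) (Ne.symm h4) h)⟩)
    · exact Or.inr (Or.inr ⟨s, Or.inr
        (opt_of_zero4 hk hpq c hq hr (Ne.symm h3) (Ne.symm h1) (Ne.symm h4) (Ne.symm h2) h.swap34)⟩)
  · rintro (rfl | rfl | ⟨s, h | h⟩)
    · exact ⟨by omega, q, hq, fun j hj => Iff.rfl⟩
    · exact ⟨hq, p, by omega, fun j hj => by grind⟩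
    · have := h.lt hk
      exact ⟨by omega, s, by omega, h.zero4 hk⟩
    · have := h.lt hk
      exact ⟨by omega, s, by omega, (h.zero4 hk).swap34⟩

theorem cset_le {k p q : ℕ} (hk : 6 ≤ k) (hpq : p < q) (hq : q < 2 * k + 2)
    (h6 : ¬ F6 k p q) (h8 : ¬ F8 k p q) : (cset k p q).card ≤ 4 := by
  by_cases hex : ∃ r s, Opt k p q r s
  · obtain ⟨r, s, h⟩ := hex
    have : cset k p q ⊆ {p, q, r, s} := by
      intro t ht
      rw [mem_cset_iff hk hpq hq] at ht
      simp only [Finset.mem_insert, Finset.mem_singleton]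
      rcases ht with h1 | h1 | ⟨u, h1 | h1⟩
      · exact Or.inl h1
      · exact Or.inr (Or.inl h1)
      · have := uniq_of_not_F hk h6 h8 h h1
        tauto
      · have := uniq_of_not_F hk h6 h8 h h1
        tauto
    exact (Finset.card_le_card this).trans Finset.card_le_four
  · have : cset k p q ⊆ {p, q} := by
      intro t ht
      rw [mem_cset_iff hk hpq hq] at ht
      simp only [Finset.mem_insert, Finset.mem_singleton]
      rcases ht with h1 | h1 | ⟨u, h1 | h1⟩
      · exact Or.inl h1
      · exact Or.inr h1
      · exact absurd ⟨_, _, h1⟩ hex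
      · exact absurd ⟨_, _, h1⟩ hex
    have := (Finset.card_le_card this).trans Finset.card_le_two
    omega

theorem F6.lt {k p q : ℕ} (hk : 6 ≤ k) (h : F6 k p q) : p < q ∧ q < 2 * k + 2 := by
  unfold F6 at h; omega
theorem F8.lt {k p q : ℕ} (hk : 6 ≤ k) (h : F8 k p q) : p < q ∧ q < 2 * k + 2 := by
  unfold F8 at h; omega

set_option maxHeartbeats 1000000 in
theorem cset_F6 {k p q : ℕ} (hk : 6 ≤ k) (h6 : F6 k p q) : (cset k p q).card = 6 := by
  obtain ⟨hpq, hq⟩ := h6.lt hk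
  obtain ⟨r1, s1, r2, s2, a1, a2, n1, n2, n3, n4, hu⟩ := two_of_F6 hk h6
  have l1 := a1.lt hk
  have l2 := a2.lt hk
  have : cset k p q = {p, q, r1, s1, r2, s2} := by
    ext t
    rw [mem_cset_iff hk hpq hq]
    simp only [Finset.mem_insert, Finset.mem_singleton]
    constructor
    · rintro (h1 | h1 | ⟨u, h1 | h1⟩)
      · tauto
      · tauto
      · have := hu _ _ h1
        tauto
      · have := hu _ _ h1
        tauto
    · rintro (h1 | h1 | h1 | h1 | h1 | h1)
      · exact Or.inl h1
      · exact Or.inr (Or.inl h1)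
      · subst h1
        exact Or.inr (Or.inr ⟨_, Or.inl a1⟩)
      · subst h1
        exact Or.inr (Or.inr ⟨_, Or.inr a1⟩)
      · subst h1
        exact Or.inr (Or.inr ⟨_, Or.inl a2⟩)
      · subst h1
        exact Or.inr (Or.inr ⟨_, Or.inr a2⟩)
  rw [this]
  repeat rw [Finset.card_insert_of_notMem
    (by simp only [Finset.mem_insert, Finset.mem_singleton]; omega)]
  rw [Finset.card_singleton]

set_option maxHeartbeats 1000000 in
theorem cset_F8 {k p q : ℕ} (hk : 6 ≤ k) (h8 : F8 k p q) : 8 ≤ (cset k p q).card := by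
  obtain ⟨hpq, hq⟩ := h8.lt hk
  obtain ⟨r1, s1, r2, s2, r3, s3, a1, a2, a3, hn⟩ := three_of_F8 hk h8
  have l1 := a1.lt hk
  have l2 := a2.lt hk
  have l3 := a3.lt hk
  have : {p, q, r1, s1, r2, s2, r3, s3} ⊆ cset k p q := by
    intro t ht
    rw [mem_cset_iff hk hpq hq]
    simp only [Finset.mem_insert, Finset.mem_singleton] at ht
    rcases ht with h1 | h1 | h1 | h1 | h1 | h1 | h1 | h1
    · exact Or.inl h1
    · exact Or.inr (Or.inl h1)
    · subst h1
      exact Or.inr (Or.inr ⟨_, Or.inl a1⟩)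
    · subst h1
      exact Or.inr (Or.inr ⟨_, Or.inr a1⟩)
    · subst h1
      exact Or.inr (Or.inr ⟨_, Or.inl a2⟩)
    · subst h1
      exact Or.inr (Or.inr ⟨_, Or.inr a2⟩)
    · subst h1
      exact Or.inr (Or.inr ⟨_, Or.inl a3⟩)
    · subst h1
      exact Or.inr (Or.inr ⟨_, Or.inr a3⟩)
  refine le_trans (le_of_eq ?_) (Finset.card_le_card this)
  repeat rw [Finset.card_insert_of_notMem
    (by simp only [Finset.mem_insert, Finset.mem_singleton]; omega)]
  rw [Finset.card_singleton]

/-- Symmetric version of `F6`. -/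
def E6 (k p q : ℕ) : Prop := F6 k p q ∨ F6 k q p
/-- Symmetric version of `F8`. -/
def E8 (k p q : ℕ) : Prop := F8 k p q ∨ F8 k q p

theorem F6_iff {k p q : ℕ} (hk : 6 ≤ k) (hpq : p < q) (hq : q < 2 * k + 2) :
    F6 k p q ↔ (cset k p q).card = 6 := by
  refine ⟨cset_F6 hk, fun h => ?_⟩
  by_contra h6
  by_cases h8 : F8 k p q
  · have := cset_F8 hk h8
    omega
  · have := cset_le hk hpq hq h6 h8
    omega

theorem F8_iff {k p q : ℕ} (hk : 6 ≤ k) (hpq : p < q) (hq : q < 2 * k + 2) :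
    F8 k p q ↔ 8 ≤ (cset k p q).card := by
  refine ⟨cset_F8 hk, fun h => ?_⟩
  by_contra h8
  by_cases h6 : F6 k p q
  · have := cset_F6 hk h6
    omega
  · have := cset_le hk hpq hq h6 h8
    omega

theorem E6_iff {k p q : ℕ} (hk : 6 ≤ k) (hpq : p ≠ q) (hp : p < 2 * k + 2) (hq : q < 2 * k + 2) :
    E6 k p q ↔ (cset k p q).card = 6 := by
  unfold E6
  rcases Nat.lt_or_gt_of_ne hpq with c | c
  · rw [← F6_iff hk c hq]
    refine or_iff_left (fun h => ?_)
    have := h.lt hk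
    omega
  · rw [cset_symm, ← F6_iff hk c hp]
    refine or_iff_right (fun h => ?_)
    have := h.lt hk
    omega

theorem E8_iff {k p q : ℕ} (hk : 6 ≤ k) (hpq : p ≠ q) (hp : p < 2 * k + 2) (hq : q < 2 * k + 2) :
    E8 k p q ↔ 8 ≤ (cset k p q).card := by
  unfold E8
  rcases Nat.lt_or_gt_of_ne hpq with c | c
  · rw [← F8_iff hk c hq]
    refine or_iff_left (fun h => ?_)
    have := h.lt hk
    omega
  · rw [cset_symm, ← F8_iff hk c hp]
    refine or_iff_right (fun h => ?_)
    have := h.lt hk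
    omega

theorem E6.symm {k p q : ℕ} (h : E6 k p q) : E6 k q p := Or.symm h
theorem e6_1 {k p q : ℕ} (h : p = 0 ∧ q % 2 = 1 ∧ 3 ≤ q ∧ q + 3 ≤ 2 * k) : E6 k p q :=
  Or.inl (Or.inl h)
theorem e6_2 {k p q : ℕ} (h : p % 2 = 1 ∧ q = p + 1 ∧ p + 5 ≤ 2 * k) : E6 k p q :=
  Or.inl (Or.inr (Or.inl h))
theorem e6_3 {k p q : ℕ} (h : p % 2 = 0 ∧ 4 ≤ p ∧ q = p + 1 ∧ p + 2 ≤ 2 * k) : E6 k p q :=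
  Or.inl (Or.inr (Or.inr (Or.inl h)))
theorem e6_4 {k p q : ℕ} (h : p + 5 = 2 * k ∧ q + 1 = 2 * k) : E6 k p q :=
  Or.inl (Or.inr (Or.inr (Or.inr (Or.inl h))))
theorem e6_5 {k p q : ℕ} (h : p + 4 = 2 * k ∧ q + 2 = 2 * k) : E6 k p q :=
  Or.inl (Or.inr (Or.inr (Or.inr (Or.inr (Or.inl h)))))
theorem e6_6 {k p q : ℕ} (h : p = 2 * k ∧ q = 2 * k + 1) : E6 k p q :=
  Or.inl (Or.inr (Or.inr (Or.inr (Or.inr (Or.inr (Or.inl h))))))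
theorem e6_7 {k p q : ℕ} (h : p = 0 ∧ q + 4 = 2 * k) : E6 k p q :=
  Or.inl (Or.inr (Or.inr (Or.inr (Or.inr (Or.inr (Or.inr (Or.inl h)))))))
theorem e6_8 {k p q : ℕ} (h : p + 5 = 2 * k ∧ q + 3 = 2 * k) : E6 k p q :=
  Or.inl (Or.inr (Or.inr (Or.inr (Or.inr (Or.inr (Or.inr (Or.inr (Or.inl h))))))))
theorem e6_9 {k p q : ℕ} (h : p = 2 ∧ q = 2 * k) : E6 k p q :=
  Or.inl (Or.inr (Or.inr (Or.inr (Or.inr (Or.inr (Or.inr (Or.inr (Or.inr (Or.inl h)))))))))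
theorem e6_10 {k p q : ℕ} (h : p = 0 ∧ q + 2 = 2 * k) : E6 k p q :=
  Or.inl (Or.inr (Or.inr (Or.inr (Or.inr (Or.inr (Or.inr (Or.inr (Or.inr (Or.inr (Or.inl h))))))))))
theorem e6_11 {k p q : ℕ} (h : p + 3 = 2 * k ∧ q + 1 = 2 * k) : E6 k p q :=
  Or.inl (Or.inr (Or.inr (Or.inr (Or.inr (Or.inr (Or.inr (Or.inr (Or.inr (Or.inr (Or.inr (Or.inl h)))))))))))
theorem e6_12 {k p q : ℕ} (h : p = 2 ∧ q = 2 * k + 1) : E6 k p q :=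
  Or.inl (Or.inr (Or.inr (Or.inr (Or.inr (Or.inr (Or.inr (Or.inr (Or.inr (Or.inr (Or.inr (Or.inr (Or.inl h))))))))))))
theorem e6_13 {k p q : ℕ} (h : p + 5 = 2 * k ∧ q = 2 * k) : E6 k p q :=
  Or.inl (Or.inr (Or.inr (Or.inr (Or.inr (Or.inr (Or.inr (Or.inr (Or.inr (Or.inr (Or.inr (Or.inr (Or.inr (Or.inl h)))))))))))))
theorem e6_14 {k p q : ℕ} (h : p + 1 = 2 * k ∧ q = 2 * k + 1) : E6 k p q :=
  Or.inl (Or.inr (Or.inr (Or.inr (Or.inr (Or.inr (Or.inr (Or.inr (Or.inr (Or.inr (Or.inr (Or.inr (Or.inr (Or.inr (Or.inl h))))))))))))))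
theorem e6_15 {k p q : ℕ} (h : p = 2 ∧ q + 3 = 2 * k) : E6 k p q :=
  Or.inl (Or.inr (Or.inr (Or.inr (Or.inr (Or.inr (Or.inr (Or.inr (Or.inr (Or.inr (Or.inr (Or.inr (Or.inr (Or.inr (Or.inr (h)))))))))))))))

theorem E6_one {k y : ℕ} (hk : 6 ≤ k) (h : E6 k 1 y) : y = 2 := by
  unfold E6 F6 at h
  rcases h with h | h <;>
    rcases h with h | h | h | h | h | h | h | h | h | h | h | h | h | h | h <;> omega
theorem E6_zero {k y : ℕ} (hk : 6 ≤ k) (h : E6 k 0 y) :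
    (y % 2 = 1 ∧ 3 ≤ y ∧ y + 3 ≤ 2 * k) ∨ y + 4 = 2 * k ∨ y + 2 = 2 * k := by
  unfold E6 F6 at h
  rcases h with h | h <;>
    rcases h with h | h | h | h | h | h | h | h | h | h | h | h | h | h | h <;> omega
theorem E6_two {k y : ℕ} (hk : 6 ≤ k) (h : E6 k 2 y) :
    y = 1 ∨ y = 2 * k ∨ y = 2 * k + 1 ∨ y + 3 = 2 * k := by
  unfold E6 F6 at h
  rcases h with h | h <;>
    rcases h with h | h | h | h | h | h | h | h | h | h | h | h | h | h | h <;> omega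
theorem E6_mid {k m y : ℕ} (h3 : 3 ≤ m) (hm : m + 6 ≤ 2 * k) (h : E6 k m y) :
    y = 0 ∨ y + 1 = m ∨ y = m + 1 := by
  unfold E6 F6 at h
  rcases h with h | h <;>
    rcases h with h | h | h | h | h | h | h | h | h | h | h | h | h | h | h <;> omega
theorem E6_b {k m y : ℕ} (hk : 6 ≤ k) (hm : m + 5 = 2 * k) (h : E6 k m y) :
    y = 0 ∨ y + 1 = m ∨ y = m + 1 ∨ y = 2 * k ∨ y + 3 = 2 * k ∨ y + 1 = 2 * k := by
  unfold E6 F6 at h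
  rcases h with h | h <;>
    rcases h with h | h | h | h | h | h | h | h | h | h | h | h | h | h | h <;> omega

theorem two_nbrs {k x : ℕ} (hk : 6 ≤ k) (hx : x = 0 ∨ x = 2 ∨ x = 3 ∨ x = 2 * k ∨
    x + 4 = 2 * k ∨ x = 2 * k + 1 ∨ x + 2 = 2 * k) :
    ∃ a b, a ≠ b ∧ a ≠ x ∧ b ≠ x ∧ a < 2 * k + 2 ∧ b < 2 * k + 2 ∧ E6 k x a ∧ E6 k x b := by
  rcases hx with h | h | h | h | h | h | h
  · refine ⟨3, 5, by omega, by omega, by omega, by omega, by omega,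
      e6_1 (by omega), e6_1 (by omega)⟩
  · refine ⟨1, 2 * k, by omega, by omega, by omega, by omega, by omega,
      (e6_2 (by omega)).symm, e6_9 (by omega)⟩
  · refine ⟨0, 4, by omega, by omega, by omega, by omega, by omega,
      (e6_1 (by omega)).symm, e6_2 (by omega)⟩
  · refine ⟨2 * k + 1, 2, by omega, by omega, by omega, by omega, by omega,
      e6_6 (by omega), (e6_9 (by omega)).symm⟩
  · refine ⟨0, 2 * k - 5, by omega, by omega, by omega, by omega, by omega,
      (e6_7 (by omega)).symm, (e6_2 (by omega)).symm⟩
  · refine ⟨2 * k, 2, by omega, by omega, by omega, by omega, by omega,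
      (e6_6 (by omega)).symm, (e6_12 (by omega)).symm⟩
  · refine ⟨0, 2 * k - 1, by omega, by omega, by omega, by omega, by omega,
      (e6_10 (by omega)).symm, e6_3 (by omega)⟩

set_option maxHeartbeats 2000000 in
theorem rigid {k : ℕ} (hk : 6 ≤ k) (σ : ℕ → ℕ) (hlt : ∀ p < 2 * k + 2, σ p < 2 * k + 2)
    (hinj : ∀ p < 2 * k + 2, ∀ q < 2 * k + 2, σ p = σ q → p = q)
    (hc : ∀ p < 2 * k + 2, ∀ q < 2 * k + 2, (cset k (σ p) (σ q)).card = (cset k p q).card) :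
    ∀ p < 2 * k + 2, σ p = p := by
  have hsurj : ∀ y < 2 * k + 2, ∃ x < 2 * k + 2, σ x = y := by
    intro y hy
    have := Finset.surjOn_of_injOn_of_card_le (s := Finset.range (2 * k + 2))
      (t := Finset.range (2 * k + 2)) σ (fun p hp => by simpa using hlt p (by simpa using hp))
      (fun p hp q hq h => hinj p (by simpa using hp) q (by simpa using hq) h) le_rfl
    obtain ⟨x, hx, h⟩ := this (show y ∈ _ by simpa using hy)
    exact ⟨x, by simpa using hx, h⟩
  have hne : ∀ p < 2 * k + 2, ∀ q < 2 * k + 2, p ≠ q → σ p ≠ σ q :=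
    fun p hp q hq h h' => h (hinj p hp q hq h')
  have h6 : ∀ p < 2 * k + 2, ∀ q < 2 * k + 2, p ≠ q → (E6 k p q ↔ E6 k (σ p) (σ q)) := by
    intro p hp q hq h
    rw [E6_iff hk h hp hq, E6_iff hk (hne p hp q hq h) (hlt p hp) (hlt q hq), hc p hp q hq]
  have h8 : ∀ p < 2 * k + 2, ∀ q < 2 * k + 2, p ≠ q → (E8 k p q ↔ E8 k (σ p) (σ q)) := by
    intro p hp q hq h
    rw [E8_iff hk h hp hq, E8_iff hk (hne p hp q hq h) (hlt p hp) (hlt q hq), hc p hp q hq]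
  -- the code 1 is fixed
  have s1 : σ 1 = 1 := by
    by_contra hs
    have e := (h8 1 (by omega) 3 (by omega) (by omega)).1 (by unfold E8 F8; omega)
    obtain ⟨a, b, hab, hax, hbx, ha, hb, ea, eb⟩ := two_nbrs (x := σ 1) hk (by
      unfold E8 F8 at e; omega)
    obtain ⟨a', ha', rfl⟩ := hsurj a ha
    obtain ⟨b', hb', rfl⟩ := hsurj b hb
    have n1 : 1 ≠ a' := fun h => hax (by rw [h])
    have n2 : 1 ≠ b' := fun h => hbx (by rw [h])
    have := E6_one hk ((h6 1 (by omega) a' ha' n1).2 ea)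
    have := E6_one hk ((h6 1 (by omega) b' hb' n2).2 eb)
    subst_vars
    exact hab rfl
  have s2 : σ 2 = 2 := by
    have e := (h6 1 (by omega) 2 (by omega) (by omega)).1 (e6_2 (by omega))
    rw [s1] at e
    exact E6_one hk e
  have s3 : σ 3 = 3 := by
    have e := (h8 1 (by omega) 3 (by omega) (by omega)).1 (by unfold E8 F8; omega)
    rw [s1] at e
    unfold E8 F8 at e
    omega
  have s0 : σ 0 = 0 := by
    have e := (h8 0 (by omega) 2 (by omega) (by omega)).1 (by unfold E8 F8; omega)
    rw [s2] at e
    unfold E8 F8 at e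
    omega
  have slow : ∀ m, m + 5 ≤ 2 * k → ∀ p ≤ m, σ p = p := by
    intro m
    induction m with
    | zero => intro _ p hp; rw [Nat.le_zero.1 hp]; exact s0
    | succ m ih =>
      intro hm p hp
      have ih := ih (by omega)
      by_cases hpm : p ≤ m
      · exact ih p hpm
      have hp' : p = m + 1 := by omega
      subst hp'
      by_cases h3 : m < 3
      · interval_cases m
        · exact s1
        · exact s2
        · exact s3
      have e := (h6 m (by omega) (m + 1) (by omega) (by omega)).1 (by
        rcases Nat.mod_two_eq_zero_or_one m with c | c
        · exact e6_3 (by omega)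
        · exact e6_2 (by omega))
      rw [ih m le_rfl] at e
      rcases E6_mid (by omega) (by omega) e with h | h | h
      · have := hinj (m + 1) (by omega) 0 (by omega) (by rw [h, s0])
        omega
      · have := hinj (m + 1) (by omega) (m - 1) (by omega) (by rw [ih (m - 1) (by omega)]; omega)
        omega
      · exact h
  have slow' : ∀ p, p + 5 ≤ 2 * k → σ p = p := fun p hp => slow p hp p le_rfl
  have t3 : σ (2 * k - 3) = 2 * k - 3 := by
    have e := (h6 2 (by omega) (2 * k - 3) (by omega) (by omega)).1 (e6_15 (by omega))
    have e' := (h6 0 (by omega) (2 * k - 3) (by omega) (by omega)).1 (e6_1 (by omega))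
    rw [s2] at e
    rw [s0] at e'
    have := E6_two hk e
    have := E6_zero hk e'
    omega
  have ta : σ (2 * k) = 2 * k := by
    have e := (h6 2 (by omega) (2 * k) (by omega) (by omega)).1 (e6_9 (by omega))
    have e' := (h6 (2 * k - 5) (by omega) (2 * k) (by omega) (by omega)).1 (e6_13 (by omega))
    rw [s2] at e
    rw [slow' (2 * k - 5) (by omega)] at e'
    have := E6_two hk e
    have := E6_b hk (by omega) e'
    have := hne (2 * k) (by omega) (2 * k - 3) (by omega) (by omega)
    omega
  have tc : σ (2 * k + 1) = 2 * k + 1 := by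
    have e := (h6 2 (by omega) (2 * k + 1) (by omega) (by omega)).1 (e6_12 (by omega))
    rw [s2] at e
    have := E6_two hk e
    have := hne (2 * k + 1) (by omega) (2 * k - 3) (by omega) (by omega)
    have := hne (2 * k + 1) (by omega) (2 * k) (by omega) (by omega)
    have := hne (2 * k + 1) (by omega) 1 (by omega) (by omega)
    omega
  have t4 : σ (2 * k - 4) = 2 * k - 4 := by
    have e := (h8 (2 * k - 4) (by omega) (2 * k) (by omega) (by omega)).1 (by unfold E8 F8; omega)
    rw [ta] at e
    unfold E8 F8 at e
    omega
  have t2 : σ (2 * k - 2) = 2 * k - 2 := by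
    have e := (h8 (2 * k - 2) (by omega) (2 * k + 1) (by omega) (by omega)).1 (by
      unfold E8 F8; omega)
    rw [tc] at e
    unfold E8 F8 at e
    omega
  have tall : ∀ p < 2 * k + 2, p + 1 ≠ 2 * k → σ p = p := by
    intro p hp hp1
    by_cases c : p + 5 ≤ 2 * k
    · exact slow' p c
    have : p = 2 * k - 4 ∨ p = 2 * k - 3 ∨ p = 2 * k - 2 ∨ p = 2 * k ∨ p = 2 * k + 1 := by omega
    rcases this with rfl | rfl | rfl | rfl | rfl <;> assumption
  intro p hp
  by_cases hp1 : p + 1 = 2 * k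
  · by_contra hne'
    have hy := hlt p hp
    have := hinj _ hy p hp (tall (σ p) hy (by omega))
    exact hne' this
  · exact tall p hp hp1

open Classical in
/-- The vector over the field with two elements encoded by a code. -/
noncomputable def vec (k p : ℕ) : Fin k → ZMod 2 := fun j => if Mem k p j then 1 else 0

/-- The set of all vectors with a code: the Imrich set together with zero. -/
def T0 (k : ℕ) : Set (Fin k → ZMod 2) := {w | ∃ p < 2 * k + 2, w = vec k p}

theorem add_self_W {k : ℕ} (w : Fin k → ZMod 2) : w + w = 0 := by
  funext j
  exact CharTwo.add_self_eq_zero (w j)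

theorem add_cancel_W {k : ℕ} (w v : Fin k → ZMod 2) : w + v + v = w := by
  rw [add_assoc, add_self_W, add_zero]

theorem vec_inj {k p q : ℕ} (hk : 6 ≤ k) (hp : p < 2 * k + 2) (hq : q < 2 * k + 2)
    (h : vec k p = vec k q) : p = q := by
  refine code_inj hk hp hq (fun j hj => ?_)
  have := congrFun h ⟨j, hj⟩
  unfold vec at this
  by_cases h1 : Mem k p j <;> by_cases h2 : Mem k q j <;> simp_all

theorem vec_zero (k : ℕ) : vec k 0 = 0 := by
  funext j
  have : ¬ Mem k 0 j := by
    have := j.2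
    unfold Mem; omega
  simp [vec, this]

theorem zero4_iff {k p q r s : ℕ} :
    Zero4 k p q r s ↔ vec k p + vec k q = vec k r + vec k s := by
  rw [funext_iff]
  constructor
  · intro h j
    have := h j j.2
    simp only [vec, Pi.add_apply]
    by_cases h1 : Mem k p j <;> by_cases h2 : Mem k q j <;> by_cases h3 : Mem k r j <;>
      by_cases h4 : Mem k s j <;> simp_all <;> decide
  · intro h j hj
    have := h ⟨j, hj⟩
    simp only [vec, Pi.add_apply] at this
    have e : (1 + 1 : ZMod 2) = 0 := by decide
    by_cases h1 : Mem k p j <;> by_cases h2 : Mem k q j <;> by_cases h3 : Mem k r j <;>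
      by_cases h4 : Mem k s j <;> simp_all

/-- Common neighbours. -/
def Rset (k : ℕ) (u v : Fin k → ZMod 2) : Set (Fin k → ZMod 2) :=
  {w | w + u ∈ T0 k ∧ w + v ∈ T0 k}

theorem Rset_card {k p q : ℕ} (hk : 6 ≤ k) :
    (Rset k (vec k p) (vec k q)).ncard = (cset k p q).card := by
  have : Rset k (vec k p) (vec k q) = (fun r => vec k r + vec k p) '' (cset k p q : Set ℕ) := by
    ext w
    constructor
    · rintro ⟨⟨r, hr, h1⟩, s, hs, h2⟩
      have e1 : w = vec k r + vec k p := by rw [← h1, add_cancel_W]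
      have e2 : w = vec k s + vec k q := by rw [← h2, add_cancel_W]
      refine ⟨r, ?_, e1.symm⟩
      rw [Finset.mem_coe, mem_cset]
      refine ⟨hr, s, hs, zero4_iff.2 ?_⟩
      have e3 : vec k r + vec k p = vec k s + vec k q := e1.symm.trans e2
      calc vec k p + vec k q = vec k r + vec k r + (vec k p + vec k q) := by
            rw [add_self_W, zero_add]
        _ = vec k r + (vec k r + vec k p) + vec k q := by abel
        _ = vec k r + vec k s + vec k q + vec k q := by rw [e3]; abel
        _ = vec k r + vec k s := add_cancel_W _ _
    · rintro ⟨r, hr, rfl⟩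
      rw [Finset.mem_coe, mem_cset] at hr
      obtain ⟨hr, s, hs, h⟩ := hr
      rw [zero4_iff] at h
      refine ⟨⟨r, hr, add_cancel_W _ _⟩, s, hs, ?_⟩
      dsimp only
      rw [add_assoc, h, ← add_assoc, add_self_W, zero_add]
  rw [this, Set.ncard_image_of_injOn, Set.ncard_coe_finset]
  intro r hr s hs h
  rw [Finset.mem_coe, mem_cset] at hr hs
  exact vec_inj hk hr.1 hs.1 (add_right_cancel h)

theorem Rset_image {k : ℕ} {α β : (Fin k → ZMod 2) → Fin k → ZMod 2}
    (ha : Function.Bijective α)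
    (h : ∀ u v, v + u ∈ T0 k ↔ β v + α u ∈ T0 k) (u v : Fin k → ZMod 2) :
    (Rset k (β u) (β v)).ncard = (Rset k u v).ncard := by
  have : Rset k (β u) (β v) = α '' Rset k u v := by
    ext w
    obtain ⟨w, rfl⟩ := ha.2 w
    rw [ha.1.mem_set_image]
    unfold Rset
    rw [Set.mem_setOf_eq, Set.mem_setOf_eq, add_comm (α w), add_comm (α w), ← h, ← h,
      add_comm u, add_comm v]
  rw [this, Set.ncard_image_of_injective _ ha.1]

theorem core_half {k : ℕ} (hk : 6 ≤ k) {α β : (Fin k → ZMod 2) → Fin k → ZMod 2}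
    (ha : Function.Bijective α) (hb : Function.Bijective β)
    (h : ∀ u v, v + u ∈ T0 k ↔ β v + α u ∈ T0 k) (h0 : α 0 = 0) :
    ∀ t ∈ T0 k, β t = t := by
  have hT : ∀ t ∈ T0 k, β t ∈ T0 k := by
    intro t ht
    have := (h 0 t).1 (by rwa [add_zero])
    rwa [h0, add_zero] at this
  have hex : ∀ p, ∃ q, p < 2 * k + 2 → q < 2 * k + 2 ∧ β (vec k p) = vec k q := by
    intro p
    by_cases hp : p < 2 * k + 2
    · obtain ⟨q, hq, e⟩ := hT _ ⟨p, hp, rfl⟩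
      exact ⟨q, fun _ => ⟨hq, e⟩⟩
    · exact ⟨0, fun h => absurd h hp⟩
  choose σ hσ using hex
  have := rigid hk σ (fun p hp => (hσ p hp).1)
    (fun p hp q hq e => vec_inj hk hp hq (hb.1 (by rw [(hσ p hp).2, (hσ q hq).2, e])))
    (fun p hp q hq => by
      rw [← Rset_card hk, ← Rset_card hk, ← (hσ p hp).2, ← (hσ q hq).2]
      exact Rset_image ha h _ _)
  rintro t ⟨p, hp, rfl⟩
  rw [(hσ p hp).2, this p hp]

theorem zero_mem_T0 (k : ℕ) : 0 ∈ T0 k := ⟨0, by omega, (vec_zero k).symm⟩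

theorem core_pair {k : ℕ} (hk : 6 ≤ k) {α β : (Fin k → ZMod 2) → Fin k → ZMod 2}
    (ha : Function.Bijective α) (hb : Function.Bijective β)
    (h : ∀ u v, v + u ∈ T0 k ↔ β v + α u ∈ T0 k) (h0 : α 0 = 0) :
    β 0 = 0 ∧ ∀ t ∈ T0 k, α t = t := by
  have b0 := core_half hk ha hb h h0 0 (zero_mem_T0 k)
  refine ⟨b0, core_half hk hb ha (fun u v => ?_) b0⟩
  rw [add_comm, h, add_comm]

theorem core_step {k : ℕ} (hk : 6 ≤ k) {α β : (Fin k → ZMod 2) → Fin k → ZMod 2}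
    (ha : Function.Bijective α) (hb : Function.Bijective β)
    (h : ∀ u v, v + u ∈ T0 k ↔ β v + α u ∈ T0 k) (v : Fin k → ZMod 2) (h0 : α v = v) :
    β v = v ∧ ∀ t ∈ T0 k, α (v + t) = v + t := by
  have key := core_pair hk (α := fun u => α (u + v) + v) (β := fun u => β (u + v) + v)
    (((Equiv.addRight v).bijective.comp ha).comp (Equiv.addRight v).bijective)
    (((Equiv.addRight v).bijective.comp hb).comp (Equiv.addRight v).bijective)
    (fun u w => by
      have e1 : β (w + v) + v + (α (u + v) + v) = β (w + v) + α (u + v) := by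
        rw [← add_assoc, add_right_comm _ v, add_cancel_W]
      have e2 : (w + v) + (u + v) = w + u := by
        rw [← add_assoc, add_right_comm _ v, add_cancel_W]
      show w + u ∈ T0 k ↔ β (w + v) + v + (α (u + v) + v) ∈ T0 k
      rw [e1, ← h, e2])
    (by show α (0 + v) + v = 0
        rw [zero_add, h0, add_self_W])
  obtain ⟨k1, k2⟩ := key
  constructor
  · rw [zero_add] at k1
    rw [← add_cancel_W (β v) v, k1, zero_add]
  · intro t ht
    have := k2 t ht
    rw [add_comm v t]
    nth_rewrite 2 [← this]
    rw [add_cancel_W]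

theorem vec_single {k : ℕ} (i : Fin k) : vec k (2 * i + 1) = Pi.single i 1 := by
  funext j
  have hi := i.2
  have hj := j.2
  have : Mem k (2 * i + 1) j ↔ j = i := by
    rw [mem_small (by omega), Fin.ext_iff]
    omega
  unfold vec
  rw [Pi.single_apply]
  by_cases hji : j = i
  · rw [if_pos (this.2 hji), if_pos hji]
  · rw [if_neg (fun h => hji (this.1 h)), if_neg hji]

theorem core {k : ℕ} (hk : 6 ≤ k) {α β : (Fin k → ZMod 2) → Fin k → ZMod 2}
    (ha : Function.Bijective α) (hb : Function.Bijective β)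
    (h : ∀ u v, v + u ∈ T0 k ↔ β v + α u ∈ T0 k) (h0 : α 0 = 0) :
    (∀ w, α w = w) ∧ β 0 = 0 := by
  refine ⟨fun w => ?_, (core_step hk ha hb h 0 h0).1⟩
  have : ∀ s : Finset (Fin k), α (∑ i ∈ s, Pi.single i (w i)) = ∑ i ∈ s, Pi.single i (w i) := by
    intro s
    induction s using Finset.induction_on with
    | empty => simpa using h0
    | insert i s hi ih =>
      rw [Finset.sum_insert hi, add_comm]
      refine (core_step hk ha hb h _ ih).2 _ ?_
      have hw : w i = 0 ∨ w i = 1 := by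
        generalize w i = c
        revert c
        decide
      rcases hw with e | e
      · rw [e, Pi.single_zero]
        exact zero_mem_T0 k
      · rw [e, ← vec_single]
        exact ⟨_, by have := i.2; omega, rfl⟩
  have := this Finset.univ
  rwa [Finset.univ_sum_single] at this

theorem exists_coord {G : Type*} [Group G] (k : ℕ) (B : Subgroup G)
    (hBcomm : ∀ a ∈ B, ∀ b ∈ B, a * b = b * a)
    (hBexp : ∀ b ∈ B, b ^ 2 = 1)
    (hBcard : Nat.card B = 2 ^ k)
    (z : ℕ → G) (hzB : ∀ i < k, z i ∈ B)
    (hzgen : Subgroup.closure (z '' Set.Iio k) = B) :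
    ∃ f : (Fin k → ZMod 2) → G, (∀ u v, f (u + v) = f u * f v) ∧ (∀ u, f u ∈ B) ∧
      (∀ b ∈ B, ∃ u, f u = b) ∧ Function.Injective f ∧
      ∀ i, i < k → f (vec k (2 * i + 1)) = z i := by
  let _ : CommGroup B := { (inferInstance : Group B) with
    mul_comm := fun a b => Subtype.ext (hBcomm a a.2 b b.2) }
  let _ : Module (ZMod 2) (Additive B) := AddCommGroup.zmodModule (fun b => by
    show Additive.ofMul ((Additive.toMul b) ^ 2) = 0
    rw [ofMul_eq_zero]
    exact Subtype.ext (hBexp _ (Additive.toMul b).2))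
  let zb : Fin k → Additive B := fun i => Additive.ofMul ⟨z i, hzB i i.2⟩
  let L := Fintype.linearCombination (ZMod 2) zb
  let g : (Fin k → ZMod 2) → B := fun u => Additive.toMul (L u)
  have hadd : ∀ u v, g (u + v) = g u * g v := by
    intro u v
    show Additive.toMul (L (u + v)) = _
    rw [map_add]
    rfl
  have hz : ∀ i : Fin k, g (Pi.single i 1) = ⟨z i, hzB i i.2⟩ := by
    intro i
    show Additive.toMul (L (Pi.single i 1)) = _
    rw [Fintype.linearCombination_apply_single, one_smul]
    rfl
  have h0 : g 0 = 1 := by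
    have := hadd 0 0
    rw [add_zero] at this
    exact left_eq_mul.1 this
  have hsurj : ∀ b ∈ B, ∃ u, (g u : G) = b := by
    intro b hb
    rw [← hzgen] at hb
    induction hb using Subgroup.closure_induction with
    | mem y hy =>
      obtain ⟨i, hi, rfl⟩ := hy
      exact ⟨Pi.single ⟨i, hi⟩ 1, by rw [hz]⟩
    | one => exact ⟨0, by rw [h0]; rfl⟩
    | mul a b _ _ ha hb =>
      obtain ⟨u, rfl⟩ := ha
      obtain ⟨v, rfl⟩ := hb
      exact ⟨u + v, by rw [hadd]; rfl⟩
    | inv a _ ha =>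
      obtain ⟨u, rfl⟩ := ha
      refine ⟨u, ?_⟩
      rw [eq_inv_iff_mul_eq_one, ← sq]
      exact hBexp _ (g u).2
  have hbij : Function.Bijective g := by
    refine Function.Surjective.bijective_of_nat_card_le ?_ ?_
    · intro b
      obtain ⟨u, hu⟩ := hsurj b b.2
      exact ⟨u, Subtype.ext hu⟩
    · rw [hBcard, Nat.card_eq_fintype_card]
      simp
  refine ⟨fun u => g u, fun u v => by
    show (g (u + v) : G) = _
    rw [hadd]; rfl, fun u => (g u).2, hsurj,
    fun u v h => hbij.1 (Subtype.ext h), fun i hi => ?_⟩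
  show (g (vec k (2 * (⟨i, hi⟩ : Fin k).1 + 1)) : G) = z i
  rw [vec_single, hz]

theorem vec_even {k i : ℕ} (hk : 6 ≤ k) (hi : i + 1 < k) :
    vec k (2 * i + 2) = vec k (2 * i + 1) + vec k (2 * (i + 1) + 1) := by
  have := zero4_iff.1 (zero4_of_quad hk
    (quad1 (k := k) (p := 0) (q := 2 * i + 1) (r := 2 * i + 2) (s := 2 * i + 3) (by omega)))
  rw [vec_zero, zero_add] at this
  rw [this]
  exact (add_cancel_W _ _).symm

theorem vec_a {k : ℕ} (hk : 6 ≤ k) :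
    vec k (2 * k) = vec k (2 * 0 + 2) + vec k (2 * (k - 3) + 1) + vec k (2 * (k - 2) + 1) := by
  have := zero4_iff.1 (zero4_of_quad hk
    (quad7 (k := k) (p := 2 * 0 + 2) (q := 2 * (k - 3) + 1) (r := 2 * (k - 2) + 1)
      (s := 2 * k) (by omega)))
  rw [this, add_comm (vec k (2 * (k - 2) + 1))]
  exact (add_cancel_W _ _).symm

theorem vec_c {k : ℕ} (hk : 6 ≤ k) :
    vec k (2 * k + 1) =
      vec k (2 * 0 + 2) + vec k (2 * (k - 2) + 1) + vec k (2 * (k - 1) + 1) := by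
  have := zero4_iff.1 (zero4_of_quad hk
    (quad8 (k := k) (p := 2 * 0 + 2) (q := 2 * (k - 2) + 1) (r := 2 * (k - 1) + 1)
      (s := 2 * k + 1) (by omega)))
  rw [this, add_comm (vec k (2 * (k - 1) + 1))]
  exact (add_cancel_W _ _).symm

theorem mem_T0_iff {G : Type*} [Group G] {k : ℕ} (hk : 6 ≤ k) (z : ℕ → G)
    (f : (Fin k → ZMod 2) → G) (hadd : ∀ u v, f (u + v) = f u * f v)
    (hinj : Function.Injective f) (hz : ∀ i, i < k → f (vec k (2 * i + 1)) = z i)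
    (w : Fin k → ZMod 2) : w ∈ T0 k ↔ f w ∈ imrichSet k z ∨ f w = 1 := by
  have h0 : f 0 = 1 := by
    have := hadd 0 0
    rw [add_zero] at this
    exact left_eq_mul.1 this
  have he : ∀ i, i + 1 < k → f (vec k (2 * i + 2)) = z i * z (i + 1) := by
    intro i hi
    rw [vec_even hk hi, hadd, hz i (by omega), hz (i + 1) hi]
  have ha : f (vec k (2 * k)) = z 0 * z 1 * z (k - 3) * z (k - 2) := by
    rw [vec_a hk, hadd, hadd, he 0 (by omega), hz (k - 3) (by omega), hz (k - 2) (by omega)]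
  have hc : f (vec k (2 * k + 1)) = z 0 * z 1 * z (k - 2) * z (k - 1) := by
    rw [vec_c hk, hadd, hadd, he 0 (by omega), hz (k - 2) (by omega), hz (k - 1) (by omega)]
  unfold imrichSet
  constructor
  · rintro ⟨p, hp, rfl⟩
    by_cases p0 : p = 0
    · right
      rw [p0, vec_zero, h0]
    left
    by_cases pa : p = 2 * k
    · rw [pa]
      exact Or.inr (Or.inl ha)
    by_cases pc : p = 2 * k + 1
    · rw [pc]
      exact Or.inr (Or.inr hc)
    rcases Nat.even_or_odd' p with ⟨i, hi | hi⟩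
    · obtain ⟨j, rfl⟩ : ∃ j, i = j + 1 := ⟨i - 1, by omega⟩
      have hi' : p = 2 * j + 2 := by omega
      rw [hi']
      exact Or.inl (Or.inr ⟨j, by omega, he j (by omega)⟩)
    · rw [hi]
      exact Or.inl (Or.inl ⟨i, Set.mem_Iio.2 (by omega), (hz i (by omega)).symm⟩)
  · rintro (((⟨i, hi, h⟩ | ⟨i, hi, h⟩) | h | h) | h)
    · rw [Set.mem_Iio] at hi
      rw [← hz i hi] at h
      exact ⟨2 * i + 1, by omega, (hinj h).symm⟩
    · rw [← he i hi] at h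
      exact ⟨2 * i + 2, by omega, hinj h⟩
    · rw [← ha] at h
      exact ⟨2 * k, by omega, hinj h⟩
    · rw [Set.mem_singleton_iff, ← hc] at h
      exact ⟨2 * k + 1, by omega, hinj h⟩
    · rw [← h0] at h
      rw [hinj h]
      exact zero_mem_T0 k

theorem T0_ncard (k : ℕ) : (T0 k).ncard ≤ 2 * k + 2 := by
  have : T0 k ⊆ vec k '' (Finset.range (2 * k + 2) : Set ℕ) := by
    rintro w ⟨p, hp, rfl⟩
    exact ⟨p, by simpa using hp, rfl⟩
  calc (T0 k).ncard ≤ (vec k '' (Finset.range (2 * k + 2) : Set ℕ)).ncard :=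
        Set.ncard_le_ncard this (Set.toFinite _)
    _ ≤ (Finset.range (2 * k + 2) : Set ℕ).ncard := Set.ncard_image_le (Set.toFinite _)
    _ = 2 * k + 2 := by rw [Set.ncard_coe_finset, Finset.card_range]

theorem pow_bound {k : ℕ} (hk : 6 ≤ k) : 4 * k + 40 ≤ 2 ^ k := by
  induction k, hk using Nat.le_induction with
  | base => norm_num
  | succ n hn ih =>
    have : 2 ^ (n + 1) = 2 ^ n + 2 ^ n := by ring
    omega

theorem good_ncard {k : ℕ} (hk : 6 ≤ k) (c : Fin k → ZMod 2) :
    36 ≤ {w : Fin k → ZMod 2 | w ∉ T0 k ∧ w + c ∉ T0 k}.ncard := by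
  have e : {w : Fin k → ZMod 2 | w ∉ T0 k ∧ w + c ∉ T0 k} =
      (T0 k ∪ (fun w => w + c) '' T0 k)ᶜ := by
    ext w
    simp only [Set.mem_setOf_eq, Set.mem_compl_iff, Set.mem_union, not_or, Set.mem_image]
    refine and_congr_right (fun _ => not_congr ⟨fun h => ⟨_, h, add_cancel_W _ _⟩, ?_⟩)
    rintro ⟨v, hv, rfl⟩
    rwa [add_cancel_W]
  have h1 := Set.ncard_union_le (T0 k) ((fun w => w + c) '' T0 k)
  have h2 := Set.ncard_image_le (f := fun w => w + c) (Set.toFinite (T0 k))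
  have h3 := T0_ncard k
  have h4 := Set.ncard_add_ncard_compl (T0 k ∪ (fun w => w + c) '' T0 k)
  have h5 : Nat.card (Fin k → ZMod 2) = 2 ^ k := by
    rw [Nat.card_eq_fintype_card]; simp
  have h6 : 4 * k + 40 ≤ 2 ^ k := pow_bound hk
  rw [e]
  omega

end ImrichAux

/-- Let `B < G` be an elementary abelian 2-group of rank `k ≥ 6`, centralised by
`x ∈ G`, let `T` be the Imrich generating set of `B` with respect to some generating
tuple, and let `S` be a generating set for `G` with
`S = ((Bx ∖ Tx) ∖ {x}) ∪ X` where `X ⊆ G ∖ ⟨B,x⟩` and `|X| ≤ 17`. Then every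
automorphism of `Cay(G,S)` fixing the vertex `1` fixes `B` pointwise and fixes `x`. -/
theorem imrich_coset_fixes_B_and_x {G : Type*} [Group G] (k : ℕ) (hk : 6 ≤ k)
    (B : Subgroup G) (hBlt : B < ⊤)
    (hBcomm : ∀ a ∈ B, ∀ b ∈ B, a * b = b * a)
    (hBexp : ∀ b ∈ B, b ^ 2 = 1)
    (hBcard : Nat.card B = 2 ^ k)
    (x : G) (hx : ∀ b ∈ B, x * b = b * x)
    (z : ℕ → G) (hzB : ∀ i < k, z i ∈ B)
    (hzgen : Subgroup.closure (z '' Set.Iio k) = B)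
    (T : Set G) (hT : T = imrichSet k z)
    (X : Set G) (hX : ∀ u ∈ X, u ∉ Subgroup.closure ((B : Set G) ∪ {x}))
    (hXfin : X.Finite) (hXcard : X.ncard ≤ 17)
    (S : Set G)
    (hS : S = (rightCosetSet B x \ (· * x) '' T) \ {x} ∪ X)
    (hSgen : Subgroup.closure S = ⊤) :
    ∀ φ : Equiv.Perm G, IsCayleyAut S φ → φ 1 = 1 →
      (∀ b ∈ B, φ b = b) ∧ φ x = x := by
  intro φ hφ h1
  obtain ⟨f, hadd, hfB, hfsurj, hfinj, hfz⟩ :=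
    ImrichAux.exists_coord k B hBcomm hBexp hBcard z hzB hzgen
  have hT0 := ImrichAux.mem_T0_iff hk z f hadd hfinj hfz
  rw [← hT] at hT0
  have f0 : f 0 = 1 := by
    have := hadd 0 0
    rw [add_zero] at this
    exact left_eq_mul.1 this
  have finv : ∀ u, (f u)⁻¹ = f u := by
    intro u
    rw [inv_eq_iff_mul_eq_one, ← hadd, ImrichAux.add_self_W, f0]
  -- membership in the connection set
  have hmem : ∀ w, f w * x ∈ S ↔ w ∉ ImrichAux.T0 k := by
    intro w
    rw [hS, hT0]
    constructor
    · rintro (⟨⟨-, h2⟩, h3⟩ | h)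
      · rintro (h | h)
        · exact h2 ⟨_, h, rfl⟩
        · exact h3 (by rw [h, one_mul]; rfl)
      · have hmul : f w * x ∈ Subgroup.closure ((B : Set G) ∪ {x}) :=
          Subgroup.mul_mem _ (Subgroup.subset_closure (Or.inl (hfB w)))
            (Subgroup.subset_closure (Or.inr rfl))
        exact absurd hmul (hX _ h)
    · intro h
      refine Or.inl ⟨⟨⟨_, hfB w, rfl⟩, ?_⟩, ?_⟩
      · rintro ⟨t, ht, e⟩
        exact h (Or.inl (by rw [← mul_right_cancel e]; exact ht))
      · intro e
        exact h (Or.inr (mul_eq_right.1 e))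
  have hSsub : ∀ s ∈ S, (∃ b ∈ B, s = b * x) ∨ s ∈ X := by
    intro s hs
    rw [hS] at hs
    rcases hs with ⟨⟨⟨b, hb, e⟩, -⟩, -⟩ | h
    · exact Or.inl ⟨b, hb, e.symm⟩
    · exact Or.inr h
  have hBfin : (B : Set G).Finite := by
    refine Set.Finite.subset (Set.finite_range f) (fun b hb => ?_)
    exact hfsurj b hb
  have hSfin : S.Finite := by
    refine Set.Finite.subset ((hBfin.image (· * x)).union hXfin) (fun s hs => ?_)
    rcases hSsub s hs with ⟨b, hb, rfl⟩ | h
    · exact Or.inl ⟨b, hb, rfl⟩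
    · exact Or.inr h
  -- common out-neighbourhoods
  let N : G → G → Set G := fun u v => {y | y * u⁻¹ ∈ S ∧ y * v⁻¹ ∈ S}
  have hNfin : ∀ u v, (N u v).Finite := by
    intro u v
    refine Set.Finite.subset (hSfin.image (· * u)) (fun y hy => ?_)
    exact ⟨y * u⁻¹, hy.1, inv_mul_cancel_right y u⟩
  have hNφ : ∀ u v, (N (φ u) (φ v)).ncard = (N u v).ncard := by
    intro u v
    have : N (φ u) (φ v) = φ '' N u v := by
      ext y
      obtain ⟨y, rfl⟩ := φ.surjective y
      rw [φ.injective.mem_set_image]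
      show (_ ∧ _) ↔ (_ ∧ _)
      rw [← hφ, ← hφ]
    rw [this, Set.ncard_image_of_injective _ φ.injective]
  have hNbig : ∀ u v, u * v⁻¹ ∈ B → 36 ≤ (N u v).ncard := by
    intro u v huv
    obtain ⟨c, hc⟩ := hfsurj _ huv
    refine (ImrichAux.good_ncard hk c).trans ?_
    have hinj : Function.Injective (fun w => f w * x * u) := by
      intro w w' e
      exact hfinj (mul_right_cancel (mul_right_cancel e))
    rw [← Set.ncard_image_of_injective _ hinj]
    refine Set.ncard_le_ncard ?_ (hNfin u v)
    rintro _ ⟨w, ⟨hw1, hw2⟩, rfl⟩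
    constructor
    · rw [mul_inv_cancel_right]
      exact (hmem w).2 hw1
    · have : f w * x * u * v⁻¹ = f (w + c) * x := by
        rw [hadd, mul_assoc, ← hc, mul_assoc, mul_assoc, hx _ (hfB c)]
      show f w * x * u * v⁻¹ ∈ S
      rw [this]
      exact (hmem _).2 hw2
  have hNsmall : ∀ u v, 36 ≤ (N u v).ncard → u * v⁻¹ ∈ B := by
    intro u v h
    by_contra huv
    have hsub : N u v ⊆ (· * u) '' X ∪ (· * v) '' X := by
      rintro y ⟨hy1, hy2⟩
      rcases hSsub _ hy1 with ⟨b, hb, e⟩ | h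
      · rcases hSsub _ hy2 with ⟨b', hb', e'⟩ | h
        · exfalso
          apply huv
          have e1 : y = b * x * u := by rw [← e, inv_mul_cancel_right]
          have e2 : y = b' * x * v := by rw [← e', inv_mul_cancel_right]
          have e3 : x * (u * v⁻¹) = b⁻¹ * b' * x := by
            have : b * x * u = b' * x * v := e1.symm.trans e2
            rw [mul_assoc b⁻¹, eq_inv_mul_iff_mul_eq, ← mul_assoc, ← mul_assoc, this,
              mul_inv_cancel_right]
          have hB := B.mul_mem (B.inv_mem hb) hb'
          rw [← hx _ hB] at e3
          rw [mul_left_cancel e3]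
          exact hB
        · exact Or.inr ⟨_, h, inv_mul_cancel_right y v⟩
      · exact Or.inl ⟨_, h, inv_mul_cancel_right y u⟩
    have c1 := Set.ncard_le_ncard hsub ((hXfin.image _).union (hXfin.image _))
    have c2 := Set.ncard_union_le ((· * u) '' X) ((· * v) '' X)
    have c3 := Set.ncard_image_le (f := (· * u)) hXfin
    have c4 := Set.ncard_image_le (f := (· * v)) hXfin
    omega
  have hcos : ∀ u v, u * v⁻¹ ∈ B → φ u * (φ v)⁻¹ ∈ B := by
    intro u v h
    refine hNsmall _ _ ?_
    rw [hNφ]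
    exact hNbig u v h
  have hφB : ∀ b ∈ B, φ b ∈ B := by
    intro b hb
    have := hcos b 1 (by rwa [inv_one, mul_one])
    rwa [h1, inv_one, mul_one] at this
  -- the coset of x is preserved
  have hex : ∃ w, φ (f w * x) ∉ X ∧ w ∉ ImrichAux.T0 k := by
    by_contra hcon
    push Not at hcon
    have hg := ImrichAux.good_ncard hk 0
    have hinj : Function.Injective (fun w => φ (f w * x)) := by
      intro w w' e
      exact hfinj (mul_right_cancel (φ.injective e))
    rw [← Set.ncard_image_of_injective _ hinj] at hg
    have hsub : (fun w => φ (f w * x)) '' {w | w ∉ ImrichAux.T0 k ∧ w + 0 ∉ ImrichAux.T0 k} ⊆ X := by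
      rintro _ ⟨w, ⟨hw, -⟩, rfl⟩
      by_contra hw'
      exact hw (hcon w hw')
    have := Set.ncard_le_ncard hsub hXfin
    omega
  obtain ⟨w0, hw0X, hw0⟩ := hex
  have hw0B : ∃ b ∈ B, φ (f w0 * x) = b * x := by
    have h2 := (hφ 1 (f w0 * x)).1 (by
      rw [inv_one, mul_one]
      exact (hmem w0).2 hw0)
    rw [h1, inv_one, mul_one] at h2
    rcases hSsub _ h2 with h | h
    · exact h
    · exact absurd h hw0X
  have hφBx : ∀ b ∈ B, ∃ b' ∈ B, φ (b * x) = b' * x := by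
    intro b hb
    obtain ⟨b0, hb0, e⟩ := hw0B
    have h2 := hcos (b * x) (f w0 * x) (by
      rw [mul_inv_rev, ← mul_assoc, mul_inv_cancel_right]
      exact B.mul_mem hb (B.inv_mem (hfB w0)))
    rw [e] at h2
    refine ⟨_, B.mul_mem h2 hb0, ?_⟩
    rw [mul_assoc, inv_mul_cancel_right]
  -- coordinates
  have hα : ∀ u, ∃ v, f v = φ (f u) := fun u => hfsurj _ (hφB _ (hfB u))
  have hβ : ∀ u, ∃ v, f v * x = φ (f u * x) := by
    intro u
    obtain ⟨b', hb', e⟩ := hφBx _ (hfB u)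
    obtain ⟨v, rfl⟩ := hfsurj b' hb'
    exact ⟨v, e.symm⟩
  choose α hα using hα
  choose β hβ using hβ
  have hαbij : Function.Bijective α := by
    refine Finite.injective_iff_bijective.1 (fun u v e => hfinj (φ.injective ?_))
    rw [← hα, ← hα, e]
  have hβbij : Function.Bijective β := by
    refine Finite.injective_iff_bijective.1
      (fun u v e => hfinj (mul_right_cancel (b := x) (φ.injective ?_)))
    rw [← hβ, ← hβ, e]
  have harc : ∀ u v, f v * x * (f u)⁻¹ = f (v + u) * x := by
    intro u v
    rw [finv, mul_assoc, hx _ (hfB u), ← mul_assoc, hadd]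
  have hcore := ImrichAux.core hk hαbij hβbij (fun u v => by
      rw [← not_iff_not, ← hmem, ← hmem, ← harc, ← harc, hα, hβ]
      exact hφ _ _) (hfinj (by rw [hα, f0, h1]))
  constructor
  · intro b hb
    obtain ⟨u, rfl⟩ := hfsurj b hb
    rw [← hα, hcore.1]
  · have := hβ 0
    rw [hcore.2, f0, one_mul] at this
    exact this.symm
end

section
/- Let ℓ and κ be non-negative integers, let V be an elementary abelian 2-group of rank 2ℓ+κ with generating set {v_1,w_1,…,v_ℓ,w_ℓ,e_1,…,e_κ}, and let G = V ⋊ ⟨x⟩ where x^2 = 1, v_i^x = w_i and w_i^x = v_i for every i ∈ {1,…,ℓ}, and e_i^x = e_i for every i ∈ {1,…,κ}. If ℓ ≥ 2 and 2ℓ+κ ≥ 8, then G admits an oriented regular representation. -/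
/-! ### Combinatorics in `E = Fin m → ZMod 2` -/

def fE (m i : ℕ) : Fin m → ZMod 2 := fun k => if k.val = i then 1 else 0
def zE (m a : ℕ) : Fin m → ZMod 2 := fun k => if k.val < a then 1 else 0
def yE (m : ℕ) : Fin m → ZMod 2 := fun k => if k.val = 2 ∨ k.val = 3 then 1 else 0
def oE (m : ℕ) : Fin m → ZMod 2 := fun k => if k.val = 1 ∨ k.val = 2 then 1 else 0

def XP (m : ℕ) : Set (Fin m → ZMod 2) := {t | (∃ a ≤ m, t = zE m a) ∨ t = yE m}
def XQ (m : ℕ) : Set (Fin m → ZMod 2) := {t | t = 0 ∨ ∃ i < m, t = fE m i}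
def XR (m : ℕ) : Set (Fin m → ZMod 2) := {0, fE m 0, oE m}

/-- `X + X`. -/
def dif {E : Type*} [AddCommGroup E] (X Y : Set E) : Set E := {t | ∃ a ∈ X, ∃ b ∈ Y, t = a + b}

lemma ev_fE {m : ℕ} (i k : ℕ) (hk : k < m) :
    fE m i ⟨k, hk⟩ = if k = i then 1 else 0 := rfl
lemma ev_zE {m : ℕ} (i k : ℕ) (hk : k < m) :
    zE m i ⟨k, hk⟩ = if k < i then 1 else 0 := rfl
lemma ev_yE {m : ℕ} (k : ℕ) (hk : k < m) :
    yE m ⟨k, hk⟩ = if k = 2 ∨ k = 3 then 1 else 0 := rfl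
lemma ev_oE {m : ℕ} (k : ℕ) (hk : k < m) :
    oE m ⟨k, hk⟩ = if k = 1 ∨ k = 2 then 1 else 0 := rfl

lemma zmod2_ite (p q : Prop) [Decidable p] [Decidable q] :
    ((if p then (1 : ZMod 2) else 0) = if q then 1 else 0) ↔ (p ↔ q) := by
  by_cases hp : p <;> by_cases hq : q <;> simp [hp, hq]

lemma zmod2_ite_add (p q : Prop) [Decidable p] [Decidable q] :
    ((if p then (1 : ZMod 2) else 0) + if q then 1 else 0) = if ¬ (p ↔ q) then 1 else 0 := by
  by_cases hp : p <;> by_cases hq : q <;> simp [hp, hq] <;> decide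

lemma zmod2_ite_zero (p : Prop) [Decidable p] :
    ((if p then (1 : ZMod 2) else 0) = 0) ↔ ¬ p := by
  by_cases hp : p <;> simp [hp]

lemma zmod2_zero_ite (p : Prop) [Decidable p] :
    ((0 : ZMod 2) = (if p then (1 : ZMod 2) else 0)) ↔ ¬ p := by
  by_cases hp : p <;> simp [hp]

lemma zE_zero (m : ℕ) : zE m 0 = 0 := by
  funext k; simp [zE]

lemma zE_succ (m i : ℕ) : fE m i = zE m i + zE m (i + 1) := by
  funext ⟨k, hk⟩
  simp only [Pi.add_apply, ev_fE, ev_zE, zmod2_ite_add, zmod2_ite]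
  omega

lemma add_self2 {m : ℕ} (t : Fin m → ZMod 2) : t + t = 0 := by
  funext k; exact CharTwo.add_self_eq_zero _

lemma zE_mem {m a : ℕ} (h : a ≤ m) : zE m a ∈ XP m := Or.inl ⟨a, h, rfl⟩
lemma zero_mem_XP (m : ℕ) : (0 : Fin m → ZMod 2) ∈ XP m := zE_zero m ▸ zE_mem (Nat.zero_le _)

lemma f_mem_D {m i : ℕ} (hi : i < m) : fE m i ∈ dif (XP m) (XP m) :=
  ⟨_, zE_mem hi.le, _, zE_mem hi, zE_succ m i⟩

lemma ff_mem_D {m i : ℕ} (hi : i + 1 < m) : fE m i + fE m (i + 1) ∈ dif (XP m) (XP m) := by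
  refine ⟨_, zE_mem (a := i) (by omega), _, zE_mem (a := i + 2) (by omega), ?_⟩
  rw [zE_succ, zE_succ, add_assoc, ← add_assoc (zE m (i+1)), add_self2, zero_add]

lemma ff_not_mem_D {m i j : ℕ} (hm : 4 ≤ m) (hij : i + 2 ≤ j) (hj : j < m) :
    fE m i + fE m j ∉ dif (XP m) (XP m) := by
  rintro ⟨s, hs, t, ht, h⟩
  have key : ∀ a b, fE m i + fE m j ≠ zE m a + zE m b := by
    intro a b h
    have h1 := congrFun h ⟨i, by omega⟩
    have h2 := congrFun h ⟨i + 1, by omega⟩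
    have h3 := congrFun h ⟨j, by omega⟩
    simp only [Pi.add_apply, ev_fE, ev_zE, zmod2_ite_add, zmod2_ite] at h1 h2 h3
    grind
  have key2 : ∀ a ≤ m, fE m i + fE m j ≠ zE m a + yE m := by
    intro a ha h
    have h0 := congrFun h ⟨0, by omega⟩
    have h1 := congrFun h ⟨1, by omega⟩
    have h2 := congrFun h ⟨2, by omega⟩
    have h3 := congrFun h ⟨3, by omega⟩
    have h4 := congrFun h ⟨i, by omega⟩
    have h5 := congrFun h ⟨j, by omega⟩
    simp only [Pi.add_apply, ev_fE, ev_zE, ev_yE, zmod2_ite_add, zmod2_ite] at h0 h1 h2 h3 h4 h5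
    grind
  rcases hs with ⟨a, ha, rfl⟩ | rfl <;> rcases ht with ⟨b, hb, rfl⟩ | rfl
  · exact key _ _ h
  · exact key2 _ ha h
  · exact key2 _ hb (by rw [h, add_comm])
  · refine key 0 0 ?_
    rw [h, add_self2, add_self2]

lemma ff_not_mem_D' {m i : ℕ} (hm : 4 ≤ m) (hi : i < m) :
    ∃ j < m, fE m i + fE m j ∉ dif (XP m) (XP m) := by
  by_cases h : i + 2 < m
  · exact ⟨i + 2, h, ff_not_mem_D hm le_rfl h⟩
  · refine ⟨0, by omega, ?_⟩
    rw [add_comm]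
    exact ff_not_mem_D hm (by omega) hi

lemma fE_inj {m i j : ℕ} (hi : i < m) (h : fE m i = fE m j) : i = j := by
  have h1 := congrFun h ⟨i, hi⟩
  simp only [ev_fE, zmod2_ite] at h1
  grind

lemma fE_ne_zero {m i : ℕ} (hi : i < m) : fE m i ≠ 0 := by
  intro h
  have h1 := congrFun h ⟨i, hi⟩
  simp [ev_fE] at h1

lemma zE_inj {m i j : ℕ} (hi : i ≤ m) (hj : j ≤ m) (h : zE m i = zE m j) : i = j := by
  by_contra hne
  rcases lt_or_gt_of_ne hne with hl | hl
  · have h1 := congrFun h ⟨i, by omega⟩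
    simp only [ev_zE, zmod2_ite] at h1
    grind
  · have h1 := congrFun h ⟨j, by omega⟩
    simp only [ev_zE, zmod2_ite] at h1
    grind

lemma yE_ne_zE {m a : ℕ} (hm : 4 ≤ m) : yE m ≠ zE m a := by
  intro h
  have h1 := congrFun h ⟨0, by omega⟩
  have h2 := congrFun h ⟨2, by omega⟩
  simp only [ev_zE, ev_yE, zmod2_ite] at h1 h2
  grind

lemma card_XQ (m : ℕ) : (XQ m).ncard = m + 1 := by
  have : XQ m = insert 0 ((fE m) '' (Finset.range m : Set ℕ)) := by
    ext t; simp [XQ, eq_comm]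
  rw [this, Set.ncard_insert_of_notMem, Set.InjOn.ncard_image, Set.ncard_coe_finset,
    Finset.card_range]
  · intro i hi j hj h
    exact fE_inj (by simpa using hi) h
  · rintro ⟨i, hi, h⟩
    exact fE_ne_zero (by simpa using hi) h

lemma card_XP {m : ℕ} (hm : 4 ≤ m) : (XP m).ncard = m + 2 := by
  have : XP m = insert (yE m) ((zE m) '' (Finset.range (m + 1) : Set ℕ)) := by
    ext t; simp [XP, eq_comm, or_comm]
  rw [this, Set.ncard_insert_of_notMem, Set.InjOn.ncard_image, Set.ncard_coe_finset,
    Finset.card_range]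
  · intro i hi j hj h
    simp at hi hj
    exact zE_inj (by omega) (by omega) h
  · rintro ⟨i, hi, h⟩
    exact yE_ne_zE hm h.symm

lemma card_XR (m : ℕ) : (XR m).ncard ≤ 3 := by
  unfold XR
  refine (Set.ncard_insert_le _ _).trans ?_
  have := Set.ncard_insert_le (fE m 0) {oE m}
  simp at this ⊢
  omega

def XX (m : ℕ) : Fin 3 → Set (Fin m → ZMod 2) := ![XP m, XQ m, XR m]

lemma card_XX {m : ℕ} (hm : 4 ≤ m) (i k : Fin 3) (h : (XX m i)ᶜ.ncard = (XX m k)ᶜ.ncard) :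
    i = k := by
  have h1 := Set.ncard_add_ncard_compl (XX m i)
  have h2 := Set.ncard_add_ncard_compl (XX m k)
  have h3 : (XX m i).ncard = (XX m k).ncard := by omega
  have hp := card_XP hm
  have hq := card_XQ m
  have hr := card_XR m
  fin_cases i <;> fin_cases k <;> simp [XX] at h3 ⊢ <;> omega

lemma compl_XX {m : ℕ} (hm : 4 ≤ m) (i : Fin 3) : ∃ t, t ∉ XX m i := by
  have hc : (XX m i).ncard ≤ m + 2 := by
    have hp := card_XP hm
    have hq := card_XQ m
    have hr := card_XR m
    fin_cases i <;> simp [XX] <;> omega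
  by_contra! h
  have : XX m i = Set.univ := Set.eq_univ_of_forall h
  rw [this, Set.ncard_univ, Nat.card_eq_fintype_card] at hc
  simp at hc
  obtain ⟨k, rfl⟩ := Nat.exists_eq_add_of_le hm
  have := Nat.lt_two_pow_self (n := k)
  rw [pow_add] at hc
  omega

lemma XR_diff {m : ℕ} (hm : 4 ≤ m) (d : Fin m → ZMod 2) : ∃ t, t ∉ XR m ∧ d + t ∉ XR m := by
  by_contra! h
  have hu : XR m ∪ (fun s => d + s) '' XR m = Set.univ := by
    refine Set.eq_univ_of_forall fun t => ?_
    by_cases ht : t ∈ XR m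
    · exact Or.inl ht
    · exact Or.inr ⟨d + t, h t ht, by simp only [← add_assoc, add_self2, zero_add]⟩
  have h1 := Set.ncard_union_le (XR m) ((fun s => d + s) '' XR m)
  have h2 := Set.ncard_image_le (f := fun s => d + s) (Set.toFinite (XR m))
  have h3 := card_XR m
  rw [hu, Set.ncard_univ, Nat.card_eq_fintype_card] at h1
  simp only [Fintype.card_pi, ZMod.card, Finset.prod_const, Finset.card_univ, Fintype.card_fin] at h1
  have : 2 ^ 4 ≤ 2 ^ m := Nat.pow_le_pow_right (by norm_num) hm
  omega

lemma f0_ne_oE {m : ℕ} (hm : 4 ≤ m) : fE m 0 + oE m ∉ XR m := by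
  rintro (h | h | h)
  · have h1 := congrFun h ⟨0, by omega⟩
    simp [Pi.add_apply, ev_fE, ev_oE] at h1
  · have h1 := congrFun h ⟨1, by omega⟩
    simp [Pi.add_apply, ev_fE, ev_oE] at h1
  · have h1 := congrFun h ⟨0, by omega⟩
    simp [Pi.add_apply, ev_fE, ev_oE] at h1

lemma oE_not_XQ {m : ℕ} (hm : 4 ≤ m) : oE m ∉ XQ m := by
  rintro (h | ⟨i, hi, h⟩)
  · have h1 := congrFun h ⟨1, by omega⟩
    simp [ev_oE] at h1
  · have h1 := congrFun h ⟨1, by omega⟩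
    have h2 := congrFun h ⟨2, by omega⟩
    simp only [ev_oE, ev_fE, zmod2_ite] at h1 h2
    grind

lemma f0oE_not_XQ {m : ℕ} (hm : 4 ≤ m) : fE m 0 + oE m ∉ XQ m := by
  rintro (h | ⟨i, hi, h⟩)
  · have h1 := congrFun h ⟨1, by omega⟩
    simp [ev_oE, ev_fE] at h1
  · have h1 := congrFun h ⟨1, by omega⟩
    have h2 := congrFun h ⟨2, by omega⟩
    simp only [Pi.add_apply, ev_oE, ev_fE, zmod2_ite_add, zmod2_ite] at h1 h2
    grind

lemma DR_inter {m : ℕ} (hm : 4 ≤ m) {t : Fin m → ZMod 2} :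
    (t ∈ dif (XR m) (XR m) ∧ t ∈ XQ m ∧ t ≠ 0) ↔ t = fE m 0 := by
  constructor
  · rintro ⟨⟨a, ha, b, hb, rfl⟩, hq, h0⟩
    have ho := oE_not_XQ hm
    have hfo := f0oE_not_XQ hm
    rcases ha with rfl | rfl | rfl <;> rcases hb with rfl | rfl | rfl <;>
      simp_all [add_self2, add_comm]
  · rintro rfl
    exact ⟨⟨0, by simp [XR], fE m 0, by simp [XR], by simp⟩, Or.inr ⟨0, by omega, rfl⟩,
      fE_ne_zero (by omega)⟩

lemma stab_XR {m : ℕ} (hm : 4 ≤ m) {t : Fin m → ZMod 2} :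
    (t ∈ XR m ∧ ∀ d ∈ XR m, d + t ∈ XR m) ↔ t = 0 := by
  constructor
  · rintro ⟨rfl | rfl | rfl, h⟩
    · rfl
    · exact absurd (add_comm (fE m 0) _ ▸ h (oE m) (by simp [XR])) (f0_ne_oE hm)
    · exact absurd (h (fE m 0) (by simp [XR])) (f0_ne_oE hm)
  · rintro rfl
    exact ⟨by simp [XR], fun d hd => by simpa using hd⟩

lemma stab_XP {m : ℕ} (hm : 4 ≤ m) {t : Fin m → ZMod 2} :
    (t ∈ XP m ∧ ∀ d ∈ XP m, d + t ∈ XP m) ↔ t = 0 := by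
  constructor
  · rintro ⟨⟨a, ha, rfl⟩ | rfl, h⟩
    · by_contra hne
      have ha0 : a ≠ 0 := by rintro rfl; exact hne (zE_zero m)
      by_cases ha1 : a = 1
      · subst ha1
        rcases h _ (zE_mem (a := 2) (by omega)) with ⟨b, hb, h⟩ | h
        · have h1 := congrFun h ⟨0, by omega⟩
          have h2 := congrFun h ⟨1, by omega⟩
          simp only [Pi.add_apply, ev_zE, zmod2_ite_add, zmod2_ite] at h1 h2
          grind
        · have h2 := congrFun h ⟨1, by omega⟩
          simp only [Pi.add_apply, ev_zE, ev_yE, zmod2_ite_add, zmod2_ite] at h2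
          grind
      · rcases h _ (zE_mem (a := 1) (by omega)) with ⟨b, hb, h⟩ | h
        · have h1 := congrFun h ⟨0, by omega⟩
          have h2 := congrFun h ⟨1, by omega⟩
          simp only [Pi.add_apply, ev_zE, zmod2_ite_add, zmod2_ite] at h1 h2
          grind
        · have h2 := congrFun h ⟨1, by omega⟩
          simp only [Pi.add_apply, ev_zE, ev_yE, zmod2_ite_add, zmod2_ite] at h2
          grind
    · exfalso
      rcases h _ (zE_mem (a := 1) (by omega)) with ⟨b, hb, h⟩ | h
      · have h1 := congrFun h ⟨1, by omega⟩
        have h2 := congrFun h ⟨2, by omega⟩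
        simp only [Pi.add_apply, ev_zE, ev_yE, zmod2_ite_add, zmod2_ite] at h1 h2
        grind
      · have h2 := congrFun h ⟨0, by omega⟩
        simp only [Pi.add_apply, ev_zE, ev_yE, zmod2_ite_add, zmod2_ite] at h2
        grind
  · rintro rfl
    exact ⟨zero_mem_XP m, fun d hd => by simpa using hd⟩

lemma base_XQ {m : ℕ} (hm : 4 ≤ m) {t : Fin m → ZMod 2} :
    (t ∈ XQ m ∧ ∀ s ∈ XQ m, t + s ∈ dif (XP m) (XP m)) ↔ t = 0 := by
  constructor
  · rintro ⟨rfl | ⟨i, hi, rfl⟩, h⟩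
    · rfl
    · obtain ⟨j, hj, hn⟩ := ff_not_mem_D' hm hi
      exact absurd (h _ (Or.inr ⟨j, hj, rfl⟩)) hn
  · rintro rfl
    refine ⟨Or.inl rfl, ?_⟩
    rintro s (rfl | ⟨i, hi, rfl⟩)
    · exact ⟨0, zero_mem_XP m, 0, zero_mem_XP m, rfl⟩
    · rw [zero_add]; exact f_mem_D hi

lemma step_XQ {m i : ℕ} (hm : 4 ≤ m) (hi : i + 1 < m) {t : Fin m → ZMod 2} :
    (t ∈ XQ m ∧ fE m i + t ∈ dif (XP m) (XP m) ∧ t ≠ 0 ∧ t ∉ {s | ∃ j ≤ i, s = fE m j}) ↔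
      t = fE m (i + 1) := by
  constructor
  · rintro ⟨h0 | ⟨j, hj, rfl⟩, hD, h1, h2⟩
    · exact absurd h0 h1
    · have : ¬ j ≤ i := fun hji => h2 ⟨j, hji, rfl⟩
      by_cases hj2 : i + 2 ≤ j
      · exact absurd hD (ff_not_mem_D hm hj2 hj)
      · rw [show j = i + 1 by omega]
  · rintro rfl
    refine ⟨Or.inr ⟨_, hi, rfl⟩, ff_mem_D hi, fE_ne_zero hi, ?_⟩
    rintro ⟨j, hj, h⟩
    have := fE_inj hi h
    omega

lemma gen_fE {m : ℕ} (H : AddSubgroup (Fin m → ZMod 2)) (h : ∀ i < m, fE m i ∈ H)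
    (t : Fin m → ZMod 2) : t ∈ H := by
  rw [← Finset.univ_sum_single t]
  refine sum_mem fun i _ => ?_
  have h2 : ∀ c : ZMod 2, c = 0 ∨ c = 1 := by decide
  rcases h2 (t i) with h0 | h1
  · rw [h0]; simp
  · rw [h1]
    convert h i i.2
    funext k
    simp [fE, Pi.single_apply, Fin.ext_iff]

/-! ### Sets preserved by a permutation -/

section Definable

open Pointwise

variable {G : Type*} [Group G] {φ : Equiv.Perm G}

lemma ca_compl {D : Set G} (h : IsCayleyAut D φ) : IsCayleyAut Dᶜ φ :=
  fun x y => not_congr (h x y)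

lemma ca_inter {D D' : Set G} (h : IsCayleyAut D φ) (h' : IsCayleyAut D' φ) :
    IsCayleyAut (D ∩ D') φ := fun x y => and_congr (h x y) (h' x y)

lemma ca_diff {D D' : Set G} (h : IsCayleyAut D φ) (h' : IsCayleyAut D' φ) :
    IsCayleyAut (D \ D') φ := fun x y => and_congr (h x y) (not_congr (h' x y))

lemma ca_exists {ι : Sort*} {D : ι → Set G} (h : ∀ i, IsCayleyAut (D i) φ) :
    IsCayleyAut {g | ∃ i, g ∈ D i} φ := fun x y => exists_congr fun i => h i x y

lemma ca_inv {D : Set G} (h : IsCayleyAut D φ) : IsCayleyAut D⁻¹ φ := by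
  intro x y
  have := h y x
  simpa [Set.mem_inv] using this

lemma ca_one : IsCayleyAut ({1} : Set G) φ := by
  intro x y
  simp [mul_inv_eq_one]

lemma ca_mul {D D' : Set G} (h : IsCayleyAut D φ) (h' : IsCayleyAut D' φ) :
    IsCayleyAut (D * D') φ := by
  have key : ∀ x y : G, y * x⁻¹ ∈ D * D' ↔ ∃ z, y * z⁻¹ ∈ D ∧ z * x⁻¹ ∈ D' := by
    intro x y
    rw [Set.mem_mul]
    constructor
    · rintro ⟨a, ha, b, hb, hab⟩
      refine ⟨b * x, ?_, by simpa using hb⟩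
      have : y = a * b * x := by rw [hab]; group
      rw [this]; simpa [mul_assoc] using ha
    · rintro ⟨z, h1, h2⟩
      exact ⟨_, h1, _, h2, by group⟩
  intro x y
  rw [key, key]
  constructor
  · rintro ⟨z, h1, h2⟩
    exact ⟨φ z, (h _ _).1 h1, (h' _ _).1 h2⟩
  · rintro ⟨z, h1, h2⟩
    refine ⟨φ.symm z, (h _ _).2 ?_, (h' _ _).2 ?_⟩ <;> simpa

lemma ca_count {D D' : Set G} (h : IsCayleyAut D φ) (h' : IsCayleyAut D' φ) (n : ℕ) :
    IsCayleyAut {g | {z | z * g⁻¹ ∈ D ∧ z ∈ D'}.ncard = n} φ := by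
  have key : ∀ x y : G, {z | z * (y * x⁻¹)⁻¹ ∈ D ∧ z ∈ D'}.ncard =
      {z | z * y⁻¹ ∈ D ∧ z * x⁻¹ ∈ D'}.ncard := by
    intro x y
    refine (Set.ncard_congr (fun z _ => z * x⁻¹) ?_ ?_ ?_).symm
    · rintro z ⟨h1, h2⟩
      exact ⟨by simpa [mul_assoc] using h1, h2⟩
    · intro a b _ _ hab
      exact mul_right_cancel hab
    · rintro z ⟨h1, h2⟩
      exact ⟨z * x, ⟨by simpa [mul_assoc] using h1, by simpa using h2⟩, by simp⟩
  intro x y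
  simp only [Set.mem_ofPred_eq]
  rw [key, key]
  have : {z | z * (φ y)⁻¹ ∈ D ∧ z * (φ x)⁻¹ ∈ D'} = φ '' {z | z * y⁻¹ ∈ D ∧ z * x⁻¹ ∈ D'} := by
    ext z
    constructor
    · rintro ⟨h1, h2⟩
      refine ⟨φ.symm z, ⟨(h _ _).2 ?_, (h' _ _).2 ?_⟩, by simp⟩ <;> simpa
    · rintro ⟨z, ⟨h1, h2⟩, rfl⟩
      exact ⟨(h _ _).1 h1, (h' _ _).1 h2⟩
  rw [this, Set.ncard_image_of_injective _ φ.injective]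

/-- The subgroup of all `g` whose left translation commutes with `φ`. -/
def caSubgroup (φ : Equiv.Perm G) : Subgroup G where
  carrier := {g | IsCayleyAut {g} φ}
  one_mem' := ca_one
  mul_mem' := by
    intro a b ha hb
    have := ca_mul ha hb
    rwa [Set.singleton_mul_singleton] at this
  inv_mem' := by
    intro a ha
    have := ca_inv ha
    rwa [Set.inv_singleton] at this

lemma mem_caSubgroup {g : G} : g ∈ caSubgroup φ ↔ IsCayleyAut {g} φ := Iff.rfl

lemma right_translation (h : caSubgroup φ = ⊤) : ∃ g : G, ∀ v : G, φ v = v * g := by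
  refine ⟨φ 1, fun v => ?_⟩
  have hv : v ∈ caSubgroup φ := h ▸ Subgroup.mem_top v
  have := (mem_caSubgroup.1 hv 1 v).1 (by simp)
  rw [Set.mem_singleton_iff] at this
  exact mul_inv_eq_iff_eq_mul.1 this

/-- The set `j(X) g`. -/
def cs {E : Type*} (j : E → G) (X : Set E) (g : G) : Set G := {h | ∃ t ∈ X, h = j t * g}

section cs

variable {m : ℕ} {j : (Fin m → ZMod 2) → G}

lemma j_zero (hj : ∀ a b, j (a + b) = j a * j b)
    : j 0 = 1 := by
  have := hj 0 0
  simpa using this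

lemma j_inv (hj : ∀ a b, j (a + b) = j a * j b)
    (t) : (j t)⁻¹ = j t := by
  rw [inv_eq_iff_mul_eq_one, ← hj, add_self2, j_zero hj]

lemma cs_mul (hj : ∀ a b, j (a + b) = j a * j b)
    (X Y : Set (Fin m → ZMod 2)) (g : G) : cs j X 1 * cs j Y g = cs j (dif X Y) g := by
  ext h
  rw [Set.mem_mul]
  constructor
  · rintro ⟨_, ⟨a, ha, rfl⟩, _, ⟨b, hb, rfl⟩, rfl⟩
    exact ⟨a + b, ⟨a, ha, b, hb, rfl⟩, by rw [hj]; group⟩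
  · rintro ⟨_, ⟨a, ha, b, hb, rfl⟩, rfl⟩
    exact ⟨_, ⟨a, ha, rfl⟩, _, ⟨b, hb, rfl⟩, by rw [hj]; group⟩

lemma cs_mul_inv (hj : ∀ a b, j (a + b) = j a * j b)
    (X Y : Set (Fin m → ZMod 2)) (g : G) :
    cs j X g * (cs j Y g)⁻¹ = cs j (dif X Y) 1 := by
  ext h
  rw [Set.mem_mul]
  constructor
  · rintro ⟨_, ⟨a, ha, rfl⟩, k, ⟨b, hb, hk⟩, rfl⟩
    refine ⟨a + b, ⟨a, ha, b, hb, rfl⟩, ?_⟩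
    rw [inv_eq_iff_eq_inv] at hk
    rw [hk, hj, mul_inv_rev, j_inv hj]; group
  · rintro ⟨_, ⟨a, ha, b, hb, rfl⟩, rfl⟩
    refine ⟨_, ⟨a, ha, rfl⟩, (j b * g)⁻¹, ⟨b, hb, by simp⟩, ?_⟩
    rw [hj, mul_inv_rev, j_inv hj]; group

lemma cs_mem (hj : ∀ a b, j (a + b) = j a * j b)
    (hinj : Function.Injective j)
    {X : Set (Fin m → ZMod 2)} {g : G} {t} : j t * g ∈ cs j X g ↔ t ∈ X := by
  constructor
  · rintro ⟨s, hs, h⟩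
    rwa [hinj (mul_right_cancel h)]
  · exact fun h => ⟨t, h, rfl⟩

lemma cs_diff (hj : ∀ a b, j (a + b) = j a * j b)
    (hinj : Function.Injective j)
    (X Y : Set (Fin m → ZMod 2)) (g : G) : cs j X g \ cs j Y g = cs j (X \ Y) g := by
  ext h
  constructor
  · rintro ⟨⟨t, ht, rfl⟩, h2⟩
    rw [cs_mem hj hinj] at h2
    exact ⟨t, ⟨ht, h2⟩, rfl⟩
  · rintro ⟨t, ⟨h1, h2⟩, rfl⟩
    exact ⟨⟨t, h1, rfl⟩, by rwa [cs_mem hj hinj]⟩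

lemma cs_inter (hj : ∀ a b, j (a + b) = j a * j b)
    (hinj : Function.Injective j)
    (X Y : Set (Fin m → ZMod 2)) (g : G) : cs j X g ∩ cs j Y g = cs j (X ∩ Y) g := by
  ext h
  constructor
  · rintro ⟨⟨t, ht, rfl⟩, h2⟩
    rw [cs_mem hj hinj] at h2
    exact ⟨t, ⟨ht, h2⟩, rfl⟩
  · rintro ⟨t, ⟨h1, h2⟩, rfl⟩
    exact ⟨⟨t, h1, rfl⟩, by rwa [cs_mem hj hinj]⟩

/-- Reconstruction: from the three coset parts, everything is rigid. -/
lemma reconstruct (hj : ∀ a b, j (a + b) = j a * j b)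
    (hinj : Function.Injective j)
    (hm : 4 ≤ m) (a : Fin 3 → G)
    (hW : IsCayleyAut (cs j Set.univ 1) φ)
    (hX : ∀ i, IsCayleyAut (cs j (XX m i)ᶜ (a i)) φ)
    (hgen : Subgroup.closure (Set.range j ∪ Set.range a) = ⊤) :
    caSubgroup φ = ⊤ := by
  have single : ∀ {t : Fin m → ZMod 2} {g : G}, cs j {t} g = {j t * g} := by
    intro t g; ext h; simp [cs]
  have hU : ∀ i, IsCayleyAut (cs j Set.univ (a i)) φ := by
    intro i
    have := ca_mul hW (hX i)
    rw [cs_mul hj] at this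
    convert this
    refine (Set.eq_univ_of_forall fun t => ?_).symm
    obtain ⟨s, hs⟩ := compl_XX hm i
    exact ⟨t + s, trivial, s, hs, by rw [add_assoc, add_self2, add_zero]⟩
  have hX' : ∀ i, IsCayleyAut (cs j (XX m i) (a i)) φ := by
    intro i
    have := ca_diff (hU i) (hX i)
    rw [cs_diff hj hinj] at this
    convert this
    ext t; simp
  have hP : IsCayleyAut (cs j (XP m) (a 0)) φ := hX' 0
  have hQ : IsCayleyAut (cs j (XQ m) (a 1)) φ := hX' 1
  have hR : IsCayleyAut (cs j (XR m) (a 2)) φ := hX' 2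
  have hDP : IsCayleyAut (cs j (dif (XP m) (XP m)) 1) φ := by
    have := ca_mul hP (ca_inv hP)
    rwa [cs_mul_inv hj] at this
  have hDR : IsCayleyAut (cs j (dif (XR m) (XR m)) 1) φ := by
    have := ca_mul hR (ca_inv hR)
    rwa [cs_mul_inv hj] at this
  -- base point of the second coset
  have hβ : IsCayleyAut (cs j {0} (a 1)) φ := by
    have h1 := ca_diff hW hDP
    rw [cs_diff hj hinj] at h1
    have h2 := ca_mul h1 hQ
    rw [cs_mul hj] at h2
    have h3 := ca_diff hQ h2
    rw [cs_diff hj hinj] at h3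
    convert h3
    ext t
    rw [Set.mem_singleton_iff, ← base_XQ hm]
    refine and_congr Iff.rfl ?_
    constructor
    · rintro h ⟨u, ⟨-, hu⟩, s, hs, rfl⟩
      have := h s hs
      rw [add_assoc, add_self2, add_zero] at this
      exact hu this
    · intro h s hs
      by_contra hn
      exact h ⟨t + s, ⟨trivial, hn⟩, s, hs, by rw [add_assoc, add_self2, add_zero]⟩
  have hQ1 : IsCayleyAut (cs j (XQ m) 1) φ := by
    have := ca_mul hQ (ca_inv hβ)
    rw [cs_mul_inv hj] at this
    convert this
    ext t; simp [dif]
  have h0 : IsCayleyAut (cs j {0} 1) φ := by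
    rw [single, j_zero hj, one_mul]; exact ca_one
  have hf : ∀ i, i < m → ∀ k ≤ i, IsCayleyAut (cs j {fE m k} 1) φ := by
    intro i
    induction i with
    | zero =>
      intro _ k hk
      obtain rfl : k = 0 := by omega
      have h1 := ca_inter hDR (ca_diff hQ1 h0)
      rw [cs_diff hj hinj, cs_inter hj hinj] at h1
      convert h1
      ext t
      rw [Set.mem_singleton_iff, ← DR_inter hm]
      rfl
    | succ i ih =>
      intro hi k hk
      have ih := ih (by omega)
      rcases Nat.lt_or_ge i k with hlt | hge
      swap
      · exact ih k hge
      obtain rfl : k = i + 1 := by omega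
      have h1 := ca_mul (ih i le_rfl) hDP
      rw [cs_mul hj] at h1
      have h2 : IsCayleyAut (cs j {s | ∃ k ≤ i, s = fE m k} 1) φ := by
        have := ca_exists (ι := {k // k ≤ i}) (fun k => ih k.1 k.2)
        convert this using 1
        ext g
        constructor
        · rintro ⟨_, ⟨k, hk, rfl⟩, rfl⟩
          exact ⟨⟨k, hk⟩, _, rfl, rfl⟩
        · rintro ⟨⟨k, hk⟩, _, rfl, rfl⟩
          exact ⟨_, ⟨k, hk, rfl⟩, rfl⟩
      have h3 := ca_inter hQ1 (ca_inter h1 (ca_diff (ca_diff hW h0) h2))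
      rw [cs_diff hj hinj, cs_diff hj hinj, cs_inter hj hinj, cs_inter hj hinj] at h3
      convert h3
      ext t
      rw [Set.mem_singleton_iff, ← step_XQ hm hi]
      refine and_congr Iff.rfl (and_congr ?_ ?_)
      · constructor
        · intro h
          exact ⟨_, rfl, _, h, by rw [← add_assoc, add_self2, zero_add]⟩
        · rintro ⟨_, rfl, u, hu, rfl⟩
          rwa [← add_assoc, add_self2, zero_add]
      · simp
  have hall : ∀ t, IsCayleyAut (cs j {t} 1) φ := by
    intro t
    let H : AddSubgroup (Fin m → ZMod 2) :=
      { carrier := {t | j t ∈ caSubgroup φ}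
        zero_mem' := by
          change j 0 ∈ caSubgroup φ
          rw [j_zero hj]; exact one_mem _
        add_mem' := by
          intro a b ha hb
          change j (a + b) ∈ caSubgroup φ
          rw [hj]; exact mul_mem ha hb
        neg_mem' := by
          intro a ha
          have : -a = a := by
            rw [neg_eq_iff_add_eq_zero, add_self2]
          change j (-a) ∈ caSubgroup φ
          rw [this]; exact ha }
    have : t ∈ H := by
      refine gen_fE H (fun i hi => ?_) t
      have := hf i hi i le_rfl
      rw [single, mul_one] at this
      exact this
    rw [single, mul_one]
    exact this
  have hany : ∀ X : Set (Fin m → ZMod 2), IsCayleyAut (cs j X 1) φ := by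
    intro X
    have := ca_exists (ι := X) (fun k => hall k.1)
    convert this using 1
    ext g
    constructor
    · rintro ⟨t, ht, rfl⟩
      exact ⟨⟨t, ht⟩, _, rfl, rfl⟩
    · rintro ⟨⟨t, ht⟩, s, hs, rfl⟩
      rw [Set.mem_singleton_iff] at hs
      exact ⟨t, ht, by rw [hs]⟩
  have hbase : ∀ i, (∀ t, (t ∈ XX m i ∧ ∀ d ∈ XX m i, d + t ∈ XX m i) ↔ t = 0) →
      IsCayleyAut (cs j {0} (a i)) φ := by
    intro i hi
    have h1 := ca_mul (hany (XX m i)) (hX i)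
    rw [cs_mul hj] at h1
    have h2 := ca_diff (hX' i) h1
    rw [cs_diff hj hinj] at h2
    convert h2
    ext t
    rw [Set.mem_singleton_iff, ← hi]
    refine and_congr Iff.rfl ?_
    constructor
    · rintro h ⟨d, hd, s, hs, rfl⟩
      have := h d hd
      rw [← add_assoc, add_self2, zero_add] at this
      exact hs this
    · intro h d hd
      by_contra hn
      exact h ⟨d, hd, d + t, hn, by rw [← add_assoc, add_self2, zero_add]⟩
  rw [eq_top_iff, ← hgen, Subgroup.closure_le]
  rintro _ (⟨t, rfl⟩ | ⟨i, rfl⟩)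
  · have := hall t
    rw [single, mul_one] at this
    exact this
  · have : IsCayleyAut (cs j {0} (a i)) φ := by
      fin_cases i
      · exact hbase 0 (fun t => stab_XP hm)
      · exact hβ
      · exact hbase 2 (fun t => stab_XR hm)
    rw [single, j_zero hj, one_mul] at this
    exact this

/-- The key construction. -/
lemma key_construction (hj : ∀ a b, j (a + b) = j a * j b)
    (hinj : Function.Injective j)
    (hm : 4 ≤ m) (a : Fin 3 → G) (W : Subgroup G) (hWn : W.Normal)
    (hWj : ∀ g, g ∈ W ↔ ∃ t, j t = g)
    (h1 : ∀ i k, a i * a k ∉ W)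
    (h2 : ∀ i k, i ≠ k → a i * (a k)⁻¹ ∉ W)
    (h3 : ∀ i k i' k', i ≠ k → a i * (a k)⁻¹ * ((a i')⁻¹ * a k')⁻¹ ∉ W)
    (hgen : Subgroup.closure (Set.range j ∪ Set.range a) = ⊤) : HasORR G := by
  have hjW : ∀ t, j t ∈ W := fun t => (hWj _).2 ⟨t, rfl⟩
  have hcsW : cs j Set.univ 1 = (W : Set G) := by
    ext g
    simp [cs, hWj, eq_comm]
  have hq : ∀ g : G, g ∈ W ↔ (QuotientGroup.mk' W) g = 1 := fun g =>
    (QuotientGroup.eq_one_iff g).symm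
  have hqj : ∀ t, (QuotientGroup.mk' W) (j t) = 1 := fun t => (hq _).1 (hjW t)
  let S : Set G := {g | ∃ i, g ∈ cs j (XX m i)ᶜ (a i)}
  refine ⟨S, ?_, ?_⟩
  · rw [Set.eq_empty_iff_forall_notMem]
    rintro g ⟨⟨i, t, ht, rfl⟩, ⟨k, s, hs, h⟩⟩
    apply h1 k i
    rw [hq]
    have := congrArg (QuotientGroup.mk' W) h
    simp only [map_mul, map_inv, hqj, one_mul] at this ⊢
    rw [← this]; simp
  · intro φ hφ
    apply right_translation
    have hW : IsCayleyAut (cs j Set.univ 1) φ := by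
      have := ca_inter (ca_mul hφ (ca_inv hφ)) (ca_mul (ca_inv hφ) hφ)
      convert this
      rw [hcsW]
      ext g
      constructor
      · intro hg
        constructor
        · obtain ⟨d, rfl⟩ := (hWj g).1 hg
          obtain ⟨t, ht, hdt⟩ := XR_diff hm d
          refine Set.mem_mul.2 ⟨j (d + t) * a 2, ⟨2, _, hdt, rfl⟩, (j t * a 2)⁻¹,
            ⟨2, t, ht, by simp⟩, ?_⟩
          rw [hj]; group
        · have hg' : a 2 * g * (a 2)⁻¹ ∈ W := hWn.conj_mem g hg _
          obtain ⟨d, hd⟩ := (hWj _).1 hg'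
          obtain ⟨t, ht, hdt⟩ := XR_diff hm d
          refine Set.mem_mul.2 ⟨(j (d + t) * a 2)⁻¹, ⟨2, d + t, hdt, by simp⟩, j t * a 2,
            ⟨2, _, ht, rfl⟩, ?_⟩
          have e : j (d + t) * j t = a 2 * g * (a 2)⁻¹ := by
            rw [← hj, add_assoc, add_self2, add_zero, hd]
          rw [mul_inv_rev, j_inv hj, mul_assoc, ← mul_assoc (j (d + t)), e]
          group
      · rintro ⟨hA, hB⟩
        obtain ⟨_, ⟨i, t, ht, rfl⟩, u, ⟨k, s, hs, hu⟩, hg⟩ := Set.mem_mul.1 hA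
        obtain ⟨u', ⟨i', t', ht', hu'⟩, _, ⟨k', s', hs', rfl⟩, hg'⟩ := Set.mem_mul.1 hB
        rw [inv_eq_iff_eq_inv] at hu hu'
        have e1 : (QuotientGroup.mk' W) g =
            (QuotientGroup.mk' W) (a i) * ((QuotientGroup.mk' W) (a k))⁻¹ := by
          rw [← hg, hu]; simp only [map_mul, map_inv, hqj, one_mul]
        have e2 : (QuotientGroup.mk' W) g =
            ((QuotientGroup.mk' W) (a i'))⁻¹ * (QuotientGroup.mk' W) (a k') := by
          rw [← hg', hu']; simp only [map_mul, map_inv, hqj, one_mul]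
        by_cases hik : i = k
        · subst hik
          change g ∈ W
          rw [hq, e1, mul_inv_cancel]
        · exfalso
          apply h3 i k i' k' hik
          rw [hq]
          simp only [map_mul, map_inv]
          rw [← e1, ← e2, mul_inv_cancel]
    refine reconstruct hj hinj hm a hW (fun i => ?_) hgen
    have hcnt := ca_inter hφ (ca_count hW hφ (XX m i)ᶜ.ncard)
    have hval : ∀ k t, {z | z * (j t * a k)⁻¹ ∈ cs j Set.univ 1 ∧ z ∈ S}.ncard =
        (XX m k)ᶜ.ncard := by
      intro k t
      have : {z | z * (j t * a k)⁻¹ ∈ cs j Set.univ 1 ∧ z ∈ S} =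
          (fun s => j s * a k) '' (XX m k)ᶜ := by
        ext z
        rw [hcsW]
        constructor
        · rintro ⟨hz, ⟨l, s, hs, rfl⟩⟩
          have : l = k := by
            by_contra hne
            apply h2 l k hne
            have hz : _ ∈ W := hz
            rw [hq] at hz ⊢
            simpa only [map_mul, map_inv, hqj, one_mul, mul_inv_rev, inv_one, mul_one] using hz
          subst this
          exact ⟨s, hs, rfl⟩
        · rintro ⟨s, hs, rfl⟩
          refine ⟨?_, ⟨k, s, hs, rfl⟩⟩
          change _ ∈ W
          rw [hq]
          simp only [map_mul, map_inv, hqj, one_mul, mul_inv_cancel]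
      rw [this, Set.ncard_image_of_injective]
      intro s s' h
      exact hinj (mul_right_cancel h)
    convert hcnt using 1
    ext g
    constructor
    · rintro ⟨t, ht, rfl⟩
      exact ⟨⟨i, t, ht, rfl⟩, hval i t⟩
    · rintro ⟨⟨k, t, ht, rfl⟩, hc⟩
      have hc : _ = _ := hc
      rw [hval] at hc
      obtain rfl := card_XX hm _ _ hc
      exact ⟨t, ht, rfl⟩

end cs

end Definable

/-! ### Coordinates on `V` -/

lemma gen_single {ι : Type*} [Fintype ι] [DecidableEq ι] (H : AddSubgroup (ι → ZMod 2))
    (h : ∀ i, Pi.single i 1 ∈ H) (t : ι → ZMod 2) : t ∈ H := by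
  rw [← Finset.univ_sum_single t]
  refine sum_mem fun i _ => ?_
  have h2 : ∀ c : ZMod 2, c = 0 ∨ c = 1 := by decide
  rcases h2 (t i) with h0 | h1
  · rw [h0]; simp
  · rw [h1]; exact h i

lemma add_self2' {ι : Type*} (t : ι → ZMod 2) : t + t = 0 := by
  funext k; exact CharTwo.add_self_eq_zero _

lemma hom_ext2 {ι G : Type*} [Fintype ι] [DecidableEq ι] [Group G]
    (F F' : (ι → ZMod 2) → G) (hF : ∀ a b, F (a + b) = F a * F b)
    (hF' : ∀ a b, F' (a + b) = F' a * F' b) (h : ∀ i, F (Pi.single i 1) = F' (Pi.single i 1))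
    (t : ι → ZMod 2) : F t = F' t := by
  let H : AddSubgroup (ι → ZMod 2) :=
    { carrier := {t | F t = F' t}
      zero_mem' := by
        have h1 := hF 0 0
        have h2 := hF' 0 0
        simp only [add_zero, left_eq_mul] at h1 h2
        change F 0 = F' 0
        rw [h1, h2]
      add_mem' := by
        intro a b ha hb
        change F (a + b) = F' (a + b)
        rw [hF, hF', show F a = F' a from ha, show F b = F' b from hb]
      neg_mem' := by
        intro a ha
        have : -a = a := by rw [neg_eq_iff_add_eq_zero, add_self2']
        change F (-a) = F' (-a)
        rw [this]; exact ha }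
  exact gen_single H h t

lemma exists_coords {ι G : Type*} [Fintype ι] [DecidableEq ι] [Group G] (V : Subgroup G)
    (hVcomm : ∀ a ∈ V, ∀ b ∈ V, a * b = b * a) (hVexp : ∀ a ∈ V, a ^ 2 = 1) (b : ι → G)
    (hb : Subgroup.closure (Set.range b) = V) (hcard : Nat.card V = 2 ^ Fintype.card ι) :
    ∃ J : (ι → ZMod 2) → G, (∀ s t, J (s + t) = J s * J t) ∧ Function.Injective J ∧
      (∀ t, J t ∈ V) ∧ ∀ i, J (Pi.single i 1) = b i := by
  letI : CommGroup V := { (inferInstance : Group V) with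
    mul_comm := fun x y => Subtype.ext (hVcomm x x.2 y y.2) }
  have h2 : ∀ x : Additive V, 2 • x = 0 := by
    intro x
    have : (x.toMul) ^ 2 = 1 := Subtype.ext (hVexp _ x.toMul.2)
    exact this
  letI : Module (ZMod 2) (Additive V) := AddCommGroup.zmodModule h2
  have hbV : ∀ i, b i ∈ V := fun i => hb ▸ Subgroup.subset_closure ⟨i, rfl⟩
  let L := Fintype.linearCombination (ZMod 2) (fun i => Additive.ofMul (⟨b i, hbV i⟩ : V))
  let F : (ι → ZMod 2) → V := fun t => (L t).toMul
  have hF : ∀ s t, F (s + t) = F s * F t := fun s t => by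
    simp only [F, map_add, toMul_add]
  have hFs : ∀ i, F (Pi.single i 1) = ⟨b i, hbV i⟩ := by
    intro i
    simp [F, L, Fintype.linearCombination_apply_single]
  have hF0 : F 0 = 1 := by simp [F]
  have hsurj : Function.Surjective F := by
    let K : Subgroup G :=
      { carrier := {g | ∃ t, (F t : G) = g}
        one_mem' := ⟨0, by rw [hF0]; rfl⟩
        mul_mem' := by
          rintro _ _ ⟨s, rfl⟩ ⟨t, rfl⟩
          exact ⟨s + t, by rw [hF]; rfl⟩
        inv_mem' := by
          rintro _ ⟨s, rfl⟩
          refine ⟨s, ?_⟩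
          rw [eq_inv_iff_mul_eq_one, ← Subgroup.coe_mul, ← hF, add_self2', hF0]; rfl }
    have hK : V ≤ K := by
      rw [← hb, Subgroup.closure_le]
      rintro _ ⟨i, rfl⟩
      exact ⟨Pi.single i 1, by rw [hFs]⟩
    intro g
    obtain ⟨t, ht⟩ := hK g.2
    exact ⟨t, Subtype.ext ht⟩
  haveI : Finite V := Nat.finite_of_card_ne_zero (by rw [hcard]; positivity)
  have hbij : Function.Bijective F := by
    rw [Nat.bijective_iff_surjective_and_card]
    refine ⟨hsurj, ?_⟩
    rw [hcard, Nat.card_eq_fintype_card]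
    simp
  refine ⟨fun t => F t, fun s t => congrArg Subtype.val (hF s t), ?_, fun t => (F t).2, fun i => congrArg Subtype.val (hFs i)⟩
  intro s t h
  exact hbij.1 (Subtype.ext h)

def c3 : Fin 3 → ZMod 2 := ![1, 0, 1]
def d3 : Fin 3 → ZMod 2 := ![0, 1, 1]

lemma cd3_ne : ∀ i, c3 i ≠ 0 ∨ d3 i ≠ 0 := by decide
lemma cd3_ne' : ∀ i k, i ≠ k → c3 i + c3 k ≠ 0 ∨ d3 i + d3 k ≠ 0 := by decide

theorem semidirect_aux {G ι : Type*} [Group G] [Fintype ι] [DecidableEq ι]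
    (V : Subgroup G) (b : ι → G) (J : (ι → ZMod 2) → G)
    (hVcomm : ∀ a ∈ V, ∀ b ∈ V, a * b = b * a)
    (hJ : ∀ s t, J (s + t) = J s * J t) (hinj : Function.Injective J)
    (hJV : ∀ t, J t ∈ V) (hJb : ∀ i, J (Pi.single i 1) = b i)
    (hb : Subgroup.closure (Set.range b) = V)
    (x : G) (hx2 : x * x = 1) (hgen : Subgroup.closure ((V : Set G) ∪ {x}) = ⊤)
    (sw : ι → ι) (hsw : ∀ i, sw (sw i) = i) (hx : ∀ i, x⁻¹ * b i * x = b (sw i))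
    (p0 p1 : ι) (h01 : p0 ≠ p1) (hp0 : sw p0 ≠ p0) (hp1 : sw p1 ≠ p1) (hp01 : sw p0 ≠ p1)
    (hcard : 8 ≤ Fintype.card ι) : HasORR G := by
  have hxi : x⁻¹ = x := inv_eq_of_mul_eq_one_left hx2
  have hp10 : sw p1 ≠ p0 := fun h => hp01 (by rw [← h, hsw])
  have hswinj : Function.Injective sw := fun i k h => by rw [← hsw i, h, hsw]
  have hJ0 : J 0 = 1 := by simpa using hJ 0 0
  have hJi : ∀ t, (J t)⁻¹ = J t := fun t => by
    rw [inv_eq_iff_mul_eq_one, ← hJ, add_self2', hJ0]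
  have hxJ : ∀ t, x * J t * x = J (fun i => t (sw i)) := by
    intro t
    refine hom_ext2 (fun t => x * J t * x) (fun t => J (fun i => t (sw i))) ?_ ?_ ?_ t
    · intro s t
      simp only [hJ]
      calc x * (J s * J t) * x = x * J s * 1 * J t * x := by group
        _ = _ := by rw [← hx2]; group
    · intro s t
      simp only [← hJ]; rfl
    · intro i
      rw [hJb]
      have := hx i
      rw [hxi] at this
      rw [this, ← hJb]
      congr 1
      funext k
      simp only [Pi.single_apply]
      congr 1
      rw [eq_iff_iff]
      constructor
      · rintro rfl; rw [hsw]
      · rintro rfl; rw [hsw]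
  let Bad : Finset ι := {p0, p1, sw p0, sw p1}
  have hBadsw : ∀ i ∈ Bad, sw i ∈ Bad := by
    intro i hi
    simp only [Bad, Finset.mem_insert, Finset.mem_singleton] at hi ⊢
    rcases hi with rfl | rfl | rfl | rfl <;> simp [hsw]
  let W : Subgroup G :=
    { carrier := {g | ∃ T : ι → ZMod 2, (∀ i ∈ Bad, T i = 0) ∧ J T = g}
      one_mem' := ⟨0, fun _ _ => rfl, hJ0⟩
      mul_mem' := by
        rintro _ _ ⟨s, hs, rfl⟩ ⟨t, ht, rfl⟩
        exact ⟨s + t, fun i hi => by simp [hs i hi, ht i hi], hJ _ _⟩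
      inv_mem' := by
        rintro _ ⟨s, hs, rfl⟩
        exact ⟨s, hs, (hJi s).symm⟩ }
  have hWmem : ∀ T, J T ∈ W ↔ ∀ i ∈ Bad, T i = 0 := by
    intro T
    constructor
    · rintro ⟨T', h, hT⟩
      rwa [← hinj hT]
    · exact fun h => ⟨T, h, rfl⟩
  have hWn : W.Normal := by
    rw [← Subgroup.normalizer_eq_top_iff, eq_top_iff, ← hgen, Subgroup.closure_le]
    rintro g (hg | rfl)
    · rw [SetLike.mem_coe, Subgroup.mem_normalizer_iff]
      have hWV : ∀ h ∈ W, h ∈ V := by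
        rintro _ ⟨T, -, rfl⟩; exact hJV T
      intro h
      constructor
      · intro hh
        rwa [hVcomm g hg h (hWV h hh), mul_inv_cancel_right]
      · intro hh
        have e : h = g⁻¹ * (g * h * g⁻¹) * g := by group
        rw [e, hVcomm g⁻¹ (inv_mem hg) _ (hWV _ hh), inv_mul_cancel_right]
        exact hh
    · rw [SetLike.mem_coe, Subgroup.mem_normalizer_iff]
      have key : ∀ h ∈ W, g * h * g ∈ W := by
        rintro _ ⟨T, hT, rfl⟩
        rw [hxJ, hWmem]
        exact fun i hi => hT _ (hBadsw i hi)
      intro h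
      rw [hxi]
      refine ⟨key h, fun hh => ?_⟩
      have := key _ hh
      have e : g * (g * h * g) * g = (g * g) * h * (g * g) := by group
      rwa [e, hx2, one_mul, mul_one] at this
  -- coordinates on `W`
  let m := Fintype.card {i // i ∉ Bad}
  have hm : 4 ≤ m := by
    have h1 : m = Fintype.card ι - Bad.card := by
      simp only [m]
      rw [Fintype.card_subtype_compl]; simp
    have h2 : Bad.card ≤ 4 := Finset.card_le_four
    omega
  let eqv : {i // i ∉ Bad} ≃ Fin m := Fintype.equivFin _
  let ext : (Fin m → ZMod 2) → (ι → ZMod 2) := fun t i => if h : i ∉ Bad then t (eqv ⟨i, h⟩) else 0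
  have hext_add : ∀ s t, ext (s + t) = ext s + ext t := by
    intro s t
    funext i
    by_cases h : i ∈ Bad <;> simp [ext, h]
  have hext_inj : Function.Injective ext := by
    intro s t h
    funext k
    have := congrFun h (eqv.symm k).1
    simpa [ext, (eqv.symm k).2] using this
  have hext_surj : ∀ T : ι → ZMod 2, (∀ i ∈ Bad, T i = 0) → ∃ t, ext t = T := by
    intro T hT
    refine ⟨fun k => T (eqv.symm k).1, ?_⟩
    funext i
    by_cases h : i ∈ Bad
    · simp [ext, h, hT i h]
    · simp [ext, h]
  have hext_bad : ∀ t, ∀ i ∈ Bad, ext t i = 0 := by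
    intro t i hi
    simp [ext, hi]
  let P : Fin 3 → ι → ZMod 2 := fun i s => if s = p0 then c3 i else if s = p1 then d3 i else 0
  have hP0 : ∀ i, P i p0 = c3 i := fun i => by simp [P]
  have hP1 : ∀ i, P i p1 = d3 i := fun i => by simp [P, h01.symm]
  have hP2 : ∀ i, P i (sw p0) = 0 := fun i => by simp [P, hp0, hp01]
  have hP3 : ∀ i, P i (sw p1) = 0 := fun i => by simp [P, hp1, hp10]
  have hB0 : p0 ∈ Bad := by simp [Bad]
  have hB1 : p1 ∈ Bad := by simp [Bad]
  let a : Fin 3 → G := fun i => J (P i) * x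
  have haa : ∀ i k, a i * a k = J (P i + fun s => P k (sw s)) := by
    intro i k
    rw [hJ, ← hxJ]
    simp only [a]; group
  have hai : ∀ i k, a i * (a k)⁻¹ = J (P i + P k) := by
    intro i k
    rw [hJ, ← hJi (P k)]
    simp only [a]; group
  have hia : ∀ i k, ((a i)⁻¹ * a k)⁻¹ = J (fun s => (P k + P i) (sw s)) := by
    intro i k
    rw [← hxJ, hJ]
    simp only [a]
    rw [mul_inv_rev, inv_inv, mul_inv_rev, hJi, hxi]
    group
  refine key_construction (j := fun t => J (ext t)) (fun s t => by rw [hext_add, hJ])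
    (hinj.comp hext_inj) hm a W hWn ?_ ?_ ?_ ?_ ?_
  · intro g
    constructor
    · rintro ⟨T, hT, rfl⟩
      obtain ⟨t, rfl⟩ := hext_surj T hT
      exact ⟨t, rfl⟩
    · rintro ⟨t, rfl⟩
      exact (hWmem _).2 (hext_bad t)
  · intro i k h
    rw [haa, hWmem] at h
    have h0 := h p0 hB0
    have h1 := h p1 hB1
    simp only [Pi.add_apply, hP0, hP1, hP2, hP3, add_zero] at h0 h1
    rcases cd3_ne i with h | h
    · exact h h0
    · exact h h1
  · intro i k hik h
    rw [hai, hWmem] at h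
    have h0 := h p0 hB0
    have h1 := h p1 hB1
    simp only [Pi.add_apply, hP0, hP1] at h0 h1
    rcases cd3_ne' i k hik with h | h
    · exact h h0
    · exact h h1
  · intro i k i' k' hik h
    rw [hai, hia, ← hJ, hWmem] at h
    have h0 := h p0 hB0
    have h1 := h p1 hB1
    simp only [Pi.add_apply, hP0, hP1, hP2, hP3, add_zero] at h0 h1
    rcases cd3_ne' i k hik with h | h
    · exact h h0
    · exact h h1
  · set N := Subgroup.closure (Set.range (fun t => J (ext t)) ∪ Set.range a) with hN
    have haN : ∀ i, a i ∈ N := fun i => Subgroup.subset_closure (Or.inr ⟨i, rfl⟩)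
    have hWN : ∀ T : ι → ZMod 2, (∀ i ∈ Bad, T i = 0) → J T ∈ N := by
      intro T hT
      obtain ⟨t, rfl⟩ := hext_surj T hT
      exact Subgroup.subset_closure (Or.inl ⟨t, rfl⟩)
    have hb0 : b p0 ∈ N := by
      have := mul_mem (haN 2) (inv_mem (haN 1))
      rw [hai] at this
      convert this
      rw [← hJb]
      congr 1
      funext s
      by_cases h0 : s = p0
      · subst h0; simp [P, c3]
      · by_cases h1 : s = p1
        · subst h1; simp [P, d3, h0]; decide
        · simp [P, h0, h1]
    have hb1 : b p1 ∈ N := by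
      have := mul_mem (haN 2) (inv_mem (haN 0))
      rw [hai] at this
      convert this
      rw [← hJb]
      congr 1
      funext s
      by_cases h0 : s = p0
      · subst h0; simp [P, c3, h01]; decide
      · by_cases h1 : s = p1
        · subst h1; simp [P, d3, h0]
        · simp [P, h0, h1]
    have hxN : x ∈ N := by
      have := mul_mem (inv_mem hb0) (haN 0)
      convert this
      have : P 0 = Pi.single p0 1 := by
        funext s
        by_cases h0 : s = p0
        · subst h0; simp [P, c3]
        · simp [P, h0, d3]
      simp only [a]
      rw [this, hJb]; group
    have hbN : ∀ i, b i ∈ N := by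
      intro i
      by_cases hi : i ∈ Bad
      · simp only [Bad, Finset.mem_insert, Finset.mem_singleton] at hi
        rcases hi with rfl | rfl | rfl | rfl
        · exact hb0
        · exact hb1
        · rw [← hx]; exact mul_mem (mul_mem (inv_mem hxN) hb0) hxN
        · rw [← hx]; exact mul_mem (mul_mem (inv_mem hxN) hb1) hxN
      · rw [← hJb]
        refine hWN _ fun k hk => ?_
        rw [Pi.single_apply, if_neg]
        rintro rfl; exact hi hk
    rw [eq_top_iff, ← hgen, Subgroup.closure_le]
    rintro g (hg | rfl)
    · have : V ≤ N := by
        rw [← hb, Subgroup.closure_le]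
        rintro _ ⟨i, rfl⟩
        exact hbN i
      exact this hg
    · exact hxN


/-- Let `G = V ⋊ ⟨x⟩` where `V` is an elementary abelian 2-group of rank `2ℓ+κ` with
generating set `v 0, w 0, …, v (ℓ-1), w (ℓ-1), e 0, …, e (κ-1)`, `x² = 1`, `x` swaps
`v i` and `w i` by conjugation and fixes each `e i`. If `ℓ ≥ 2` and `2ℓ+κ ≥ 8`, then
`G` admits an oriented regular representation. -/
theorem semidirect_hasORR {G : Type*} [Group G] [Finite G]
    (ℓ κ : ℕ) (V : Subgroup G) (hV : V.Normal)
    (v w : Fin ℓ → G) (e : Fin κ → G)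
    (hVgen : Subgroup.closure (Set.range v ∪ Set.range w ∪ Set.range e) = V)
    (hVcomm : ∀ a ∈ V, ∀ b ∈ V, a * b = b * a)
    (hVexp : ∀ a ∈ V, a ^ 2 = 1)
    (hVcard : Nat.card V = 2 ^ (2 * ℓ + κ))
    (x : G) (hxV : x ∉ V) (hx2 : x * x = 1)
    (hgen : Subgroup.closure ((V : Set G) ∪ {x}) = ⊤)
    (hxv : ∀ i, x⁻¹ * v i * x = w i)
    (hxw : ∀ i, x⁻¹ * w i * x = v i)
    (hxe : ∀ i, x⁻¹ * e i * x = e i)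
    (hℓ : 2 ≤ ℓ) (hrank : 8 ≤ 2 * ℓ + κ) :
    HasORR G := by

  have hrange : Set.range (Sum.elim (Sum.elim v w) e) = Set.range v ∪ Set.range w ∪ Set.range e := by
    rw [Set.Sum.elim_range, Set.Sum.elim_range]
  have hcard : Fintype.card ((Fin ℓ ⊕ Fin ℓ) ⊕ Fin κ) = 2 * ℓ + κ := by
    simp; omega
  obtain ⟨J, hJ, hinj, hJV, hJb⟩ := exists_coords V hVcomm hVexp (Sum.elim (Sum.elim v w) e)
    (by rw [hrange, hVgen]) (by rw [hcard, hVcard])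
  refine semidirect_aux V (Sum.elim (Sum.elim v w) e) J hVcomm hJ hinj hJV hJb
    (by rw [hrange, hVgen]) x hx2 hgen (Sum.map Sum.swap id) ?_ ?_
    (Sum.inl (Sum.inl ⟨0, by omega⟩)) (Sum.inl (Sum.inl ⟨1, by omega⟩)) ?_ ?_ ?_ ?_ (by omega)
  · rintro ((i | i) | i) <;> rfl
  · rintro ((i | i) | i)
    · exact hxv i
    · exact hxw i
    · exact hxe i
  all_goals simp
end

section
/- Let ℓ and κ be non-negative integers with κ ≥ 1, let V be an elementary abelian 2-group of rank 2ℓ+κ with generating set {v_1,w_1,…,v_ℓ,w_ℓ,e_1,…,e_κ}, and let G = ⟨V, x⟩ where x^2 = e_1, v_i^x = w_i and w_i^x = v_i for every i ∈ {1,…,ℓ}, and e_i^x = e_i for every i ∈ {1,…,κ}. If 2ℓ+κ ≥ 7, then G admits an oriented regular representation. -/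
/-- Rigidity of the bipartite Cayley graph of `A` with respect to `X`. -/
def BipRigid {A : Type*} [AddCommGroup A] (X : Finset A) : Prop :=
  ∀ f g : A → A, Function.Injective f → Function.Injective g →
    (∀ u y, y - u ∈ X ↔ g y - f u ∈ X) → f 0 = 0 → (∀ a, f a = a) ∧ ∀ a, g a = a

/-- `A` has a rigid subset which is neither too small nor too large. -/
def HasRigid (A : Type*) [AddCommGroup A] : Prop :=
  ∃ X : Finset A, 3 ≤ X.card ∧ 2 * X.card + 3 ≤ Nat.card A ∧ BipRigid X

lemma BipRigid.translate {A : Type*} [AddCommGroup A] {X : Finset A} (h : BipRigid X)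
    (f g : A → A) (hf : Function.Injective f) (hg : Function.Injective g)
    (hfg : ∀ u y, y - u ∈ X ↔ g y - f u ∈ X) :
    (∀ a, f a = a + f 0) ∧ ∀ a, g a = a + f 0 := by
  have := h (fun a => f a - f 0) (fun a => g a - f 0)
    (fun a b hab => hf (by simpa using hab)) (fun a b hab => hg (by simpa using hab))
    (fun u y => by rw [hfg]; simp) (by simp)
  exact ⟨fun a => by rw [← sub_eq_iff_eq_add]; exact this.1 a,
    fun a => by rw [← sub_eq_iff_eq_add]; exact this.2 a⟩

/-- Number of common neighbours. -/
def cn {A : Type*} [AddCommGroup A] [Fintype A] [DecidableEq A] (X : Finset A) (u w : A) : ℕ :=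
  (Finset.univ.filter (fun y => y - u ∈ X ∧ y - w ∈ X)).card

lemma cn_pres {A : Type*} [AddCommGroup A] [Fintype A] [DecidableEq A] (X : Finset A)
    (f g : A → A) (hg : Function.Injective g)
    (hfg : ∀ u y, y - u ∈ X ↔ g y - f u ∈ X) (u w : A) :
    cn X (f u) (f w) = cn X u w := by
  unfold cn
  symm
  apply Finset.card_bij (fun y _ => g y)
  · intro y hy
    simp only [Finset.mem_filter, Finset.mem_univ, true_and] at hy ⊢
    rwa [← hfg, ← hfg]
  · intro a _ b _ hab
    exact hg hab
  · intro b hb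
    obtain ⟨a, rfl⟩ := (Finite.injective_iff_surjective.1 hg) b
    simp only [Finset.mem_filter, Finset.mem_univ, true_and] at hb
    rw [← hfg, ← hfg] at hb
    exact ⟨a, by simpa using hb, rfl⟩

lemma HasRigid.equiv {A A' : Type*} [AddCommGroup A] [AddCommGroup A'] (h : HasRigid A)
    (e : A ≃+ A') : HasRigid A' := by
  obtain ⟨X, h1, h2, h3⟩ := h
  refine ⟨X.map e.toEquiv.toEmbedding, by simpa, by
    simpa [← Nat.card_congr e.toEquiv] using h2, ?_⟩
  intro f g hf hg hfg h0
  have key : ∀ z, z ∈ X.map e.toEquiv.toEmbedding ↔ e.symm z ∈ X := by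
    intro z
    constructor
    · intro hz
      obtain ⟨a, ha, rfl⟩ := Finset.mem_map.1 hz
      simpa using ha
    · intro hz
      exact Finset.mem_map.2 ⟨_, hz, by simp⟩
  have := h3 (fun a => e.symm (f (e a))) (fun a => e.symm (g (e a)))
    (e.symm.injective.comp (hf.comp e.injective)) (e.symm.injective.comp (hg.comp e.injective))
    (fun u y => by
      have := hfg (e u) (e y)
      rw [key, key] at this
      simpa using this) (by simp [h0])
  constructor
  · intro a
    have := congrArg e (this.1 (e.symm a))
    simpa using this
  · intro a
    have := congrArg e (this.2 (e.symm a))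
    simpa using this

/-- The elementary abelian group of order 64, as bit strings. -/
def ESix : Type := Fin 64

instance : Fintype ESix := inferInstanceAs (Fintype (Fin 64))
instance : DecidableEq ESix := inferInstanceAs (DecidableEq (Fin 64))

/-- The underlying number. -/
def ESix.toNat (a : ESix) : ℕ := Fin.val (n := 64) a

lemma ESix.toNat_lt (a : ESix) : a.toNat < 64 := Fin.isLt (n := 64) a

/-- Constructor. -/
def ESix.mk (a : ℕ) (h : a < 64) : ESix := (⟨a, h⟩ : Fin 64)

lemma ESix.toNat_inj {a b : ESix} (h : a.toNat = b.toNat) : a = b := Fin.ext (n := 64) h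

instance : Zero ESix := ⟨ESix.mk 0 (by norm_num)⟩
instance : Add ESix :=
  ⟨fun a b => ESix.mk (a.toNat ^^^ b.toNat)
    (Nat.xor_lt_two_pow (n := 6) a.toNat_lt b.toNat_lt)⟩
instance : Neg ESix := ⟨fun a => a⟩

lemma ESix.toNat_add (a b : ESix) : (a + b).toNat = a.toNat ^^^ b.toNat := rfl
lemma ESix.toNat_zero : (0 : ESix).toNat = 0 := rfl
lemma ESix.toNat_mk (a : ℕ) (h : a < 64) : (ESix.mk a h).toNat = a := rfl

instance : AddCommGroup ESix where
  add_assoc a b c := ESix.toNat_inj (by simp only [ESix.toNat_add, Nat.xor_assoc])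
  zero_add a := ESix.toNat_inj (by simp only [ESix.toNat_add, ESix.toNat_zero, Nat.zero_xor])
  add_zero a := ESix.toNat_inj (by simp only [ESix.toNat_add, ESix.toNat_zero, Nat.xor_zero])
  add_comm a b := ESix.toNat_inj (by simp only [ESix.toNat_add, Nat.xor_comm])
  neg_add_cancel a := ESix.toNat_inj (by
    change a.toNat ^^^ a.toNat = 0
    simp)
  nsmul := nsmulRec
  zsmul := zsmulRec

lemma ESix.toNat_sub (a b : ESix) : (a - b).toNat = a.toNat ^^^ b.toNat := rfl

/-- bit mask of the base set -/
def mask : ℕ := 9965639048965985670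

/-- autocorrelation of the base set -/
def tab (d : ℕ) : ℕ :=
  (527023917155550964011816549231843802303136953612628222987726390686271739191085587120129188588200764698284056894556004480509329545134557279552665962809884 >>> (8 * d)) % 256

/-- counting -/
def cnt (d : ℕ) : ℕ → ℕ
  | 0 => 0
  | k + 1 => cnt d k + (if mask.testBit k && mask.testBit (k ^^^ d) then 1 else 0)

set_option maxRecDepth 100000 in
lemma cnt_tab : ∀ d < 64, cnt d 64 = tab d := by decide +kernel

/-- The base set. -/
def XSix : Finset ESix := Finset.univ.filter (fun a => mask.testBit a.toNat = true)

lemma mem_XSix (a : ESix) : a ∈ XSix ↔ mask.testBit a.toNat = true := by simp [XSix]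

lemma cnt_eq (d k : ℕ) : cnt d k =
    ((Finset.range k).filter (fun y => mask.testBit y && mask.testBit (y ^^^ d))).card := by
  induction k with
  | zero => rfl
  | succ k ih =>
    rw [cnt, ih, Finset.range_add_one, Finset.filter_insert]
    split_ifs with h <;> simp

lemma cn_XSix (u w : ESix) : cn XSix u w = tab (u - w).toNat := by
  rw [← cnt_tab _ (ESix.toNat_lt _), cnt_eq]
  unfold cn
  apply Finset.card_bij (fun y _ => (y - u).toNat)
  · intro y hy
    simp only [Finset.mem_filter, Finset.mem_univ, true_and, mem_XSix] at hy
    simp only [Finset.mem_filter, Finset.mem_range, ESix.toNat_lt, true_and, Bool.and_eq_true]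
    refine ⟨hy.1, ?_⟩
    rw [← ESix.toNat_add, sub_add_sub_cancel]
    exact hy.2
  · intro a _ b _ hab
    simpa using ESix.toNat_inj hab
  · intro b hb
    simp only [Finset.mem_filter, Finset.mem_range, Bool.and_eq_true] at hb
    refine ⟨ESix.mk b hb.1 + u, ?_, ?_⟩
    · simp only [Finset.mem_filter, Finset.mem_univ, true_and, mem_XSix]
      have : ESix.mk b hb.1 + u - w = ESix.mk b hb.1 + (u - w) := by abel
      rw [this, add_sub_cancel_right, ESix.toNat_add, ESix.toNat_mk]
      exact hb.2
    · rw [add_sub_cancel_right, ESix.toNat_mk]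

lemma tab_uniq : ∀ d < 64, (tab d = tab 0 → d = 0) ∧ (tab d = tab 7 → d = 7) ∧
    (tab d = tab 13 → d = 13) ∧
    (tab d = tab 26 → d = 26) ∧ (tab d = tab 40 → d = 40) := by decide +kernel

lemma tab_res : ∀ a < 64, ∀ b < 64, (tab a = tab b ∧ tab (a ^^^ 7) = tab (b ^^^ 7) ∧
    tab (a ^^^ 13) = tab (b ^^^ 13) ∧ tab (a ^^^ 26) = tab (b ^^^ 26) ∧
    tab (a ^^^ 40) = tab (b ^^^ 40)) → a = b := by decide +kernel

lemma XSix_rigid : BipRigid XSix := by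
  intro f g hf hg hfg h0
  have hN : ∀ u w : ESix, tab (f u - f w).toNat = tab (u - w).toNat := by
    intro u w
    rw [← cn_XSix, ← cn_XSix]
    exact cn_pres _ f g hg hfg u w
  have hN0 : ∀ u : ESix, tab (f u).toNat = tab u.toNat := by
    intro u
    have := hN u 0
    rwa [h0, sub_zero, sub_zero] at this
  have fix : ∀ (d : ℕ) (hd : d < 64), (∀ c < 64, tab c = tab d → c = d) →
      ∀ u : ESix, tab ((f u).toNat ^^^ d) = tab (u.toNat ^^^ d) := by
    intro d hd hc u
    have h1 : f (ESix.mk d hd) = ESix.mk d hd :=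
      ESix.toNat_inj (hc _ (ESix.toNat_lt _) (hN0 _))
    have := hN u (ESix.mk d hd)
    rwa [h1, ESix.toNat_sub, ESix.toNat_sub, ESix.toNat_mk] at this
  have hfid : ∀ a, f a = a := by
    intro a
    apply ESix.toNat_inj
    refine tab_res _ (ESix.toNat_lt _) _ (ESix.toNat_lt _) ⟨hN0 a, ?_, ?_, ?_, ?_⟩
    · exact fix 7 (by norm_num) (fun c hc => (tab_uniq c hc).2.1) a
    · exact fix 13 (by norm_num) (fun c hc => (tab_uniq c hc).2.2.1) a
    · exact fix 26 (by norm_num) (fun c hc => (tab_uniq c hc).2.2.2.1) a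
    · exact fix 40 (by norm_num) (fun c hc => (tab_uniq c hc).2.2.2.2) a
  refine ⟨hfid, fun a => ?_⟩
  have h1 : cn XSix a (g a) = cn XSix 0 0 := by
    unfold cn
    have e : ∀ u : ESix, u - a ∈ XSix ↔ u - g a ∈ XSix := by
      intro u
      have hneg : ∀ p q : ESix, p - q = q - p := fun p q => by
        apply ESix.toNat_inj
        rw [ESix.toNat_sub, ESix.toNat_sub, Nat.xor_comm]
      rw [hneg u a, hneg u (g a), hfg u a, hfid]
    simp only [← e, and_self]
    apply Finset.card_bij (fun y _ => y - a)
    · intro y hy; simpa using hy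
    · intro y _ z _ h; simpa using h
    · intro y hy; exact ⟨y + a, by simpa using hy, by simp⟩
  rw [cn_XSix, cn_XSix, sub_self] at h1
  have := (tab_uniq _ (ESix.toNat_lt (a - g a))).1 h1
  have := sub_eq_zero.1 (ESix.toNat_inj (b := 0) this)
  exact this.symm

lemma hasRigid_ESix : HasRigid ESix := by
  have h : XSix.card = 28 := by decide +kernel
  have h' : Nat.card ESix = 64 := by rw [Nat.card_eq_fintype_card]; rfl
  exact ⟨XSix, by omega, by omega, XSix_rigid⟩

lemma HasRigid.step {A : Type*} [AddCommGroup A] [Finite A] (h : HasRigid A) :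
    HasRigid (ZMod 2 × A) := by
  classical
  have : Fintype A := Fintype.ofFinite A
  obtain ⟨X, h1, h2, h3⟩ := h
  rw [Nat.card_eq_fintype_card] at h2
  set Y : Finset (ZMod 2 × A) :=
    insert (1, 0) (Xᶜ.map (Function.Embedding.sectR (0 : ZMod 2) A)) with hY
  have m0 : ∀ a : A, ((0 : ZMod 2), a) ∈ Y ↔ a ∉ X := by
    intro a; simp [hY]
  have m1 : ∀ a : A, ((1 : ZMod 2), a) ∈ Y ↔ a = 0 := by
    intro a; simp [hY]
  have hcY : Y.card = (Fintype.card A - X.card) + 1 := by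
    rw [hY, Finset.card_insert_of_notMem (by simp), Finset.card_map, Finset.card_compl]
  have hz : ∀ i : ZMod 2, i = 0 ∨ i = 1 := by decide
  have hc : Nat.card (ZMod 2 × A) = 2 * Fintype.card A := by
    rw [Nat.card_eq_fintype_card, Fintype.card_prod, ZMod.card]
  refine ⟨Y, by omega, by omega, ?_⟩
  intro f g hf hg hfg h0
  -- common neighbours
  have big : ∀ u w : ZMod 2 × A, u.1 = w.1 → 3 ≤ cn Y u w := by
    rintro ⟨i, u⟩ ⟨j, w⟩ (rfl : i = j)
    have hle : ((X.map (addRightEmbedding u) ∪ X.map (addRightEmbedding w))ᶜ).card ≤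
        cn Y (i, u) (i, w) := by
      unfold cn
      apply Finset.card_le_card_of_injOn (fun a => (i, a))
      · intro a ha
        simp only [Finset.coe_compl, Finset.coe_union, Finset.coe_map, Set.mem_compl_iff,
          Set.mem_union, Set.mem_image, not_or, not_exists, not_and, Finset.mem_coe,
          addRightEmbedding_apply] at ha
        simp only [Finset.coe_filter, Finset.mem_univ, true_and, Set.mem_ofPred_eq,
          Prod.mk_sub_mk, sub_self, m0]
        exact ⟨fun hx => ha.1 _ hx (by simp), fun hx => ha.2 _ hx (by simp)⟩
      · intro a _ b _ hab
        simpa using hab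
    rw [Finset.card_compl] at hle
    have := Finset.card_union_le (X.map (addRightEmbedding u)) (X.map (addRightEmbedding w))
    simp only [Finset.card_map] at this
    omega
  have sub1 : ∀ i j : ZMod 2, i ≠ j → i - j = 1 := by decide
  have small : ∀ u w : ZMod 2 × A, u.1 ≠ w.1 → cn Y u w ≤ 2 := by
    intro u w huw
    have : Finset.univ.filter (fun y => y - u ∈ Y ∧ y - w ∈ Y) ⊆ {u + (1, 0), w + (1, 0)} := by
      intro y hy
      simp only [Finset.mem_filter, Finset.mem_univ, true_and] at hy
      simp only [Finset.mem_insert, Finset.mem_singleton]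
      have aux : ∀ v : ZMod 2 × A, y.1 ≠ v.1 → y - v ∈ Y → y = v + (1, 0) := by
        intro v hv hm
        have e : y - v = (1, y.2 - v.2) := Prod.ext (sub1 _ _ hv) rfl
        rw [e, m1] at hm
        rw [← sub_eq_iff_eq_add', e, hm]
      by_cases hyu : y.1 = u.1
      · right
        exact aux w (by rwa [hyu]) hy.2
      · left
        exact aux u hyu hy.1
    exact (Finset.card_le_card this).trans Finset.card_le_two
  have hlev : ∀ u, (f u).1 = u.1 := by
    intro u
    have hp := cn_pres Y f g hg hfg u 0
    rw [h0] at hp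
    by_cases hu : u.1 = 0
    · by_contra hne
      have := big u 0 hu
      have := small (f u) 0 (by simpa [hu] using hne)
      omega
    · by_contra hne
      have := small u 0 hu
      have h5 : (f u).1 = 0 := by
        rcases hz (f u).1 with h | h
        · exact h
        · rcases hz u.1 with h' | h'
          · exact absurd h' hu
          · exact absurd (h.trans h'.symm) hne
      have := big (f u) 0 h5
      omega
  have hlevg : ∀ y, (g y).1 = y.1 := by
    intro y
    by_contra hne
    have hX : 1 < (Xᶜ).card := by rw [Finset.card_compl]; omega
    obtain ⟨a, ha, b, hb, hab⟩ := Finset.one_lt_card.1 hX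
    have aux : ∀ a ∈ Xᶜ, f (y - (0, a)) = g y - (1, 0) := by
      intro a ha
      have h6 : y - (y - (0, a)) ∈ Y := by
        rw [sub_sub_cancel, m0]; simpa using ha
      rw [hfg] at h6
      have e : g y - f (y - (0, a)) = (1, (g y - f (y - (0, a))).2) :=
        Prod.ext (sub1 _ _ (by rw [hlev]; simpa using hne)) rfl
      rw [e, m1] at h6
      rw [h6] at e
      rw [← e, sub_sub_cancel]
    have := hf ((aux a ha).trans (aux b hb).symm)
    simp at this
    exact hab this
  have res : ∀ i : ZMod 2, (∀ a, (f (i, a)).2 = a + (f (i, 0)).2) ∧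
      ∀ a, (g (i, a)).2 = a + (f (i, 0)).2 := by
    intro i
    apply h3.translate (fun a => (f (i, a)).2) (fun a => (g (i, a)).2)
    · intro a b hab
      have := hf (Prod.ext ((hlev (i, a)).trans (hlev (i, b)).symm) hab)
      simpa using this
    · intro a b hab
      have := hg (Prod.ext ((hlevg (i, a)).trans (hlevg (i, b)).symm) hab)
      simpa using this
    · intro u y
      have := hfg (i, u) (i, y)
      have e : g (i, y) - f (i, u) = (0, (g (i, y)).2 - (f (i, u)).2) :=
        Prod.ext (by rw [Prod.fst_sub, hlev, hlevg, sub_self]) rfl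
      rw [e, Prod.mk_sub_mk, sub_self, m0, m0] at this
      exact not_iff_not.1 this
  have t0 : (f (0, 0)).2 = 0 := by
    have : ((0 : ZMod 2), (0 : A)) = 0 := rfl
    rw [this, h0]; rfl
  have t1 : (f (1, 0)).2 = 0 := by
    have := hfg (0, 0) (1, 0)
    have e : g (1, 0) - f (0, 0) = (1, (f (1, 0)).2) :=
      Prod.ext (by rw [Prod.fst_sub, hlev, hlevg, sub_zero])
        (by rw [Prod.snd_sub, t0, (res 1).2]; simp)
    rw [e, Prod.mk_sub_mk, sub_zero, sub_zero, m1, m1] at this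
    exact this.1 rfl
  have t : ∀ i : ZMod 2, (f (i, 0)).2 = 0 := by
    intro i
    rcases hz i with rfl | rfl
    · exact t0
    · exact t1
  constructor
  · rintro ⟨i, a⟩
    exact Prod.ext (hlev _) (by rw [(res i).1, t]; simp)
  · rintro ⟨i, a⟩
    exact Prod.ext (hlevg _) (by rw [(res i).2, t]; simp)

lemma nonempty_equiv_of_exp_two {A : Type*} [AddCommGroup A] [Finite A]
    (h : ∀ a : A, 2 • a = 0) : ∃ m : ℕ, Nonempty (A ≃+ (Fin m → ZMod 2)) := by
  let _ : Module (ZMod 2) A := AddCommGroup.zmodModule h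
  exact ⟨_, ⟨(Module.finBasis (ZMod 2) A).equivFun.toAddEquiv⟩⟩

lemma hasRigid_fin (m : ℕ) (hm : 6 ≤ m) : HasRigid (Fin m → ZMod 2) := by
  induction m, hm using Nat.le_induction with
  | base =>
    obtain ⟨m, ⟨e⟩⟩ := nonempty_equiv_of_exp_two (A := ESix) (fun a => by
      rw [two_nsmul]
      apply ESix.toNat_inj
      rw [ESix.toNat_add, Nat.xor_self, ESix.toNat_zero])
    have h' : Nat.card ESix = 64 := by rw [Nat.card_eq_fintype_card]; rfl
    have : m = 6 := by
      rw [Nat.card_congr e.toEquiv] at h'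
      simp at h'
      exact Nat.pow_right_injective (le_refl 2) (h'.trans (by norm_num : 64 = 2 ^ 6))
    subst this
    exact hasRigid_ESix.equiv e
  | succ m hm ih =>
    refine ih.step.equiv (AddEquiv.mk (Fin.consEquiv (fun _ => ZMod 2)) ?_)
    intro x y
    funext i
    refine Fin.cases ?_ (fun j => ?_) i <;> simp [Fin.consEquiv]

lemma hasRigid_of_exp_two {A : Type*} [AddCommGroup A] [Finite A]
    (h : ∀ a : A, 2 • a = 0) (hc : 64 ≤ Nat.card A) : HasRigid A := by
  obtain ⟨m, ⟨e⟩⟩ := nonempty_equiv_of_exp_two h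
  refine (hasRigid_fin m ?_).equiv e.symm
  rw [Nat.card_congr e.toEquiv] at hc
  simp at hc
  by_contra hlt
  have : 2 ^ m ≤ 2 ^ 5 := Nat.pow_le_pow_right (by norm_num) (by omega)
  omega

lemma hasORR_of_rigid {G : Type*} [Group G] [Finite G] (W : Subgroup G)
    (hcomm : ∀ a ∈ W, ∀ b ∈ W, a * b = b * a) (hexp : ∀ a ∈ W, a ^ 2 = 1)
    (hcard : 64 ≤ Nat.card W) (x : G) (hconj : ∀ a ∈ W, x * a * x⁻¹ ∈ W)
    (hxx : x * x ∉ W) (hgen : Subgroup.closure ((W : Set G) ∪ {x}) = ⊤) : HasORR G := by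
  classical
  let _ : CommGroup W := { (inferInstance : Group W) with
    mul_comm := fun a b => Subtype.ext (hcomm a a.2 b b.2) }
  have hR : HasRigid (Additive W) := by
    apply hasRigid_of_exp_two
    · intro a
      have : (a.toMul) ^ 2 = 1 := Subtype.ext (by simpa using hexp a.toMul a.toMul.2)
      exact congrArg Additive.ofMul this
    · exact hcard
  obtain ⟨X, -, hX2, hX⟩ := hR
  -- multiplicative form of the rigid set
  obtain ⟨Q, hQ, hQX, hQR⟩ : ∃ Q : Finset W, 2 * Q.card + 3 ≤ Nat.card W ∧
      Q.card = X.card ∧ ∀ f g : W → W, Function.Injective f → Function.Injective g →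
      (∀ u y, y * u⁻¹ ∈ Q ↔ g y * (f u)⁻¹ ∈ Q) → f 1 = 1 → (∀ a, f a = a) ∧ ∀ a, g a = a := by
    refine ⟨X.map Additive.toMul.toEmbedding, by rw [Finset.card_map]; exact hX2, by simp, ?_⟩
    intro f g hf hg hfg h1
    refine hX f g hf hg ?_ h1
    intro u y
    have := hfg u y
    rw [Finset.mem_map_equiv, Finset.mem_map_equiv] at this
    have hs : ∀ p q : Additive W, p - q = Additive.ofMul (p.toMul * (q.toMul)⁻¹) := by
      intro p q
      rw [sub_eq_add_neg]; rfl
    have e1 := hs y u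
    have e2 := hs (Additive.ofMul (g y.toMul)) (Additive.ofMul (f u.toMul))
    exact (iff_of_eq (congrArg (· ∈ X) e1)).trans
      (this.trans (iff_of_eq (congrArg (· ∈ X) e2)).symm)
  have : Fintype W := Fintype.ofFinite W
  rw [Nat.card_eq_fintype_card] at hQ
  set S : Set G := {s | ∃ b : W, b ∉ Q ∧ s = x * b} with hS
  have hSx : ∀ b : W, x * (b : G) ∈ S ↔ b ∉ Q := by
    intro b
    constructor
    · rintro ⟨c, hc, h⟩
      have : b = c := Subtype.ext (mul_left_cancel h)
      rwa [this]
    · intro h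
      exact ⟨b, h, rfl⟩
  have pig : ∀ w : W, ∃ b : W, b ∉ Q ∧ b * w ∉ Q := by
    intro w
    by_contra! hcon
    have : (Finset.univ : Finset W) ⊆ Q ∪ Q.image (fun q => q * w⁻¹) := by
      intro b _
      rw [Finset.mem_union, Finset.mem_image]
      by_cases hb : b ∈ Q
      · exact Or.inl hb
      · exact Or.inr ⟨b * w, hcon b hb, by simp⟩
    have h1 := Finset.card_le_card this
    have h2 := Finset.card_union_le Q (Q.image (fun q => q * w⁻¹))
    have h3 : (Q.image (fun q => q * w⁻¹)).card ≤ Q.card := Finset.card_image_le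
    rw [Finset.card_univ] at h1
    omega
  have hcoset : ∀ g k : G, (∃ z, z * g⁻¹ ∈ S ∧ z * k⁻¹ ∈ S) ↔ k * g⁻¹ ∈ W := by
    intro g k
    constructor
    · rintro ⟨z, ⟨b, -, hb⟩, ⟨c, -, hc⟩⟩
      have h1 : k * g⁻¹ = (c : G)⁻¹ * b := by
        have hb' : z = x * b * g := by rw [← hb]; group
        have hc' : z = x * c * k := by rw [← hc]; group
        have : x * (b * g) = x * (c * k) := by rw [← mul_assoc, ← mul_assoc, ← hb', ← hc']
        have := mul_left_cancel this
        rw [mul_inv_eq_iff_eq_mul, mul_assoc, this]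
        group
      rw [h1]
      exact W.mul_mem (W.inv_mem c.2) b.2
    · intro h
      obtain ⟨b, hb, hbw⟩ := pig ⟨_, h⟩
      refine ⟨x * b * k, ?_, ?_⟩
      · have : x * b * k * g⁻¹ = x * ((b * ⟨_, h⟩ : W) : G) := by
          simp [mul_assoc]
        rw [this, hSx]
        exact hbw
      · rw [mul_inv_cancel_right, hSx]
        exact hb
  have main : ∀ ψ : Equiv.Perm G, IsCayleyAut S ψ → ψ 1 = 1 →
      ∀ w : W, ψ w = w ∧ ψ (x * w) = x * w := by
    intro ψ hψ h1
    have hW : ∀ w : W, ψ w ∈ W := by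
      intro w
      have h2 := (hcoset 1 (w : G)).2 (by simp)
      obtain ⟨z, hz1, hz2⟩ := h2
      have := (hcoset (ψ 1) (ψ w)).1 ⟨ψ z, (hψ _ _).1 hz1, (hψ _ _).1 hz2⟩
      simpa [h1] using this
    have hxW : ∀ w : W, x⁻¹ * ψ (x * w) ∈ W := by
      intro w
      obtain ⟨b, hb, -⟩ := pig 1
      have h2 : (x * w) * (((b⁻¹ * w : W) : G))⁻¹ ∈ S := by
        have : (x * w) * (((b⁻¹ * w : W) : G))⁻¹ = x * b := by
          simp
        rw [this, hSx]
        exact hb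
      rw [hψ] at h2
      obtain ⟨c, -, hc⟩ := h2
      rw [mul_inv_eq_iff_eq_mul] at hc
      rw [hc]
      have : x⁻¹ * (x * c * ψ ((b⁻¹ * w : W) : G)) = c * ψ ((b⁻¹ * w : W) : G) := by group
      rw [this]
      exact W.mul_mem c.2 (hW _)
    obtain ⟨hf, hg⟩ := hQR (fun w => ⟨ψ w, hW w⟩) (fun w => ⟨x⁻¹ * ψ (x * w), hxW w⟩)
      (fun a b hab => by
        have := congrArg Subtype.val hab
        exact Subtype.ext (ψ.injective this))
      (fun a b hab => by
        have := mul_left_cancel (congrArg Subtype.val hab)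
        exact Subtype.ext (mul_left_cancel (ψ.injective this)))
      (fun u y => by
        rw [← not_iff_not, ← hSx, ← hSx]
        have := hψ u (x * y)
        simp only [Subgroup.coe_mul, Subgroup.coe_inv]
        rw [← mul_assoc, this, ← mul_assoc, mul_inv_cancel_left])
      (Subtype.ext (by simpa using h1))
    intro w
    refine ⟨congrArg Subtype.val (hf w), ?_⟩
    have := congrArg Subtype.val (hg w)
    simp only at this
    rw [inv_mul_eq_iff_eq_mul] at this
    exact this
  have main2 : ∀ φ : Equiv.Perm G, IsCayleyAut S φ → φ 1 = 1 → ∀ g, φ g = g := by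
    intro φ hφ h1
    have step : ∀ g, φ g = g → ∀ w : W, φ (w * g) = w * g ∧ φ (x * w * g) = x * w * g := by
      intro g hg w
      have := main ((Equiv.mulRight g).trans (φ.trans (Equiv.mulRight g⁻¹)))
        (by
          intro a b
          have := hφ (a * g) (b * g)
          simp only [Equiv.trans_apply, Equiv.coe_mulRight]
          have e1 : b * g * (a * g)⁻¹ = b * a⁻¹ := by group
          have e2 : φ (b * g) * g⁻¹ * (φ (a * g) * g⁻¹)⁻¹ = φ (b * g) * (φ (a * g))⁻¹ := by group
          rw [e2, ← this, e1])
        (by simp [hg]) w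
      simp only [Equiv.trans_apply, Equiv.coe_mulRight, mul_inv_eq_iff_eq_mul] at this
      exact this
    have all : ∀ h : G, ∀ g, φ g = g → φ (h * g) = h * g := by
      intro h
      have hh : h ∈ Subgroup.closure ((W : Set G) ∪ {x}) := by rw [hgen]; trivial
      induction hh using Subgroup.closure_induction with
      | mem a ha =>
        intro g hg
        rcases ha with ha | ha
        · exact (step g hg ⟨a, ha⟩).1
        · rw [Set.mem_singleton_iff.1 ha]
          simpa using (step g hg 1).2
      | one => intro g hg; simpa using hg
      | mul a b _ _ iha ihb =>
        intro g hg
        rw [mul_assoc]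
        exact iha _ (ihb g hg)
      | inv a _ iha =>
        have hp : ∀ k : ℕ, ∀ g, φ g = g → φ (a ^ k * g) = a ^ k * g := by
          intro k
          induction k with
          | zero => intro g hg; simpa using hg
          | succ k ih =>
            intro g hg
            rw [pow_succ, mul_assoc]
            exact ih _ (iha g hg)
        have : a⁻¹ ∈ Submonoid.powers a :=
          mem_powers_iff_mem_zpowers.2 (Subgroup.inv_mem _ (Subgroup.mem_zpowers a))
        obtain ⟨k, hk⟩ := this
        rw [← hk]
        exact hp k
    intro g
    simpa using all g 1 h1
  refine ⟨S, ?_, ?_⟩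
  · ext s
    simp only [Set.mem_inter_iff, Set.mem_inv, Set.mem_empty_iff_false, iff_false, not_and]
    rintro ⟨b, -, hb⟩ ⟨c, -, hc⟩
    apply hxx
    have h1 : (x * b) * (x * c) = 1 := by rw [← hb, ← hc, mul_inv_cancel]
    have h2 : x * x = (x * b * x⁻¹)⁻¹ * ((x * b) * (x * c)) * (x⁻¹ * (x * (c : G)⁻¹ * x⁻¹) * x) := by
      group
    have h3 : x * x = (x * b * x⁻¹)⁻¹ * (c : G)⁻¹ := by
      rw [h2, h1]; group
    rw [h3]
    exact W.mul_mem (W.inv_mem (hconj _ b.2)) (W.inv_mem c.2)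
  · intro φ hφ
    refine ⟨φ 1, fun g => ?_⟩
    have := main2 (φ.trans (Equiv.mulRight (φ 1)⁻¹))
      (by
        intro a b
        simp only [Equiv.trans_apply, Equiv.coe_mulRight]
        have e2 : φ b * (φ 1)⁻¹ * (φ a * (φ 1)⁻¹)⁻¹ = φ b * (φ a)⁻¹ := by group
        rw [e2]
        exact hφ a b)
      (by simp) g
    simpa [mul_inv_eq_iff_eq_mul] using this

lemma closure_insert_cases {G : Type*} [Group G] (V : Subgroup G)
    (hVcomm : ∀ a ∈ V, ∀ b ∈ V, a * b = b * a) (hVexp : ∀ a ∈ V, a ^ 2 = 1)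
    (s : Set G) (a : G) (hs : s ⊆ V) (ha : a ∈ V) :
    ∀ g ∈ Subgroup.closure (insert a s),
      g ∈ Subgroup.closure s ∨ a * g ∈ Subgroup.closure s := by
  have hsV : Subgroup.closure s ≤ V := (Subgroup.closure_le V).2 hs
  have haa : a * a = 1 := by rw [← pow_two]; exact hVexp a ha
  have hC : Subgroup.closure (insert a s) ≤ V :=
    (Subgroup.closure_le V).2 (Set.insert_subset ha hs)
  intro g hg
  induction hg using Subgroup.closure_induction with
  | mem b hb =>
    rcases hb with rfl | hb
    · right; rw [haa]; exact Subgroup.one_mem _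
    · left; exact Subgroup.subset_closure hb
  | one => left; exact Subgroup.one_mem _
  | mul b c hb hc ihb ihc =>
    have hbV := hC hb
    have hcV := hC hc
    rcases ihb with h1 | h1 <;> rcases ihc with h2 | h2
    · left; exact Subgroup.mul_mem _ h1 h2
    · right
      have : a * (b * c) = b * (a * c) := by
        rw [← mul_assoc, hVcomm a ha b hbV, mul_assoc]
      rw [this]; exact Subgroup.mul_mem _ h1 h2
    · right
      rw [← mul_assoc]; exact Subgroup.mul_mem _ h1 h2
    · left
      have : b * c = (a * b) * (a * c) := by
        rw [hVcomm a ha b hbV, mul_assoc, ← mul_assoc a a c, haa, one_mul]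
      rw [this]; exact Subgroup.mul_mem _ h1 h2
  | inv b hb ih =>
    have : b⁻¹ = b := by
      rw [inv_eq_iff_mul_eq_one, ← pow_two]; exact hVexp b (hC hb)
    rwa [this]

lemma card_closure_insert_le {G : Type*} [Group G] [Finite G] (V : Subgroup G)
    (hVcomm : ∀ a ∈ V, ∀ b ∈ V, a * b = b * a) (hVexp : ∀ a ∈ V, a ^ 2 = 1)
    (s : Set G) (a : G) (hs : s ⊆ V) (ha : a ∈ V) :
    Nat.card (Subgroup.closure (insert a s)) ≤ 2 * Nat.card (Subgroup.closure s) := by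
  have h1 : (Subgroup.closure (insert a s) : Set G) ⊆
      (Subgroup.closure s : Set G) ∪ (fun g => a⁻¹ * g) '' (Subgroup.closure s : Set G) := by
    intro g hg
    rcases closure_insert_cases V hVcomm hVexp s a hs ha g hg with h | h
    · exact Or.inl h
    · exact Or.inr ⟨_, h, by simp⟩
  have h2 := Set.ncard_le_ncard h1 (Set.toFinite _)
  have h3 := Set.ncard_union_le (Subgroup.closure s : Set G)
    ((fun g => a⁻¹ * g) '' (Subgroup.closure s : Set G))
  have h4 := Set.ncard_image_le (f := fun g => a⁻¹ * g)
    (Set.toFinite (Subgroup.closure s : Set G))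
  have e1 : Nat.card (Subgroup.closure (insert a s)) =
    (Subgroup.closure (insert a s) : Set G).ncard := rfl
  have e2 : Nat.card (Subgroup.closure s) = (Subgroup.closure s : Set G).ncard := rfl
  omega

lemma card_closure_finset_le {G : Type*} [Group G] [Finite G] (V : Subgroup G)
    (hVcomm : ∀ a ∈ V, ∀ b ∈ V, a * b = b * a) (hVexp : ∀ a ∈ V, a ^ 2 = 1)
    (t : Finset G) (ht : (t : Set G) ⊆ V) :
    Nat.card (Subgroup.closure (t : Set G)) ≤ 2 ^ t.card := by
  classical
  induction t using Finset.induction_on with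
  | empty => simp
  | insert a t hat ih =>
    rw [Finset.coe_insert] at ht ⊢
    rw [Finset.card_insert_of_notMem hat, pow_succ]
    have h1 := card_closure_insert_le V hVcomm hVexp (t : Set G) a
      (fun b hb => ht (Set.mem_insert_of_mem _ hb)) (ht (Set.mem_insert _ _))
    have h2 := ih (fun b hb => ht (Set.mem_insert_of_mem _ hb))
    omega

/-- Let `G = ⟨V, x⟩` where `V` is an elementary abelian 2-group of rank `2ℓ+κ` with
`κ ≥ 1` and generating set `v 0, w 0, …, v (ℓ-1), w (ℓ-1), e 0, …, e (κ-1)`,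
`x² = e 0`, `x` swaps `v i` and `w i` by conjugation and fixes each `e i`.
If `2ℓ+κ ≥ 7`, then `G` admits an oriented regular representation. -/
theorem x_squared_e1_hasORR {G : Type*} [Group G] [Finite G]
    (ℓ κ : ℕ) (hκ : 0 < κ) (V : Subgroup G)
    (v w : Fin ℓ → G) (e : Fin κ → G)
    (hVgen : Subgroup.closure (Set.range v ∪ Set.range w ∪ Set.range e) = V)
    (hVcomm : ∀ a ∈ V, ∀ b ∈ V, a * b = b * a)
    (hVexp : ∀ a ∈ V, a ^ 2 = 1)
    (hVcard : Nat.card V = 2 ^ (2 * ℓ + κ))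
    (x : G) (hx2 : x * x = e ⟨0, hκ⟩)
    (hgen : Subgroup.closure ((V : Set G) ∪ {x}) = ⊤)
    (hxv : ∀ i, x⁻¹ * v i * x = w i)
    (hxw : ∀ i, x⁻¹ * w i * x = v i)
    (hxe : ∀ i, x⁻¹ * e i * x = e i)
    (hrank : 7 ≤ 2 * ℓ + κ) :
    HasORR G := by
  classical
  set i0 : Fin κ := ⟨0, hκ⟩ with hi0
  set t : Finset G := Finset.univ.image v ∪ Finset.univ.image w ∪
    (Finset.univ.erase i0).image e with ht
  have hgenV : ∀ g ∈ Set.range v ∪ Set.range w ∪ Set.range e, g ∈ V := by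
    intro g hg
    rw [← hVgen]
    exact Subgroup.subset_closure hg
  have hvV : ∀ i, v i ∈ V := fun i => hgenV _ (Or.inl (Or.inl ⟨i, rfl⟩))
  have hwV : ∀ i, w i ∈ V := fun i => hgenV _ (Or.inl (Or.inr ⟨i, rfl⟩))
  have heV : ∀ i, e i ∈ V := fun i => hgenV _ (Or.inr ⟨i, rfl⟩)
  have hmem : ∀ g, g ∈ t ↔ (∃ i, v i = g) ∨ (∃ i, w i = g) ∨ ∃ i, i ≠ i0 ∧ e i = g := by
    intro g
    simp [ht]
  have htV : (t : Set G) ⊆ V := by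
    intro g hg
    rcases (hmem g).1 hg with ⟨i, rfl⟩ | ⟨i, rfl⟩ | ⟨i, -, rfl⟩
    · exact hvV i
    · exact hwV i
    · exact heV i
  have htc : t.card + 1 ≤ 2 * ℓ + κ := by
    have h1 : t.card ≤ _ := Finset.card_union_le _ _
    have h2 := Finset.card_union_le (Finset.univ.image v) (Finset.univ.image w)
    have h3 : (Finset.univ.image v).card ≤ _ := Finset.card_image_le
    have h4 : (Finset.univ.image w).card ≤ _ := Finset.card_image_le
    have h5 : ((Finset.univ.erase i0).image e).card ≤ _ := Finset.card_image_le
    rw [Finset.card_erase_of_mem (Finset.mem_univ _)] at h5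
    simp only [Finset.card_univ, Fintype.card_fin] at h3 h4 h5
    omega
  have hins : Subgroup.closure (insert (e i0) (t : Set G)) = V := by
    apply le_antisymm
    · exact (Subgroup.closure_le V).2 (Set.insert_subset (heV i0) htV)
    · rw [← hVgen]
      apply Subgroup.closure_mono
      rintro g ((⟨i, rfl⟩ | ⟨i, rfl⟩) | ⟨i, rfl⟩)
      · exact Or.inr ((hmem _).2 (Or.inl ⟨i, rfl⟩))
      · exact Or.inr ((hmem _).2 (Or.inr (Or.inl ⟨i, rfl⟩)))
      · by_cases hi : i = i0
        · rw [hi]; exact Or.inl rfl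
        · exact Or.inr ((hmem _).2 (Or.inr (Or.inr ⟨i, hi, rfl⟩)))
  set W : Subgroup G := Subgroup.closure (t : Set G) with hW
  have hWV : W ≤ V := (Subgroup.closure_le V).2 htV
  have hub : Nat.card W ≤ 2 ^ t.card := card_closure_finset_le V hVcomm hVexp t htV
  have hlb : Nat.card V ≤ 2 * Nat.card W := by
    have := card_closure_insert_le V hVcomm hVexp (t : Set G) (e i0) htV (heV i0)
    rwa [hins] at this
  have he0 : e i0 ∉ W := by
    intro h
    have hVW : V ≤ W := by
      rw [← hins]
      exact (Subgroup.closure_le W).2 (Set.insert_subset h Subgroup.subset_closure)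
    have heq : V = W := le_antisymm hVW hWV
    rw [← heq, hVcard] at hub
    have := (Nat.pow_le_pow_iff_right (by norm_num : 1 < 2)).1 hub
    omega
  apply hasORR_of_rigid W (fun a ha b hb => hVcomm a (hWV ha) b (hWV hb))
    (fun a ha => hVexp a (hWV ha)) ?_ x ?_ (by rw [hx2]; exact he0) ?_
  · have : 2 ^ 7 ≤ 2 ^ (2 * ℓ + κ) := Nat.pow_le_pow_right (by norm_num) hrank
    omega
  · have hinv : ∀ a ∈ W, x⁻¹ * a * x ∈ W := by
      intro a ha
      induction ha using Subgroup.closure_induction with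
      | mem a ha =>
        apply Subgroup.subset_closure
        rcases (hmem a).1 ha with ⟨i, rfl⟩ | ⟨i, rfl⟩ | ⟨i, hi, rfl⟩
        · rw [hxv]; exact (hmem _).2 (Or.inr (Or.inl ⟨i, rfl⟩))
        · rw [hxw]; exact (hmem _).2 (Or.inl ⟨i, rfl⟩)
        · rw [hxe]; exact (hmem _).2 (Or.inr (Or.inr ⟨i, hi, rfl⟩))
      | one => simp
      | mul a b _ _ iha ihb =>
        have : x⁻¹ * (a * b) * x = (x⁻¹ * a * x) * (x⁻¹ * b * x) := by group
        rw [this]; exact W.mul_mem iha ihb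
      | inv a _ iha =>
        have : x⁻¹ * a⁻¹ * x = (x⁻¹ * a * x)⁻¹ := by group
        rw [this]; exact W.inv_mem iha
    intro a ha
    have hc : x * x * a = a * (x * x) := by
      rw [hx2]; exact hVcomm _ (heV _) _ (hWV ha)
    have : x * a * x⁻¹ = x⁻¹ * a * x := by
      have h1 : x * a * x⁻¹ = x⁻¹ * (x * x * a) * x⁻¹ := by group
      rw [h1, hc]; group
    rw [this]
    exact hinv a ha
  · rw [eq_top_iff, ← hgen, Subgroup.closure_le]
    have hxC : x ∈ Subgroup.closure ((W : Set G) ∪ {x}) := Subgroup.subset_closure (Or.inr rfl)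
    rintro g (hg | hg)
    · have hVC : V ≤ Subgroup.closure ((W : Set G) ∪ {x}) := by
        rw [← hins, Subgroup.closure_le]
        apply Set.insert_subset
        · rw [← hx2]; exact Subgroup.mul_mem _ hxC hxC
        · intro g hg
          exact Subgroup.subset_closure (Or.inl (Subgroup.subset_closure hg))
      exact hVC hg
    · rw [Set.mem_singleton_iff.1 hg]; exact hxC
end

section
/- Let G = ⟨A, g, n⟩ be a 2-group where A ≅ C4 × C2^k is abelian, generated by a_1,…,a_{k+1} with a_1 of order 4 and a_i of order 2 for i ∈ {2,…,k+1}; g^2 = 1; conjugation by g inverts every element of A; n^g = n^{-1}; n normalises A; and n^2 ∈ A. If G is not generalised dihedral, then there exists a ∈ A such that a has order greater than 2 and a is not centralised by n (that is, a^n ≠ a). -/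
/-- Let `G = ⟨A, g, n⟩` be a 2-group where `A ≅ C₄ × C₂^k` is abelian with generators
`a 0, …, a k` (`a 0` of order 4, the rest of order 2), `g² = 1`, conjugation by `g`
inverts `A`, `nᵍ = n⁻¹`, `n` normalises `A` and `n² ∈ A`. If `G` is not generalised
dihedral, then some `y ∈ A` of order greater than 2 is not centralised by `n`. -/
theorem exists_not_centralised {G : Type*} [Group G] [Finite G]
    (k : ℕ) (hG : IsPGroup 2 G)
    (A : Subgroup G)
    (hAiso : Nonempty (A ≃* Multiplicative (ZMod 4 × (Fin k → ZMod 2))))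
    (hAcomm : ∀ y ∈ A, ∀ z ∈ A, y * z = z * y)
    (a : Fin (k + 1) → G)
    (hagen : Subgroup.closure (Set.range a) = A)
    (ha0 : orderOf (a 0) = 4)
    (hai : ∀ i : Fin (k + 1), i ≠ 0 → orderOf (a i) = 2)
    (g n : G)
    (hgen : Subgroup.closure ((A : Set G) ∪ {g, n}) = ⊤)
    (hg2 : g * g = 1)
    (hginv : ∀ y ∈ A, g⁻¹ * y * g = y⁻¹)
    (hng : g⁻¹ * n * g = n⁻¹)
    (hnnorm : ∀ y ∈ A, n⁻¹ * y * n ∈ A)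
    (hn2 : n * n ∈ A)
    (hngd : ¬ IsGeneralizedDihedral G) :
    ∃ y ∈ A, 2 < orderOf y ∧ n⁻¹ * y * n ≠ y := by
  by_contra hcon
  have hcon' : ∀ y ∈ A, 2 < orderOf y → n⁻¹ * y * n = y := by
    intro y hy h2
    by_contra h
    exact hcon ⟨y, hy, h2, h⟩
  have hgi : g⁻¹ = g := inv_eq_of_mul_eq_one_left hg2
  have h0A : a 0 ∈ A := hagen ▸ Subgroup.subset_closure ⟨0, rfl⟩
  have hsq : a 0 * a 0 ≠ 1 := by
    intro h
    have := orderOf_dvd_of_pow_eq_one (x := a 0) (n := 2) (by rw [pow_two, h])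
    rw [ha0] at this
    omega
  have hord : ∀ y : G, y * y ≠ 1 → 2 < orderOf y := by
    intro y hy
    by_contra h
    have hp := orderOf_pos y
    have hd : orderOf y ∣ 2 := by
      have : orderOf y = 1 ∨ orderOf y = 2 := by omega
      rcases this with h | h <;> simp [h]
    exact hy (by rw [← pow_two]; exact orderOf_dvd_iff_pow_eq_one.1 hd)
  have hc : ∀ y ∈ A, y * y ≠ 1 → y * n = n * y := by
    intro y hy h
    have h1 := hcon' y hy (hord y h)
    calc y * n = n * (n⁻¹ * y * n) := by group
      _ = n * y := by rw [h1]
  have hcent : ∀ y ∈ A, y * n = n * y := by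
    intro y hy
    by_cases h : y * y = 1
    · have e0 := hc _ h0A hsq
      have e1 := hc (a 0 * y) (A.mul_mem h0A hy) (by
        have : a 0 * y * (a 0 * y) = a 0 * a 0 * (y * y) := by
          have := hAcomm y hy _ h0A
          calc a 0 * y * (a 0 * y) = a 0 * (y * a 0) * y := by group
            _ = _ := by rw [this]; group
        rw [this, h, mul_one]
        exact hsq)
      rw [mul_assoc, ← mul_assoc n, ← e0, mul_assoc] at e1
      exact mul_left_cancel e1
    · exact hc y hy h
  let S : Set G := (A : Set G) ∪ {n}
  let B : Subgroup G := Subgroup.closure S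
  have hS : ∀ x ∈ S, ∀ y ∈ S, x * y = y * x := by
    rintro x (hx | rfl) y (hy | rfl)
    · exact hAcomm x hx y hy
    · exact hcent x hx
    · exact (hcent y hy).symm
    · rfl
  have hSB : ∀ x ∈ S, ∀ y ∈ B, x * y = y * x := by
    intro x hx y hy
    refine Subgroup.closure_induction (p := fun y _ => Commute x y) ?_ ?_ ?_ ?_ hy
    · intro z hz; exact hS x hx z hz
    · exact Commute.one_right x
    · intro u v _ _ hu hv; exact hu.mul_right hv
    · intro u _ hu; exact hu.inv_right
  have hB : ∀ x ∈ B, ∀ y ∈ B, x * y = y * x := by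
    intro x hx y hy
    refine Subgroup.closure_induction (p := fun x _ => Commute x y) ?_ ?_ ?_ ?_ hx
    · intro z hz; exact hSB z hz y hy
    · exact Commute.one_left y
    · intro u v _ _ hu hv; exact hu.mul_left hv
    · intro u _ hu; exact hu.inv_left
  have hinv : ∀ x ∈ B, g * x * g = x⁻¹ := by
    intro x hx
    refine Subgroup.closure_induction (p := fun x _ => g * x * g = x⁻¹) ?_ ?_ ?_ ?_ hx
    · rintro z (hz | rfl)
      · have := hginv z hz
        rwa [hgi] at this
      · rwa [hgi] at hng
    · simpa using hg2
    · intro u v hu' hv' hu hv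
      calc g * (u * v) * g = g * u * (g * g) * v * g := by rw [hg2]; group
        _ = (g * u * g) * (g * v * g) := by group
        _ = (v * u)⁻¹ := by rw [hu, hv, mul_inv_rev]
        _ = _ := by rw [hB v hv' u hu']
    · intro u _ hu
      rw [← hu, mul_inv_rev, mul_inv_rev, hgi, ← hu]
      simp only [mul_assoc]
  have hAB : ∀ x ∈ A, x ∈ B := fun x hx => Subgroup.subset_closure (Or.inl hx)
  have hnB : n ∈ B := Subgroup.subset_closure (Or.inr rfl)
  apply hngd
  refine ⟨B, hB, g, ?_, hg2, hinv, ?_⟩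
  · intro hgB
    have h1 := hinv _ (hAB _ h0A)
    rw [hB g hgB _ (hAB _ h0A), mul_assoc, hg2, mul_one] at h1
    apply hsq
    nth_rewrite 2 [h1]
    simp
  · have hswap : ∀ x ∈ B, g * x = x⁻¹ * g := by
      intro x hx
      rw [← hinv x hx, mul_assoc, hg2, mul_one]
    intro x
    have hx : x ∈ Subgroup.closure ((A : Set G) ∪ {g, n}) := hgen ▸ Subgroup.mem_top x
    refine Subgroup.closure_induction
      (p := fun x _ => x ∈ B ∨ ∃ b ∈ B, x = b * g) ?_ ?_ ?_ ?_ hx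
    · rintro z (hz | rfl | rfl)
      · exact Or.inl (hAB z hz)
      · exact Or.inr ⟨1, B.one_mem, by simp⟩
      · exact Or.inl hnB
    · exact Or.inl B.one_mem
    · rintro u v _ _ (hu | ⟨b, hb, rfl⟩) (hv | ⟨c, hc, rfl⟩)
      · exact Or.inl (B.mul_mem hu hv)
      · exact Or.inr ⟨u * c, B.mul_mem hu hc, by group⟩
      · exact Or.inr ⟨b * v⁻¹, B.mul_mem hb (B.inv_mem hv), by
          rw [mul_assoc, hswap v hv, mul_assoc]⟩
      · left
        have : b * g * (c * g) = b * c⁻¹ := by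
          rw [← hinv c hc]; group
        rw [this]
        exact B.mul_mem hb (B.inv_mem hc)
    · rintro u _ (hu | ⟨b, hb, rfl⟩)
      · exact Or.inl (B.inv_mem hu)
      · exact Or.inr ⟨b, hb, by
          rw [mul_inv_rev, hgi, hswap _ (B.inv_mem hb), inv_inv]⟩
end

section
/- Let G = ⟨A, g, n⟩ be a 2-group where A ≅ C4 × C2^k is abelian, generated by a_1,…,a_{k+1} with a_1 of order 4 and a_i of order 2 for i ∈ {2,…,k+1}; g^2 = 1; conjugation by g inverts every element of A; n^g = n^{-1}; n normalises A; and n^2 ∈ A. If n has order 2 and G is not generalised dihedral, then there exists a ∈ A such that a has order greater than 2 and a is not inverted by n (that is, a^n ≠ a^{-1}). -/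
/-- The subgroup `H ∪ H t` for an involution `t` normalising `H`. -/
def extInv {G : Type*} [Group G] (H : Subgroup G) (t : G) (ht : t * t = 1)
    (hH : ∀ x ∈ H, t * x * t ∈ H) : Subgroup G where
  carrier := {x | x ∈ H ∨ x * t ∈ H}
  one_mem' := Or.inl H.one_mem
  mul_mem' := by
    rintro x y (hx | hx) (hy | hy)
    · exact Or.inl (H.mul_mem hx hy)
    · right
      rw [mul_assoc]
      exact H.mul_mem hx hy
    · right
      have h := H.mul_mem hx (hH y hy)
      have e : x * t * (t * y * t) = x * (t * t) * y * t := by group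
      rw [e, ht, mul_one] at h
      exact h
    · left
      have h := H.mul_mem hx (hH _ hy)
      have e : x * t * (t * (y * t) * t) = x * (t * t) * y * (t * t) := by
        simp only [mul_assoc]
      rw [e, ht, mul_one, mul_one] at h
      exact h
  inv_mem' := by
    rintro x (hx | hx)
    · exact Or.inl (H.inv_mem hx)
    · right
      have h := hH _ (H.inv_mem hx)
      have e : t * (x * t)⁻¹ * t = x⁻¹ * t := by group
      rw [e] at h
      exact h

/-- Let `G = ⟨A, g, n⟩` be a 2-group where `A ≅ C₄ × C₂^k` is abelian with generators
`a 0, …, a k` (`a 0` of order 4, the rest of order 2), `g² = 1`, conjugation by `g`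
inverts `A`, `nᵍ = n⁻¹`, `n` normalises `A` and `n² ∈ A`. If `n` has order 2 and
`G` is not generalised dihedral, then some `y ∈ A` of order greater than 2 is not
inverted by `n`. -/
theorem exists_not_inverted {G : Type*} [Group G] [Finite G]
    (k : ℕ) (hG : IsPGroup 2 G)
    (A : Subgroup G)
    (hAiso : Nonempty (A ≃* Multiplicative (ZMod 4 × (Fin k → ZMod 2))))
    (hAcomm : ∀ y ∈ A, ∀ z ∈ A, y * z = z * y)
    (a : Fin (k + 1) → G)
    (hagen : Subgroup.closure (Set.range a) = A)
    (ha0 : orderOf (a 0) = 4)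
    (hai : ∀ i : Fin (k + 1), i ≠ 0 → orderOf (a i) = 2)
    (g n : G)
    (hgen : Subgroup.closure ((A : Set G) ∪ {g, n}) = ⊤)
    (hg2 : g * g = 1)
    (hginv : ∀ y ∈ A, g⁻¹ * y * g = y⁻¹)
    (hng : g⁻¹ * n * g = n⁻¹)
    (hnnorm : ∀ y ∈ A, n⁻¹ * y * n ∈ A)
    (hn2 : n * n ∈ A)
    (hn : orderOf n = 2)
    (hngd : ¬ IsGeneralizedDihedral G) :
    ∃ y ∈ A, 2 < orderOf y ∧ n⁻¹ * y * n ≠ y⁻¹ := by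
  by_contra! hcon
  have hord : ∀ y : G, y * y ≠ 1 → 2 < orderOf y := by
    intro y hy
    by_contra hlt
    have hpos := orderOf_pos y
    apply hy
    rw [← pow_two, ← orderOf_dvd_iff_pow_eq_one]
    have : orderOf y = 1 ∨ orderOf y = 2 := by omega
    rcases this with h | h <;> rw [h]
    norm_num
  have ha0A : a 0 ∈ A := by
    rw [← hagen]
    exact Subgroup.subset_closure ⟨0, rfl⟩
  have ha0sq : a 0 * a 0 ≠ 1 := by
    rw [← pow_two]
    intro h
    have := orderOf_dvd_of_pow_eq_one h
    rw [ha0] at this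
    norm_num at this
  have hnn : n * n = 1 := by
    rw [← pow_two, ← hn]
    exact pow_orderOf_eq_one n
  have hninv : n⁻¹ = n := inv_eq_of_mul_eq_one_left hnn
  have hgi : g⁻¹ = g := inv_eq_of_mul_eq_one_left hg2
  rw [hninv, hgi] at hng
  rw [hgi] at hginv
  rw [hninv] at hcon
  have hinv : ∀ y ∈ A, n * y * n = y⁻¹ := by
    intro y hy
    by_cases h : y * y = 1
    · have h0 := hcon _ ha0A (hord _ ha0sq)
      have hsq : (a 0 * y) * (a 0 * y) ≠ 1 := by
        have e : (a 0 * y) * (a 0 * y) = (a 0 * a 0) * (y * y) := by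
          rw [mul_assoc, ← mul_assoc y, hAcomm y hy _ ha0A]
          simp only [mul_assoc]
        rw [e, h, mul_one]
        exact ha0sq
      have h1 := hcon _ (A.mul_mem ha0A hy) (hord _ hsq)
      have e : n * (a 0 * y) * n = (n * a 0 * n) * (n * y * n) := by
        have : (n * a 0 * n) * (n * y * n) = n * a 0 * (n * n) * y * n := by
          simp only [mul_assoc]
        rw [this, hnn, mul_one]
        simp only [mul_assoc]
      rw [e, h0, hAcomm _ ha0A _ hy, mul_inv_rev] at h1
      exact mul_left_cancel h1
    · exact hcon y hy (hord y h)
  have hgn : g * n = n * g := by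
    calc g * n = g * n * (g * g) := by rw [hg2, mul_one]
      _ = (g * n * g) * g := by simp only [mul_assoc]
      _ = n * g := by rw [hng]
  obtain ⟨t, htdef⟩ : ∃ t, t = g * n := ⟨_, rfl⟩
  have htt : t * t = 1 := by
    calc t * t = (g * n) * (n * g) := by rw [htdef, ← hgn]
      _ = g * (n * n) * g := by simp only [mul_assoc]
      _ = 1 := by rw [hnn, mul_one, hg2]
  have htA : ∀ y ∈ A, t * y * t = y := by
    intro y hy
    calc t * y * t = (g * n) * y * (n * g) := by rw [htdef, ← hgn]
      _ = g * (n * y * n) * g := by simp only [mul_assoc]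
      _ = y := by rw [hinv y hy, hginv _ (A.inv_mem hy), inv_inv]
  have htc : ∀ y ∈ A, t * y = y * t := by
    intro y hy
    calc t * y = t * y * (t * t) := by rw [htt, mul_one]
      _ = (t * y * t) * t := by simp only [mul_assoc]
      _ = y * t := by rw [htA y hy]
  have hgt : g * t * g = t := by
    rw [htdef, ← mul_assoc, hg2, one_mul, hgn]
  have htinv : t⁻¹ = t := inv_eq_of_mul_eq_one_left htt
  let B := extInv A t htt (fun x hx => by rw [htA x hx]; exact hx)
  have hBmem : ∀ x ∈ B, ∃ y ∈ A, x = y ∨ x = y * t := by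
    rintro x (hx | hx)
    · exact ⟨x, hx, Or.inl rfl⟩
    · exact ⟨x * t, hx, Or.inr (by rw [mul_assoc, htt, mul_one])⟩
  have htB : t ∈ B := Or.inr (by rw [htt]; exact A.one_mem)
  have hAB : ∀ y ∈ A, y ∈ B := fun y hy => Or.inl hy
  have hBA : ∀ x ∈ B, ∀ y ∈ A, x * y = y * x := by
    intro x hx y hy
    obtain ⟨z, hz, rfl | rfl⟩ := hBmem x hx
    · exact hAcomm _ hz _ hy
    · rw [mul_assoc, htc y hy, ← mul_assoc, hAcomm z hz y hy, mul_assoc]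
  have hBt : ∀ x ∈ B, x * t = t * x := by
    intro x hx
    obtain ⟨z, hz, rfl | rfl⟩ := hBmem x hx
    · exact (htc _ hz).symm
    · rw [← mul_assoc t, htc z hz]
  have hBinv : ∀ x ∈ B, g * x * g = x⁻¹ := by
    intro x hx
    obtain ⟨z, hz, rfl | rfl⟩ := hBmem x hx
    · exact hginv _ hz
    · calc g * (z * t) * g = g * z * (g * g) * t * g := by
            rw [hg2, mul_one, ← mul_assoc g]
        _ = (g * z * g) * (g * t * g) := by simp only [mul_assoc]
        _ = (z * t)⁻¹ := by
            rw [hgt, hginv z hz, ← htc _ (A.inv_mem hz), mul_inv_rev, htinv]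
  have hgB : g ∉ B := by
    intro h
    have h1 := hginv _ ha0A
    rw [hBA g h _ ha0A, mul_assoc, hg2, mul_one] at h1
    apply ha0sq
    nth_rewrite 1 [h1]
    exact inv_mul_cancel _
  let C := extInv B g hg2 (fun x hx => by rw [hBinv x hx]; exact B.inv_mem hx)
  have hC : ∀ x : G, x ∈ C := by
    have hle : Subgroup.closure ((A : Set G) ∪ {g, n}) ≤ C := by
      rw [Subgroup.closure_le]
      rintro x (hx | rfl | rfl)
      · exact Or.inl (hAB x hx)
      · exact Or.inr (by rw [hg2]; exact B.one_mem)
      · exact Or.inr (by rw [← hgn, ← htdef]; exact htB)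
    rw [hgen] at hle
    exact fun x => hle (Subgroup.mem_top x)
  apply hngd
  refine ⟨B, ?_, g, hgB, hg2, hBinv, ?_⟩
  · intro x hx y hy
    obtain ⟨z, hz, rfl | rfl⟩ := hBmem y hy
    · exact hBA x hx _ hz
    · rw [← mul_assoc, hBA x hx z hz, mul_assoc, hBt x hx, mul_assoc]
  · intro x
    rcases hC x with h | h
    · exact Or.inl h
    · exact Or.inr ⟨x * g, h, by rw [mul_assoc, hg2, mul_one]⟩
end
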